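/- Let q be a power of an odd prime, F_q a finite field with q elements, m ≥ 0, and let J ∈ M_{2m+1}(F_q) be an invertible symmetric matrix. Let H = O(J) = {g ∈ GL(2m+1, F_q) : gᵀ J g = J} and let S be a complete set of irreducible complex representations of H. Then Σ_{σ ∈ S} dim σ = 2 · Σ_{k=0}^{m} q^{2k(m−k+1)} · binom(m,k)_{q²} (as real numbers). -/

import Mathlib

open Matrix CategoryTheory
open scoped Classical

noncomputable section

/-- The Frobenius–Schur indicator of a complex-valued function on a finite group. -/
def fsIndicator (G : Type*) [Group G] [Fintype G] (χ : G → ℂ) : ℂ :=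
  (Fintype.card G : ℂ)⁻¹ * ∑ g : G, χ (g * g)

/-- The twisted Frobenius–Schur indicator of a complex-valued function on a finite group,
with respect to a map `σ`. -/
def twistedFSIndicator (G : Type*) [Group G] [Fintype G] (σ : G → G) (χ : G → ℂ) : ℂ :=
  (Fintype.card G : ℂ)⁻¹ * ∑ g : G, χ (g * σ g)

/-- A complex-valued function is real-valued if all its values are real. -/
def IsRealValued {G : Type*} (χ : G → ℂ) : Prop := ∀ g : G, ∃ r : ℝ, χ g = (r : ℂ)

/-- The Gaussian binomial coefficient `binom(m,k)_q` as a real number. -/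
def gbinom (m k : ℕ) (q : ℝ) : ℝ := ∏ i ∈ Finset.Icc 1 k, (q ^ (m - k + i) - 1) / (q ^ i - 1)

section Groups

variable {N F : Type*} [Fintype N] [DecidableEq N] [Field F]

theorem sim_one (J : Matrix N N F) :
    ((1 : GL N F) : Matrix N N F)ᵀ * J * ((1 : GL N F) : Matrix N N F) = ((1 : Fˣ) : F) • J := by
  simp

theorem sim_mul {J : Matrix N N F} (a b : GL N F) (c d : Fˣ)
    (hc : (a : Matrix N N F)ᵀ * J * (a : Matrix N N F) = (c : F) • J)
    (hd : (b : Matrix N N F)ᵀ * J * (b : Matrix N N F) = (d : F) • J) :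
    ((a * b : GL N F) : Matrix N N F)ᵀ * J * ((a * b : GL N F) : Matrix N N F)
      = ((c * d : Fˣ) : F) • J := by
  calc ((a * b : GL N F) : Matrix N N F)ᵀ * J * ((a * b : GL N F) : Matrix N N F)
      = (b : Matrix N N F)ᵀ * ((a : Matrix N N F)ᵀ * J * (a : Matrix N N F)) *
          (b : Matrix N N F) := by
        rw [show ((a * b : GL N F) : Matrix N N F) = (a : Matrix N N F) * b from rfl,
          transpose_mul]
        simp only [Matrix.mul_assoc]
    _ = (b : Matrix N N F)ᵀ * ((c : F) • J) * (b : Matrix N N F) := by rw [hc]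
    _ = (c : F) • ((b : Matrix N N F)ᵀ * J * (b : Matrix N N F)) := by
        rw [Matrix.mul_smul, Matrix.smul_mul]
    _ = (c : F) • ((d : F) • J) := by rw [hd]
    _ = ((c * d : Fˣ) : F) • J := by rw [smul_smul, Units.val_mul]

theorem sim_inv {J : Matrix N N F} (a : GL N F) (c : Fˣ)
    (hc : (a : Matrix N N F)ᵀ * J * (a : Matrix N N F) = (c : F) • J) :
    ((a⁻¹ : GL N F) : Matrix N N F)ᵀ * J * ((a⁻¹ : GL N F) : Matrix N N F)
      = ((c⁻¹ : Fˣ) : F) • J := by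
  have ht : ((a⁻¹ : GL N F) : Matrix N N F)ᵀ * (a : Matrix N N F)ᵀ = 1 := by
    rw [← transpose_mul, a.mul_inv, transpose_one]
  have key : ((a⁻¹ : GL N F) : Matrix N N F)ᵀ * ((a : Matrix N N F)ᵀ * J * (a : Matrix N N F)) *
      ((a⁻¹ : GL N F) : Matrix N N F) = J := by
    calc ((a⁻¹ : GL N F) : Matrix N N F)ᵀ * ((a : Matrix N N F)ᵀ * J * (a : Matrix N N F)) *
        ((a⁻¹ : GL N F) : Matrix N N F)
        = (((a⁻¹ : GL N F) : Matrix N N F)ᵀ * (a : Matrix N N F)ᵀ) * J *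
          ((a : Matrix N N F) * ((a⁻¹ : GL N F) : Matrix N N F)) := by
          simp only [Matrix.mul_assoc]
      _ = J := by rw [ht, a.mul_inv, Matrix.one_mul, Matrix.mul_one]
  have key2 : ((a⁻¹ : GL N F) : Matrix N N F)ᵀ * ((c : F) • J) * ((a⁻¹ : GL N F) : Matrix N N F)
      = (c : F) • (((a⁻¹ : GL N F) : Matrix N N F)ᵀ * J * ((a⁻¹ : GL N F) : Matrix N N F)) := by
    rw [Matrix.mul_smul, Matrix.smul_mul]
  have h3 : (c : F) • (((a⁻¹ : GL N F) : Matrix N N F)ᵀ * J *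
      ((a⁻¹ : GL N F) : Matrix N N F)) = J := by rw [← key2, ← hc, key]
  calc ((a⁻¹ : GL N F) : Matrix N N F)ᵀ * J * ((a⁻¹ : GL N F) : Matrix N N F)
      = ((c⁻¹ : Fˣ) : F) • ((c : F) • (((a⁻¹ : GL N F) : Matrix N N F)ᵀ * J *
          ((a⁻¹ : GL N F) : Matrix N N F))) := by
        rw [smul_smul, ← Units.val_mul, inv_mul_cancel, Units.val_one, one_smul]
    _ = ((c⁻¹ : Fˣ) : F) • J := by rw [h3]

/-- The similitude group of the bilinear form given by the matrix `J`:  all invertible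
matrices `g` with `gᵀ * J * g = c • J` for some nonzero scalar `c` (the similitude of `g`). -/
def similitudeGroup (J : Matrix N N F) : Subgroup (GL N F) where
  carrier := {g | ∃ c : Fˣ, (g : Matrix N N F)ᵀ * J * (g : Matrix N N F) = (c : F) • J}
  one_mem' := ⟨1, sim_one J⟩
  mul_mem' := by rintro a b ⟨c, hc⟩ ⟨d, hd⟩; exact ⟨c * d, sim_mul a b c d hc hd⟩
  inv_mem' := by rintro a ⟨c, hc⟩; exact ⟨c⁻¹, sim_inv a c hc⟩

/-- The isometry group of the bilinear form given by the matrix `J`:  all invertible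
matrices `g` with `gᵀ * J * g = J`. -/
def fixGroup (J : Matrix N N F) : Subgroup (GL N F) where
  carrier := {g | (g : Matrix N N F)ᵀ * J * (g : Matrix N N F) = J}
  one_mem' := by simp
  mul_mem' := by
    intro a b ha hb
    have := sim_mul (J := J) a b 1 1 (by simpa using ha) (by simpa using hb)
    simpa using this
  inv_mem' := by
    intro a ha
    have := sim_inv (J := J) a 1 (by simpa using ha)
    simpa using this

/-- The group of isometries of determinant one of the bilinear form given by the matrix `J`. -/
def specialFixGroup (J : Matrix N N F) : Subgroup (GL N F) where
  carrier := {g | (g : Matrix N N F)ᵀ * J * (g : Matrix N N F) = J ∧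
    ((g : Matrix N N F)).det = 1}
  one_mem' := ⟨by simp, by simp⟩
  mul_mem' := by
    rintro a b ⟨ha1, ha2⟩ ⟨hb1, hb2⟩
    refine ⟨(fixGroup J).mul_mem ha1 hb1, ?_⟩
    rw [show ((a * b : GL N F) : Matrix N N F) = (a : Matrix N N F) * b from rfl,
      Matrix.det_mul, ha2, hb2, one_mul]
  inv_mem' := by
    rintro a ⟨ha1, ha2⟩
    refine ⟨(fixGroup J).inv_mem ha1, ?_⟩
    have h := congrArg Matrix.det a.mul_inv
    rw [Matrix.det_mul, ha2, one_mul, Matrix.det_one] at h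
    exact h

/-- The connected component of the similitude group of the symmetric bilinear form on a
`2 * m`-dimensional space given by the matrix `J`:  all similitudes `g`, with similitude
character `μ`, such that `det g = μ(g) ^ m`. -/
def connSimilitudeGroup (J : Matrix N N F) (m : ℕ) : Subgroup (GL N F) where
  carrier := {g | ∃ c : Fˣ, (g : Matrix N N F)ᵀ * J * (g : Matrix N N F) = (c : F) • J ∧
    ((g : Matrix N N F)).det = (c : F) ^ m}
  one_mem' := ⟨1, sim_one J, by simp⟩
  mul_mem' := by
    rintro a b ⟨c, hc1, hc2⟩ ⟨d, hd1, hd2⟩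
    refine ⟨c * d, sim_mul a b c d hc1 hd1, ?_⟩
    rw [show ((a * b : GL N F) : Matrix N N F) = (a : Matrix N N F) * b from rfl,
      Matrix.det_mul, hc2, hd2, Units.val_mul, mul_pow]
  inv_mem' := by
    rintro a ⟨c, hc1, hc2⟩
    refine ⟨c⁻¹, sim_inv a c hc1, ?_⟩
    have h := congrArg Matrix.det a.mul_inv
    rw [Matrix.det_mul, hc2, Matrix.det_one] at h
    have hc : ((c : F) ^ m)⁻¹ = ((c⁻¹ : Fˣ) : F) ^ m := by
      rw [← inv_pow]
      norm_cast
    rw [← hc]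
    exact (inv_eq_of_mul_eq_one_right h).symm

theorem neg_one_mem_similitudeGroup (J : Matrix N N F) : (-1 : GL N F) ∈ similitudeGroup J := by
  refine ⟨1, ?_⟩
  have h : ((-1 : GL N F) : Matrix N N F) = -1 := by simp
  rw [h]
  simp

/-- The standard symplectic form matrix `[[0, I], [-I, 0]]`. -/
def Jsp (n : ℕ) (F : Type*) [Field F] : Matrix (Fin n ⊕ Fin n) (Fin n ⊕ Fin n) F :=
  Matrix.fromBlocks 0 1 (-1) 0

/-- The standard split symmetric form matrix `[[0, I], [I, 0]]`. -/
def Jsplit (n : ℕ) (F : Type*) [Field F] : Matrix (Fin n ⊕ Fin n) (Fin n ⊕ Fin n) F :=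
  Matrix.fromBlocks 0 1 1 0

/-- A symmetric matrix `J` of size `2n` is split if it is congruent to `[[0, I], [I, 0]]`. -/
def IsSplit {n : ℕ} (J : Matrix (Fin n ⊕ Fin n) (Fin n ⊕ Fin n) F) : Prop :=
  ∃ P : GL (Fin n ⊕ Fin n) F,
    (P : Matrix (Fin n ⊕ Fin n) (Fin n ⊕ Fin n) F)ᵀ * J * P = Jsplit n F

/-- The symplectic similitude group `GSp(2n, F)`. -/
def GSp (n : ℕ) (F : Type*) [Field F] : Subgroup (GL (Fin n ⊕ Fin n) F) :=
  similitudeGroup (Jsp n F)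

/-- The symplectic group `Sp(2n, F)`. -/
def Sp (n : ℕ) (F : Type*) [Field F] : Subgroup (GL (Fin n ⊕ Fin n) F) :=
  fixGroup (Jsp n F)


/-- The underlying matrix of an element of a matrix subgroup. -/
def matOf {S : Subgroup (GL N F)} (g : ↥S) : Matrix N N F := ((g : GL N F) : Matrix N N F)

end Groups

noncomputable instance subgroupFintype {G : Type*} [Group G] [Finite G] (S : Subgroup G) :
    Fintype S := Fintype.ofFinite _

open Representation in
/-- A group all of whose finite-dimensional complex representations have nonnegative
Frobenius-Schur sum. For a finite group this says that no irreducible complex representation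
is quaternionic. -/
def NonnegFS (G : Type) [Group G] : Prop :=
  ∀ (_ : Fintype G) (W : Type) [AddCommGroup W] [Module ℂ W] [FiniteDimensional ℂ W]
    (ρ : Representation ℂ G W), 0 ≤ (∑ g : G, ρ.character (g * g)).re

section FrobeniusSchur

variable {G W : Type} [Group G] [AddCommGroup W] [Module ℂ W]

/-- The trace of an endomorphism preserving two complementary subspaces. -/
theorem trace_eq_add_of_isCompl [FiniteDimensional ℂ W] {p q : Submodule ℂ W} (h : IsCompl p q)
    (f : W →ₗ[ℂ] W) (hp : ∀ x ∈ p, f x ∈ p) (hq : ∀ x ∈ q, f x ∈ q) :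
    LinearMap.trace ℂ W f =
      LinearMap.trace ℂ p (f.restrict hp) + LinearMap.trace ℂ q (f.restrict hq) := by
  rw [← LinearMap.trace_prodMap', ← LinearMap.trace_conj' _ (Submodule.prodEquivOfIsCompl p q h)]
  congr 1
  ext x
  obtain ⟨y, rfl⟩ := (Submodule.prodEquivOfIsCompl p q h).surjective x
  simp [LinearEquiv.conj_apply]

theorem character_eq_add_of_isCompl [FiniteDimensional ℂ W] (ρ : Representation ℂ G W)
    {p q : Subrepresentation ρ} (h : IsCompl p q) (g : G) :
    ρ.character g = p.toRepresentation.character g + q.toRepresentation.character g := by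
  have h' : IsCompl p.toSubmodule q.toSubmodule := by
    constructor
    · rw [disjoint_iff, ← Subrepresentation.toSubmodule_inf, h.inf_eq_bot]; rfl
    · rw [codisjoint_iff, ← Subrepresentation.toSubmodule_sup, h.sup_eq_top]; rfl
  exact trace_eq_add_of_isCompl h' (ρ g) (fun x hx => p.apply_mem_toSubmodule g hx)
    (fun x hx => q.apply_mem_toSubmodule g hx)

/-- An additive inequality between characters may be checked on irreducible subrepresentations. -/
theorem exists_irreducible_of_sum_neg [Fintype G] (a : ℂ) (c : G → G) (n : ℕ) :
    ∀ (W : Type) [AddCommGroup W] [Module ℂ W] [FiniteDimensional ℂ W]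
      (ρ : Representation ℂ G W), Module.finrank ℂ W = n →
      (a * ∑ g : G, ρ.character (c g)).re < 0 →
      ∃ (U : Type) (_ : AddCommGroup U) (_ : Module ℂ U) (_ : FiniteDimensional ℂ U)
        (σ : Representation ℂ G U), σ.IsIrreducible ∧ (a * ∑ g : G, σ.character (c g)).re < 0 := by
  induction n using Nat.strong_induction_on with
  | _ n ih =>
    intro W _ _ _ ρ hn hneg
    have hW : Nontrivial W := by
      by_contra h
      rw [not_nontrivial_iff_subsingleton] at h
      have : ∀ g, ρ.character g = 0 := fun g => by
        rw [Representation.character, Subsingleton.elim (ρ g) 0, map_zero]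
      simp [this] at hneg
    by_cases hirr : ρ.IsIrreducible
    · exact ⟨W, inferInstance, inferInstance, inferInstance, ρ, hirr, hneg⟩
    have hnt : Nontrivial (Subrepresentation ρ) := by
      refine ⟨⊥, ⊤, fun h => ?_⟩
      have := congrArg Subrepresentation.toSubmodule h
      exact bot_ne_top this
    obtain ⟨p, hp1, hp2⟩ : ∃ p : Subrepresentation ρ, p ≠ ⊥ ∧ p ≠ ⊤ := by
      by_contra hcon
      push Not at hcon
      exact hirr ⟨fun a => or_iff_not_imp_left.mpr (hcon a)⟩
    have hss : ρ.IsSemisimpleRepresentation := inferInstance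
    obtain ⟨r, hr⟩ := exists_isCompl p
    have hlt : ∀ s : Subrepresentation ρ, s ≠ ⊤ → Module.finrank ℂ s.toSubmodule < n := by
      intro s hs
      rw [← hn]
      refine Submodule.finrank_lt fun h => hs ?_
      exact Subrepresentation.toSubmodule_injective h
    have hr2 : r ≠ ⊤ := fun h => hp1 (by simpa [h] using hr.inf_eq_bot)
    simp only [character_eq_add_of_isCompl ρ hr, Finset.sum_add_distrib, mul_add, Complex.add_re] at hneg
    rcases lt_or_ge (a * ∑ g : G, p.toRepresentation.character (c g)).re 0 with h | h
    · exact ih _ (hlt p hp2) p.toSubmodule p.toRepresentation rfl h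
    · exact ih _ (hlt r hr2) r.toSubmodule r.toRepresentation rfl (by linarith)

theorem nonnegFS_of_irreducible
    (h : ∀ (_ : Fintype G) (W : Type) [AddCommGroup W] [Module ℂ W] [FiniteDimensional ℂ W]
      (ρ : Representation ℂ G W), ρ.IsIrreducible → 0 ≤ (∑ g : G, ρ.character (g * g)).re) :
    NonnegFS G := by
  intro _ W _ _ _ ρ
  by_contra hneg
  obtain ⟨U, _, _, _, σ, hσ, hlt⟩ :=
    exists_irreducible_of_sum_neg 1 (fun g : G => g * g) _ W ρ rfl
      (by rw [one_mul]; exact not_le.mp hneg)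
  rw [one_mul] at hlt
  exact absurd (h _ U σ hσ) (not_le.mpr hlt)

/-- The trace of the twisted transposition `X ↦ (A ⊗ A) Xᵗ` on bilinear forms. -/
theorem trace_flip_compl [FiniteDimensional ℂ W] (A : W →ₗ[ℂ] W)
    (T : (W →ₗ[ℂ] W →ₗ[ℂ] ℂ) →ₗ[ℂ] (W →ₗ[ℂ] W →ₗ[ℂ] ℂ))
    (hT : ∀ X v w, T X v w = X (A w) (A v)) :
    LinearMap.trace ℂ _ T = LinearMap.trace ℂ W (A * A) := by
  let b := Module.finBasis ℂ W
  let B := (Matrix.stdBasis ℂ (Fin (Module.finrank ℂ W)) (Fin (Module.finrank ℂ W))).map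
    (Matrix.toLinearMap₂ b b)
  have hrepr : ∀ X p, B.repr X p = X (b p.1) (b p.2) := by
    intro X p
    obtain ⟨Y, rfl⟩ := (Matrix.toLinearMap₂ b b (N₂ := ℂ)).surjective X
    obtain ⟨i, j⟩ := p
    simp [B, Matrix.toLinearMap₂_apply, Matrix.stdBasis, Finsupp.single_apply]
  rw [LinearMap.trace_eq_matrix_trace ℂ B, LinearMap.trace_eq_matrix_trace ℂ b,
    LinearMap.toMatrix_mul]
  simp only [Matrix.trace, Matrix.diag, Matrix.mul_apply, Fintype.sum_prod_type]
  refine Finset.sum_congr rfl fun i _ => Finset.sum_congr rfl fun j _ => ?_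
  rw [LinearMap.toMatrix_apply, hrepr, hT]
  simp [LinearMap.toMatrix_apply, Matrix.toLinearMap₂_apply, Matrix.stdBasis_eq_single,
    Matrix.single_apply, B, ite_and, mul_comm]

/-- A bilinear form on a representation is invariant. -/
def InvariantForm (ρ : Representation ℂ G W) (ω : W →ₗ[ℂ] W →ₗ[ℂ] ℂ) : Prop :=
  ∀ g v w, ω (ρ g v) (ρ g w) = ω v w

/-- Schur's lemma. -/
theorem exists_smul_of_commute [FiniteDimensional ℂ W] (ρ : Representation ℂ G W)
    (hρ : ρ.IsIrreducible) (f : W →ₗ[ℂ] W) (hf : ∀ g v, f (ρ g v) = ρ g (f v)) :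
    ∃ c : ℂ, ∀ v, f v = c • v := by
  obtain ⟨c, hc⟩ := (Representation.IsIrreducible.algebraMap_intertwiningMap_bijective_of_isAlgClosed
    (ρ := ρ)).2 (f.intertwiningMap_of_isIntertwiningMap ρ ρ hf)
  exact ⟨c, fun v => (congrArg (fun F => F v) hc).symm⟩

theorem subrepresentation_eq_bot_or_top (ρ : Representation ℂ G W)
    (hρ : ρ.IsIrreducible) (p : Submodule ℂ W) (hp : ∀ g, ∀ v ∈ p, ρ g v ∈ p) :
    p = ⊥ ∨ p = ⊤ := by
  rcases hρ.eq_bot_or_eq_top ⟨p, fun g v hv => hp g v hv⟩ with h | h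
  · exact Or.inl (congrArg Subrepresentation.toSubmodule h)
  · exact Or.inr (congrArg Subrepresentation.toSubmodule h)

theorem InvariantForm.injective {ρ : Representation ℂ G W}
    (hρ : ρ.IsIrreducible) {ω : W →ₗ[ℂ] W →ₗ[ℂ] ℂ} (hω : InvariantForm ρ ω) (h0 : ω ≠ 0) :
    Function.Injective ω := by
  rw [← LinearMap.ker_eq_bot]
  refine (subrepresentation_eq_bot_or_top ρ hρ (LinearMap.ker ω) fun g v hv => ?_).resolve_right
    fun h => h0 (LinearMap.ker_eq_top.mp h)
  rw [LinearMap.mem_ker] at hv ⊢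
  ext w
  have := hω g v (ρ g⁻¹ w)
  rw [Representation.self_inv_apply] at this
  rw [this, hv]; rfl

theorem InvariantForm.eq_smul [FiniteDimensional ℂ W] {ρ : Representation ℂ G W}
    (hρ : ρ.IsIrreducible) {ω X : W →ₗ[ℂ] W →ₗ[ℂ] ℂ} (hω : InvariantForm ρ ω) (h0 : ω ≠ 0)
    (hX : InvariantForm ρ X) : ∃ c : ℂ, X = c • ω := by
  have hinj := hω.injective hρ h0
  let e : W ≃ₗ[ℂ] (W →ₗ[ℂ] ℂ) := LinearEquiv.ofInjectiveOfFinrankEq ω hinj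
    (Subspace.dual_finrank_eq (K := ℂ) (V := W)).symm
  have he : ∀ v, e v = ω v := fun v => rfl
  obtain ⟨c, hc⟩ := exists_smul_of_commute ρ hρ (e.symm.toLinearMap ∘ₗ X) (fun g v => by
    apply e.injective
    simp only [LinearMap.comp_apply, LinearEquiv.coe_coe, LinearEquiv.apply_symm_apply]
    ext w
    obtain ⟨u, hu⟩ := e.surjective (X v)
    rw [← hu, e.symm_apply_apply, he]
    have h1 := hX g v (ρ g⁻¹ w)
    have h2 := hω g u (ρ g⁻¹ w)
    rw [Representation.self_inv_apply] at h1 h2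
    rw [h1, h2, ← hu, he])
  refine ⟨c, LinearMap.ext fun v => ?_⟩
  have := congrArg e (hc v)
  rwa [LinearMap.comp_apply, LinearEquiv.coe_coe, e.apply_symm_apply, map_smul, he] at this

/-- Transposition of bilinear forms as a linear map. -/
def formFlip (W : Type) [AddCommGroup W] [Module ℂ W] :
    (W →ₗ[ℂ] W →ₗ[ℂ] ℂ) →ₗ[ℂ] (W →ₗ[ℂ] W →ₗ[ℂ] ℂ) where
  toFun X := X.flip
  map_add' _ _ := rfl
  map_smul' _ _ := rfl

theorem sum_character_sq_eq_trace [FiniteDimensional ℂ W] [Fintype G]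
    [Invertible (Fintype.card G : ℂ)] (ρ : Representation ℂ G W) :
    ∑ g : G, ρ.character (g * g) = Fintype.card G *
      LinearMap.trace ℂ _ ((formFlip W).comp
        (ρ.linHom ρ.dual).averageMap) := by
  have h : ∀ g : G, ρ.character (g⁻¹ * g⁻¹) = LinearMap.trace ℂ _
      ((formFlip W).comp (ρ.linHom ρ.dual g)) := by
    intro g
    rw [trace_flip_compl (ρ g⁻¹), ← map_mul]
    · rfl
    · intro X v w; rfl
  rw [← Equiv.sum_comp (Equiv.inv G)]
  simp only [Equiv.inv_apply, h, ← map_sum]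
  rw [← smul_eq_mul, ← map_smul, ← LinearMap.comp_smul]
  congr 2
  ext X v w
  simp [GroupAlgebra.average, map_sum, LinearMap.sum_apply]

theorem mem_linHom_dual_invariants (ρ : Representation ℂ G W) (X : W →ₗ[ℂ] W →ₗ[ℂ] ℂ) :
    X ∈ (ρ.linHom ρ.dual).invariants ↔ InvariantForm ρ X := by
  rw [Representation.mem_invariants]
  constructor
  · intro h g v w
    have := congrArg (fun Y : W →ₗ[ℂ] W →ₗ[ℂ] ℂ => Y v w) (h g⁻¹)
    rw [← this]
    change _ = X (ρ g⁻¹⁻¹ v) (ρ g⁻¹⁻¹ w)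
    rw [inv_inv]
  · intro h g
    ext v w
    exact h g⁻¹ v w

theorem trace_of_isProj_span [FiniteDimensional ℂ W] {w : W} (hw : w ≠ 0) (P : W →ₗ[ℂ] W)
    (hP : LinearMap.IsProj (Submodule.span ℂ {w}) P) : LinearMap.trace ℂ W P = 1 := by
  rw [hP.trace, finrank_span_singleton hw, Nat.cast_one]

/-- The Frobenius-Schur alternative for irreducible representations. -/
theorem frobeniusSchur_irreducible [FiniteDimensional ℂ W] [Fintype G]
    (ρ : Representation ℂ G W) (hρ : ρ.IsIrreducible) :
    (∑ g : G, ρ.character (g * g) = 0 ∧ ∀ ω, InvariantForm ρ ω → ω = 0) ∨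
    ∃ c : ℂ, (c = 1 ∨ c = -1) ∧ ∑ g : G, ρ.character (g * g) = c * Fintype.card G ∧
      (∃ ω, ω ≠ 0 ∧ InvariantForm ρ ω) ∧
      ∀ ω, InvariantForm ρ ω → ∀ v w, ω w v = c * ω v w := by
  have : Invertible (Fintype.card G : ℂ) :=
    invertibleOfNonzero (by exact_mod_cast Fintype.card_ne_zero)
  by_cases hz : ∀ ω, InvariantForm ρ ω → ω = 0
  · refine Or.inl ⟨?_, hz⟩
    rw [sum_character_sq_eq_trace]
    have : (ρ.linHom ρ.dual).averageMap = 0 := by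
      ext1 X
      exact hz _ ((mem_linHom_dual_invariants ρ _).mp (Representation.averageMap_invariant _ X))
    rw [this]; simp
  · right
    push Not at hz
    obtain ⟨ω, hω, h0⟩ := hz
    have hflip : InvariantForm ρ ω.flip := fun g v w => hω g w v
    obtain ⟨c, hc⟩ := hω.eq_smul hρ h0 hflip
    have hcc : ∀ v w, ω w v = c * ω v w := fun v w =>
      congrArg (fun Y : W →ₗ[ℂ] W →ₗ[ℂ] ℂ => Y v w) hc
    have hall : ∀ X, InvariantForm ρ X → ∀ v w, X w v = c * X v w := by
      intro X hX v w
      obtain ⟨d, rfl⟩ := hω.eq_smul hρ h0 hX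
      simp only [LinearMap.smul_apply, smul_eq_mul, hcc v w]
      ring
    have hc2 : c * c = 1 := by
      obtain ⟨v, w, hvw⟩ : ∃ v w, ω v w ≠ 0 := by
        by_contra hcon
        push Not at hcon
        exact h0 (LinearMap.ext fun v => LinearMap.ext fun w => hcon v w)
      have h1 := hcc w v
      rw [hcc v w, ← mul_assoc] at h1
      exact mul_right_cancel₀ hvw (by rw [← h1, one_mul])
    refine ⟨c, mul_self_eq_one_iff.mp hc2, ?_, ⟨ω, h0, hω⟩, hall⟩
    rw [sum_character_sq_eq_trace, mul_comm]
    congr 1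
    have h1 : (formFlip W).comp
        (ρ.linHom ρ.dual).averageMap = c • (ρ.linHom ρ.dual).averageMap := by
      refine LinearMap.ext fun X => LinearMap.ext fun v => LinearMap.ext fun w => ?_
      exact hall _ ((mem_linHom_dual_invariants ρ _).mp
        (Representation.averageMap_invariant _ X)) v w
    let P : (W →ₗ[ℂ] W →ₗ[ℂ] ℂ) →ₗ[ℂ] (W →ₗ[ℂ] W →ₗ[ℂ] ℂ) := (ρ.linHom ρ.dual).averageMap
    have hproj : LinearMap.IsProj (Submodule.span ℂ {ω}) P := by
      constructor
      · intro X
        obtain ⟨d, hd⟩ := hω.eq_smul hρ h0 ((mem_linHom_dual_invariants ρ _).mp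
          (Representation.averageMap_invariant _ X))
        exact hd ▸ Submodule.smul_mem _ _ (Submodule.mem_span_singleton_self ω)
      · intro X hX
        obtain ⟨d, rfl⟩ := Submodule.mem_span_singleton.mp hX
        rw [map_smul]
        congr 1
        exact (Representation.averageMap_id _ ω ((mem_linHom_dual_invariants ρ _).mpr hω))
    have htr : LinearMap.trace ℂ _ P = 1 := by
      exact trace_of_isProj_span h0 P hproj
    rw [h1, map_smul, smul_eq_mul]
    exact (congrArg (c * ·) htr).trans (mul_one c)

theorem sum_character_sq_im [FiniteDimensional ℂ W] [Fintype G]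
    (ρ : Representation ℂ G W) : (∑ g : G, ρ.character (g * g)).im = 0 := by
  have key : ∀ a : ℂ, a.re = 0 → 0 ≤ (a * ∑ g : G, ρ.character (g * g)).re := by
    intro a ha
    by_contra hneg
    obtain ⟨U, _, _, _, σ, hσ, hlt⟩ :=
      exists_irreducible_of_sum_neg a (fun g : G => g * g) _ W ρ rfl (not_le.mp hneg)
    rcases frobeniusSchur_irreducible σ hσ with ⟨h, -⟩ | ⟨c, hc, h, -⟩
    · simp [h] at hlt
    · rcases hc with rfl | rfl <;> simp [h, ha] at hlt
  have h1 := key Complex.I (by simp)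
  have h2 := key (-Complex.I) (by simp)
  simp only [Complex.mul_re, Complex.I_re, Complex.I_im, Complex.neg_re, Complex.neg_im] at h1 h2
  linarith

end FrobeniusSchur

section Lagrangian

variable {G W : Type} [Group G] [AddCommGroup W] [Module ℂ W] [FiniteDimensional ℂ W]

/-- In a group without quaternionic representations, invariant alternating forms vanish on
irreducible subrepresentations. -/
theorem NonnegFS.form_eq_zero [Fintype G] (hG : NonnegFS G) (ρ : Representation ℂ G W)
    (hρ : ρ.IsIrreducible) {ω : W →ₗ[ℂ] W →ₗ[ℂ] ℂ} (hω : InvariantForm ρ ω)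
    (halt : ∀ v w, ω w v = -ω v w) : ω = 0 := by
  rcases frobeniusSchur_irreducible ρ hρ with ⟨-, h⟩ | ⟨c, hc, hsum, -, h⟩
  · exact h ω hω
  · have hc1 : c = 1 := by
      refine hc.resolve_right fun hc => ?_
      have := hG inferInstance W ρ
      rw [hsum, hc] at this
      have hpos : (0 : ℝ) < Fintype.card G := by exact_mod_cast Fintype.card_pos
      simp at this
    ext v w
    have h1 := h ω hω v w
    rw [halt, hc1, one_mul] at h1
    simpa using self_eq_neg.mp h1.symm

theorem exists_irreducible_le (ρ : Representation ℂ G W) (M : Subrepresentation ρ) (hM : M ≠ ⊥) :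
    ∃ U : Subrepresentation ρ, U ≤ M ∧ U ≠ ⊥ ∧ U.toRepresentation.IsIrreducible := by
  obtain ⟨U, ⟨hUM, hU⟩, hmin⟩ := exists_minimalFor_of_wellFoundedLT
    (fun U : Subrepresentation ρ => U ≤ M ∧ U ≠ ⊥)
    (fun U : Subrepresentation ρ => Module.finrank ℂ U.toSubmodule) ⟨M, le_rfl, hM⟩
  refine ⟨U, hUM, hU, ?_⟩
  have hnt : Nontrivial (Subrepresentation U.toRepresentation) := by
    refine ⟨⊥, ⊤, fun h => hU ?_⟩
    apply Subrepresentation.toSubmodule_injective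
    have := congrArg Subrepresentation.toSubmodule h
    change (⊥ : Submodule ℂ U.toSubmodule) = ⊤ at this
    change U.toSubmodule = ⊥
    rw [← Submodule.subsingleton_iff_eq_bot]
    exact (Submodule.subsingleton_iff ℂ).mp (subsingleton_iff_bot_eq_top.mp this)
  refine ⟨fun a => or_iff_not_imp_left.mpr fun ha => ?_⟩
  let a' : Subrepresentation ρ := ⟨a.toSubmodule.map U.toSubmodule.subtype, by
    rintro g _ ⟨x, hx, rfl⟩
    exact ⟨_, a.apply_mem_toSubmodule g hx, rfl⟩⟩
  have hle : a' ≤ U := by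
    rintro _ ⟨x, -, rfl⟩
    exact x.2
  have ha' : a' ≠ ⊥ := by
    intro h
    apply ha
    apply Subrepresentation.toSubmodule_injective
    have := congrArg Subrepresentation.toSubmodule h
    change a.toSubmodule.map U.toSubmodule.subtype = ⊥ at this
    exact Submodule.map_injective_of_injective U.toSubmodule.injective_subtype
      (this.trans (Submodule.map_bot _).symm)
  have hfr : Module.finrank ℂ a'.toSubmodule ≤ Module.finrank ℂ U.toSubmodule :=
    Submodule.finrank_mono hle
  have h2 := hmin ⟨hle.trans hUM, ha'⟩ hfr
  apply Subrepresentation.toSubmodule_injective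
  change a.toSubmodule = ⊤
  apply Submodule.eq_top_of_finrank_eq
  refine le_antisymm (Submodule.finrank_le _) (h2.trans_eq ?_)
  exact Submodule.finrank_map_subtype_eq _ _

/-- The restriction of a symplectic representation to a group without quaternionic
representations has an invariant Lagrangian, hence its character is `η + η^∨`. -/
theorem NonnegFS.exists_character_eq_add_inv [Fintype G] (hG : NonnegFS G)
    (ρ : Representation ℂ G W) {ω : W →ₗ[ℂ] W →ₗ[ℂ] ℂ} (hω : InvariantForm ρ ω)
    (halt : ∀ v w, ω w v = -ω v w) (hinj : Function.Injective ω) :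
    ∃ (L : Type) (_ : AddCommGroup L) (_ : Module ℂ L) (_ : FiniteDimensional ℂ L)
      (η : Representation ℂ G L), ∀ g, ρ.character g = η.character g + η.character g⁻¹ := by
  obtain ⟨L, hL, hmax⟩ := exists_maximalFor_of_wellFoundedGT
    (fun L : Subrepresentation ρ => ∀ v ∈ L, ∀ w ∈ L, ω v w = 0)
    (fun L : Subrepresentation ρ => (⟨Module.finrank ℂ L.toSubmodule,
      Nat.lt_succ_of_le (Submodule.finrank_le _)⟩ : Fin (Module.finrank ℂ W + 1)))
    ⟨⊥, fun v hv w hw => by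
      have : v = 0 := hv
      simp [this]⟩
  obtain ⟨C, hC⟩ := exists_isCompl L
  have hC' : IsCompl L.toSubmodule C.toSubmodule := by
    constructor
    · rw [disjoint_iff, ← Subrepresentation.toSubmodule_inf, hC.inf_eq_bot]; rfl
    · rw [codisjoint_iff, ← Subrepresentation.toSubmodule_sup, hC.sup_eq_top]; rfl
  have hdecomp : ∀ w, ∃ l ∈ L, ∃ c ∈ C, w = l + c := by
    intro w
    obtain ⟨l, hl, c, hc, h⟩ := Submodule.mem_sup.mp
      (hC'.sup_eq_top ▸ Submodule.mem_top : w ∈ L.toSubmodule ⊔ C.toSubmodule)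
    exact ⟨l, hl, c, hc, h.symm⟩
  have hperp : ∀ c ∈ C, (∀ l ∈ L, ω l c = 0) → c = 0 := by
    by_contra hcon
    push Not at hcon
    obtain ⟨c, hcC, hcL, hc0⟩ := hcon
    let M : Subrepresentation ρ := ⟨{
        carrier := {w | w ∈ C ∧ ∀ l ∈ L, ω l w = 0}
        zero_mem' := ⟨C.toSubmodule.zero_mem, by simp⟩
        add_mem' := fun {a b} ha hb => ⟨C.toSubmodule.add_mem ha.1 hb.1, fun l hl => by
          rw [map_add, ha.2 l hl, hb.2 l hl, add_zero]⟩
        smul_mem' := fun r a ha => ⟨C.toSubmodule.smul_mem r ha.1, fun l hl => by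
          rw [map_smul, ha.2 l hl, smul_zero]⟩ }, fun g v hv =>
        ⟨C.apply_mem_toSubmodule g hv.1, fun l hl => by
          have := hω g (ρ g⁻¹ l) v
          rw [Representation.self_inv_apply] at this
          rw [this]
          exact hv.2 _ (L.apply_mem_toSubmodule g⁻¹ hl)⟩⟩
    have hM : M ≠ ⊥ := by
      intro h
      have : c ∈ M := ⟨hcC, hcL⟩
      rw [h] at this
      exact hc0 this
    obtain ⟨U, hUM, hU, hUirr⟩ := exists_irreducible_le ρ M hM
    have hU0 : ∀ v ∈ U, ∀ w ∈ U, ω v w = 0 := by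
      have := hG.form_eq_zero U.toRepresentation hUirr
        (ω := ω.compl₁₂ U.toSubmodule.subtype U.toSubmodule.subtype)
        (fun g v w => hω g v w) (fun v w => halt v w)
      intro v hv w hw
      exact congrArg (fun X : U.toSubmodule →ₗ[ℂ] U.toSubmodule →ₗ[ℂ] ℂ => X ⟨v, hv⟩ ⟨w, hw⟩) this
    have hiso : ∀ v ∈ L ⊔ U, ∀ w ∈ L ⊔ U, ω v w = 0 := by
      intro v hv w hw
      obtain ⟨l, hl, u, hu, rfl⟩ := Submodule.mem_sup.mp
        (show v ∈ L.toSubmodule ⊔ U.toSubmodule from Subrepresentation.toSubmodule_sup L U ▸ hv)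
      obtain ⟨l', hl', u', hu', rfl⟩ := Submodule.mem_sup.mp
        (show w ∈ L.toSubmodule ⊔ U.toSubmodule from Subrepresentation.toSubmodule_sup L U ▸ hw)
      have h1 := (hUM hu').2 l hl
      have h2 := (hUM hu).2 l' hl'
      have h3 := halt l' u
      simp only [map_add, LinearMap.add_apply, hL l hl l' hl', hU0 u hu u' hu', h1, h3, h2]
      simp
    have hle : Module.finrank ℂ L.toSubmodule ≤ Module.finrank ℂ (L ⊔ U).toSubmodule :=
      Submodule.finrank_mono (by rw [Subrepresentation.toSubmodule_sup]; exact le_sup_left)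
    have h2 : Module.finrank ℂ (L ⊔ U).toSubmodule ≤ Module.finrank ℂ L.toSubmodule :=
      hmax hiso hle
    have h3 : L.toSubmodule = (L ⊔ U).toSubmodule := Submodule.eq_of_le_of_finrank_le
      (by rw [Subrepresentation.toSubmodule_sup]; exact le_sup_left) h2
    apply hU
    apply Subrepresentation.toSubmodule_injective
    change U.toSubmodule = ⊥
    rw [eq_bot_iff, ← hC'.inf_eq_bot]
    refine le_inf ?_ fun u hu => (hUM hu).1
    rw [h3, Subrepresentation.toSubmodule_sup]
    exact le_sup_right
  let e₀ : C.toSubmodule →ₗ[ℂ] Module.Dual ℂ L.toSubmodule :=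
    (ω.compl₁₂ L.toSubmodule.subtype C.toSubmodule.subtype).flip
  let e₁ : L.toSubmodule →ₗ[ℂ] Module.Dual ℂ C.toSubmodule :=
    ω.compl₁₂ L.toSubmodule.subtype C.toSubmodule.subtype
  have hinj0 : Function.Injective e₀ := by
    rw [injective_iff_map_eq_zero]
    intro c hc
    exact Subtype.ext (hperp c c.2 fun l hl => congrArg (fun f => f ⟨l, hl⟩) hc)
  have hinj1 : Function.Injective e₁ := by
    rw [injective_iff_map_eq_zero]
    intro l hl
    apply Subtype.ext
    apply hinj
    rw [ZeroMemClass.coe_zero, map_zero]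
    ext w
    obtain ⟨l', hl', c, hc, rfl⟩ := hdecomp w
    rw [map_add, hL l l.2 l' hl', zero_add]
    exact congrArg (fun f => f ⟨c, hc⟩) hl
  have hfr : Module.finrank ℂ C.toSubmodule = Module.finrank ℂ (Module.Dual ℂ L.toSubmodule) := by
    have h0 := LinearMap.finrank_le_finrank_of_injective hinj0
    have h1 := LinearMap.finrank_le_finrank_of_injective hinj1
    rw [Subspace.dual_finrank_eq] at h0 h1 ⊢
    exact le_antisymm h0 h1
  let e := LinearEquiv.ofInjectiveOfFinrankEq e₀ hinj0 hfr
  refine ⟨L.toSubmodule, inferInstance, inferInstance, inferInstance, L.toRepresentation,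
    fun g => ?_⟩
  rw [character_eq_add_of_isCompl ρ hC, ← Representation.char_dual]
  congr 1
  refine congrFun (Representation.char_iso (Representation.Equiv.mk e fun g => ?_)) g
  ext c l
  change ω l (ρ g c) = ω (ρ g⁻¹ l) c
  have := hω g (ρ g⁻¹ l) c
  rwa [Representation.self_inv_apply] at this

end Lagrangian

section FiniteOrder

variable {U : Type} [AddCommGroup U] [Module ℂ U] [FiniteDimensional ℂ U]

theorem pow_eq_one_of_mem_roots_charpoly {f : Module.End ℂ U} {n : ℕ} (hf : f ^ n = 1)
    {μ : ℂ} (hμ : μ ∈ f.charpoly.roots) : μ ^ n = 1 := by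
  have h1 : f.HasEigenvalue μ := by
    rw [Module.End.hasEigenvalue_iff_isRoot_charpoly]
    exact (Polynomial.mem_roots'.mp hμ).2
  obtain ⟨v, hv⟩ := h1.exists_hasEigenvector
  have h2 := hv.pow_apply n
  rw [hf, Module.End.one_apply] at h2
  have h3 : (μ ^ n - 1) • v = 0 := by rw [sub_smul, one_smul, ← h2, sub_self]
  exact sub_eq_zero.mp ((smul_eq_zero.mp h3).resolve_right hv.2)

theorem isIntegral_trace_of_pow_eq_one {f : Module.End ℂ U} {n : ℕ} (hn : 0 < n)
    (hf : f ^ n = 1) : IsIntegral ℤ (LinearMap.trace ℂ U f) := by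
  rw [Module.End.trace_eq_sum_roots_charpoly_of_splits (IsAlgClosed.splits _)]
  refine IsIntegral.multiset_sum fun μ hμ => ?_
  refine IsIntegral.of_pow hn ?_
  rw [pow_eq_one_of_mem_roots_charpoly hf hμ]
  exact isIntegral_one

theorem norm_trace_le_of_pow_eq_one {f : Module.End ℂ U} {n : ℕ} (hn : 0 < n)
    (hf : f ^ n = 1) : ‖LinearMap.trace ℂ U f‖ ≤ Module.finrank ℂ U := by
  rw [Module.End.trace_eq_sum_roots_charpoly_of_splits (IsAlgClosed.splits _)]
  have hle : ‖f.charpoly.roots.sum‖ ≤ (f.charpoly.roots.map fun x => ‖x‖).sum :=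
    Multiset.le_sum_of_subadditive (fun x : ℂ => ‖x‖) norm_zero.le norm_add_le _
  refine hle.trans ?_
  have h1 : f.charpoly.roots.map (fun x => ‖x‖) = f.charpoly.roots.map fun _ => (1 : ℝ) :=
    Multiset.map_congr rfl fun μ hμ =>
      Complex.norm_eq_one_of_pow_eq_one (pow_eq_one_of_mem_roots_charpoly hf hμ) hn.ne'
  rw [h1, Multiset.map_const', Multiset.sum_replicate, nsmul_eq_mul, mul_one]
  exact_mod_cast (Polynomial.card_roots' _).trans_eq f.charpoly_natDegree

end FiniteOrder

section Coset

variable {G W B : Type} [Group G] [AddCommGroup W] [Module ℂ W] [FiniteDimensional ℂ W]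
  [Group B] [Fintype B]

theorem trace_comp_proj {p : Submodule ℂ W} {P : W →ₗ[ℂ] W} (hP : LinearMap.IsProj p P)
    (f : W →ₗ[ℂ] W) (hf : ∀ w, f (P w) = P (f w)) (hfp : ∀ w ∈ p, f w ∈ p) :
    LinearMap.trace ℂ W (f ∘ₗ P) = LinearMap.trace ℂ p (f.restrict hfp) := by
  have hfP : ∀ x ∈ p, (f ∘ₗ P) x ∈ p := fun x _ => by
    rw [LinearMap.comp_apply, hf]; exact hP.map_mem _
  have hker : ∀ x ∈ LinearMap.ker P, (f ∘ₗ P) x ∈ LinearMap.ker P := fun x hx => by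
    rw [LinearMap.comp_apply, LinearMap.mem_ker.mp hx, map_zero]; exact Submodule.zero_mem _
  rw [trace_eq_add_of_isCompl hP.isCompl _ hfP hker]
  have h2 : (f ∘ₗ P).restrict hker = 0 := by
    ext ⟨x, hx⟩
    simp [LinearMap.mem_ker.mp hx]
  have h1 : (f ∘ₗ P).restrict hfP = f.restrict hfp := by
    ext ⟨x, hx⟩
    simp [hP.map_id x hx]
  rw [h1, h2, map_zero, add_zero]

/-- Sum of a character over a coset `c · φ(B)`, where `c` centralizes `φ(B)`. -/
theorem exists_sum_character_coset [Finite G] (ρ : Representation ℂ G W) (φ : B →* G) (c : G)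
    (hc : ∀ β, c * φ β = φ β * c) :
    ∃ (U : Submodule ℂ W) (f : Module.End ℂ U) (n : ℕ), 0 < n ∧ f ^ n = 1 ∧
      (∀ w, w ∈ U ↔ ∀ β, ρ (φ β) w = w) ∧
      ∑ β : B, ρ.character (c * φ β) = Fintype.card B * LinearMap.trace ℂ U f := by
  have : Invertible (Fintype.card B : ℂ) :=
    invertibleOfNonzero (by exact_mod_cast Fintype.card_ne_zero)
  let σ : Representation ℂ B W := ρ.comp φ
  have hmem : ∀ w, w ∈ σ.invariants ↔ ∀ β, ρ (φ β) w = w := fun w => Iff.rfl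
  have hpres : ∀ w ∈ σ.invariants, ρ c w ∈ σ.invariants := by
    intro w hw β
    change ρ (φ β) (ρ c w) = ρ c w
    rw [← Module.End.mul_apply, ← map_mul, ← hc, map_mul, Module.End.mul_apply, (hmem w).mp hw]
  have hP := σ.isProj_averageMap
  have hPeq : ∀ w, σ.averageMap w = (⅟(Fintype.card B : ℂ)) • ∑ β, ρ (φ β) w := by
    intro w
    simp [GroupAlgebra.average, map_sum, LinearMap.sum_apply, σ]
  refine ⟨σ.invariants, (ρ c).restrict hpres, orderOf c, orderOf_pos c, ?_, hmem, ?_⟩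
  · ext w
    rw [Module.End.pow_restrict]
    · simp only [LinearMap.restrict_apply, ← map_pow, pow_orderOf_eq_one]
      simp
  · rw [← trace_comp_proj hP (ρ c) _ hpres]
    · have : ρ c ∘ₗ σ.averageMap = (⅟(Fintype.card B : ℂ)) • ∑ β, ρ (c * φ β) := by
        ext w
        rw [LinearMap.comp_apply, hPeq, map_smul, map_sum]
        simp [LinearMap.sum_apply]
      rw [this, map_smul, map_sum, smul_eq_mul, ← mul_assoc, mul_invOf_self, one_mul]
      rfl
    · intro w
      simp only [hPeq, map_smul, map_sum, ← Module.End.mul_apply, ← map_mul, hc]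

theorem exists_sum_character_coset_integral [Finite G] (ρ : Representation ℂ G W) (φ : B →* G)
    (c : G) (hc : ∀ β, c * φ β = φ β * c) :
    ∃ z : ℂ, IsIntegral ℤ z ∧ ∑ β : B, ρ.character (c * φ β) = Fintype.card B * z := by
  obtain ⟨U, f, n, hn, hf, -, h⟩ := exists_sum_character_coset ρ φ c hc
  exact ⟨_, isIntegral_trace_of_pow_eq_one hn hf, h⟩

theorem norm_sum_character_coset_le [Finite G] (ρ : Representation ℂ G W) (φ : B →* G)
    (c : G) (hc : ∀ β, c * φ β = φ β * c) :
    ‖∑ β : B, ρ.character (c * φ β)‖ ≤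
      Fintype.card B * Module.finrank ℂ (Representation.invariants (ρ.comp φ)) := by
  obtain ⟨U, f, n, hn, hf, hU, h⟩ := exists_sum_character_coset ρ φ c hc
  have : U = Representation.invariants (ρ.comp φ) := Submodule.ext hU
  subst this
  rw [h, norm_mul, Complex.norm_natCast]
  exact mul_le_mul_of_nonneg_left (norm_trace_le_of_pow_eq_one hn hf) (Nat.cast_nonneg _)

theorem sum_character_comp (ρ : Representation ℂ G W) (φ : B →* G) :
    ∑ β : B, ρ.character (φ β) =
      Fintype.card B * (Module.finrank ℂ (Representation.invariants (ρ.comp φ)) : ℂ) := by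
  have h0 : (Fintype.card B : ℂ) ≠ 0 := by exact_mod_cast Fintype.card_ne_zero
  have : Invertible (Nat.card B : ℂ) :=
    invertibleOfNonzero (by rw [Nat.card_eq_fintype_card]; exact h0)
  rw [← Representation.card_inv_mul_sum_char_eq_finrank, Nat.card_eq_fintype_card,
    mul_inv_cancel_left₀ h0]
  rfl

end Coset

section Closure

variable {K : Type} [Group K]

theorem sum_comp_of_surjective {A N : Type} [Group A] [Group N] [Fintype A] [Fintype N]
    (φ : A →* N) (hφ : Function.Surjective φ) (F : N → ℂ) :
    ∑ a, F (φ a) = (Nat.card φ.ker : ℂ) * ∑ n, F n := by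
  rw [← Finset.sum_fiberwise_of_maps_to (t := Finset.univ) (g := φ) (fun _ _ => Finset.mem_univ _),
    Finset.mul_sum]
  refine Finset.sum_congr rfl fun n _ => ?_
  have h1 : ∀ a ∈ Finset.univ.filter (fun a => φ a = n), F (φ a) = F n := by
    intro a ha
    rw [(Finset.mem_filter.mp ha).2]
  rw [Finset.sum_congr rfl h1, Finset.sum_const, nsmul_eq_mul]
  congr 2
  rw [MonoidHom.card_fiber_eq_of_mem_range φ (hφ n) (hφ 1), Nat.card_eq_fintype_card,
    Fintype.card_subtype]
  congr 1
  ext a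
  simp [MonoidHom.mem_ker]

theorem NonnegFS.of_surjective {A : Type} [Group A] [Finite A] (hA : NonnegFS A) (φ : A →* K)
    (hφ : Function.Surjective φ) : NonnegFS K := by
  intro _ W _ _ _ ρ
  have : Fintype A := Fintype.ofFinite A
  have h := hA inferInstance W (ρ.comp φ)
  have h2 : ∑ a : A, Representation.character (ρ.comp φ) (a * a) =
      ∑ a : A, ρ.character (φ a * φ a) :=
    Finset.sum_congr rfl fun a _ => by rw [← map_mul]; rfl
  rw [h2, sum_comp_of_surjective φ hφ fun n => ρ.character (n * n), ← Complex.ofReal_natCast,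
    Complex.re_ofReal_mul] at h
  exact nonneg_of_mul_nonneg_right h (by exact_mod_cast Nat.card_pos)

theorem NonnegFS.prod {A B : Type} [Group A] [Group B] [Finite A] [Finite B] (hA : NonnegFS A)
    (hB : NonnegFS B) : NonnegFS (A × B) := by
  refine nonnegFS_of_irreducible fun _ W _ _ _ ρ hρ => ?_
  have : Fintype A := Fintype.ofFinite A
  have : Fintype B := Fintype.ofFinite B
  have hW : Nontrivial W := by
    by_contra h
    rw [not_nontrivial_iff_subsingleton] at h
    exact bot_ne_top (α := Subrepresentation ρ) (Subrepresentation.toSubmodule_injective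
      (Subsingleton.elim _ _))
  let S : W →ₗ[ℂ] W := ∑ a : A, ρ (a * a, 1)
  have hS : ∀ (g : A × B) v, S (ρ g v) = ρ g (S v) := by
    rintro ⟨a, b⟩ v
    simp only [S, LinearMap.sum_apply, map_sum]
    refine ((Equiv.sum_comp (MulAut.conj a).toEquiv
      fun c => ρ (c * c, 1) (ρ (a, b) v)).symm).trans ?_
    refine Finset.sum_congr rfl fun c _ => ?_
    change ρ (a * c * a⁻¹ * (a * c * a⁻¹), 1) (ρ (a, b) v) = ρ (a, b) (ρ (c * c, 1) v)
    rw [← Module.End.mul_apply, ← Module.End.mul_apply, ← map_mul ρ, ← map_mul ρ]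
    congr 2
    ext <;> simp [mul_assoc]
  obtain ⟨c, hc⟩ := exists_smul_of_commute ρ hρ S hS
  have hS' : S = c • (1 : Module.End ℂ W) := LinearMap.ext hc
  have hA1 : ∑ a : A, Representation.character (ρ.comp (MonoidHom.inl A B)) (a * a) =
      c * Module.finrank ℂ W := by
    have : LinearMap.trace ℂ W S = c * Module.finrank ℂ W := by
      rw [hS', map_smul, LinearMap.trace_one, smul_eq_mul]
    rw [← this, map_sum]
    rfl
  have hre := hA inferInstance W (ρ.comp (MonoidHom.inl A B))
  have him := sum_character_sq_im (G := A) (ρ.comp (MonoidHom.inl A B))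
  have hd : (0 : ℝ) < Module.finrank ℂ W := by exact_mod_cast Module.finrank_pos
  rw [hA1, ← Complex.ofReal_natCast, Complex.re_mul_ofReal] at hre
  rw [hA1, ← Complex.ofReal_natCast, Complex.im_mul_ofReal] at him
  have hcre : 0 ≤ c.re := nonneg_of_mul_nonneg_left hre hd
  have hcim : c.im = 0 := (mul_eq_zero.mp him).resolve_right hd.ne'
  have htot : ∑ g : A × B, ρ.character (g * g) =
      c * ∑ b : B, Representation.character (ρ.comp (MonoidHom.inr A B)) (b * b) := by
    have h1 : ∀ b : B, ∑ a : A, ρ.character ((a, b) * (a, b)) =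
        c * Representation.character (ρ.comp (MonoidHom.inr A B)) (b * b) := by
      intro b
      have h2 : ∀ a : A, ρ ((a, b) * (a, b)) = ρ (a * a, 1) * ρ (1, b * b) := by
        intro a
        rw [← map_mul]
        simp
      simp only [Representation.character, h2, ← map_sum, ← Finset.sum_mul]
      change LinearMap.trace ℂ W (S * ρ (1, b * b)) = _
      rw [hS', smul_mul_assoc, one_mul, map_smul]
      rfl
    rw [Finset.mul_sum, ← Finset.sum_congr rfl fun b _ => h1 b, Finset.sum_comm,
      ← Fintype.sum_prod_type' fun a b => ρ.character ((a, b) * (a, b))]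
    convert rfl
  rw [htot, Complex.mul_re, hcim, zero_mul, sub_zero]
  exact mul_nonneg hcre (hB _ W _)

theorem sum_coset [Fintype K] (B : Subgroup K) (c : K) (F : K → ℂ) :
    ∑ k, (if c⁻¹ * k ∈ B then F k else 0) = ∑ β : B, F (c * β) := by
  rw [← Equiv.sum_comp (Equiv.mulLeft c)]
  simp only [Equiv.coe_mulLeft, inv_mul_cancel_left]
  rw [← Finset.sum_filter]
  exact Finset.sum_subtype (f := fun k => F (c * k)) _ (by simp)

theorem NonnegFS.of_mulEquiv {A : Type} [Group A] [Finite A] (hA : NonnegFS A) (e : A ≃* K) :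
    NonnegFS K :=
  hA.of_surjective e.toMonoidHom e.surjective

theorem re_sum_character_comp_nonneg {B W : Type} [Group B] [Fintype B] [AddCommGroup W]
    [Module ℂ W] [FiniteDimensional ℂ W] (ρ : Representation ℂ K W) (φ : B →* K) :
    0 ≤ (∑ β, ρ.character (φ β)).re := by
  rw [sum_character_comp, ← Complex.ofReal_natCast, ← Complex.ofReal_natCast,
    ← Complex.ofReal_mul, Complex.ofReal_re]
  positivity

theorem sum_eq_add_sum_coset [Fintype K] (B : Subgroup K) (s : K) (hs : s ∉ B)
    (hK : ∀ k, k ∈ B ∨ s⁻¹ * k ∈ B) (F : K → ℂ) :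
    ∑ k, F k = ∑ β : B, F β + ∑ β : B, F (s * β) := by
  rw [← sum_coset B s, ← one_mul (∑ β : B, F β)]
  have h1 := sum_coset B 1 F
  simp only [inv_one, one_mul] at h1 ⊢
  rw [← h1, ← Finset.sum_add_distrib]
  refine Finset.sum_congr rfl fun k _ => ?_
  rcases hK k with h | h
  · have h' : s⁻¹ * k ∉ B := fun h2 => hs (by simpa using B.inv_mem ((B.mul_mem_cancel_right h).mp h2))
    rw [if_pos h, if_neg h', add_zero]
  · have h' : k ∉ B := fun h2 => hs (by simpa using B.inv_mem ((B.mul_mem_cancel_right h2).mp h))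
    rw [if_pos h, if_neg h', zero_add]

/-- A finite group generated by the image of `H × H` and an involution swapping the factors. -/
theorem NonnegFS.of_swap {H : Type} [Group H] [Finite H] [Finite K] (hH : NonnegFS H)
    (f : H × H →* K) (s : K) (hsf : ∀ a b, s * f (a, b) * s = f (b, a))
    (hK : ∀ k, k ∈ f.range ∨ s⁻¹ * k ∈ f.range) : NonnegFS K := by
  have : Fintype H := Fintype.ofFinite H
  have hN : NonnegFS f.range := (hH.prod hH).of_surjective f.rangeRestrict
    f.rangeRestrict_surjective
  by_cases hsr : s ∈ f.range
  · refine (hH.prod hH).of_surjective f fun k => ?_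
    rcases hK k with h | h
    · exact h
    · exact (f.range.mul_mem_cancel_left (f.range.inv_mem hsr)).mp h
  intro _ W _ _ _ ρ
  rw [sum_eq_add_sum_coset f.range s hsr hK, Complex.add_re]
  refine add_nonneg (hN _ W (ρ.comp f.range.subtype)) ?_
  have h1 : ∑ p : H × H, ρ.character (s * f p * (s * f p)) =
      Fintype.card H * ∑ g : H, ρ.character (f (g, g)) := by
    rw [Fintype.sum_prod_type]
    have h2 : ∀ a : H, ∑ b, ρ.character (s * f (a, b) * (s * f (a, b))) =
        ∑ g : H, ρ.character (f (g, g)) := by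
      intro a
      rw [← Equiv.sum_comp (Equiv.mulLeft a) fun g => ρ.character (f (g, g))]
      refine Finset.sum_congr rfl fun b _ => ?_
      rw [← mul_assoc, hsf, ← map_mul, ← Representation.char_conj ρ _ (f (a, 1)), ← map_inv,
        ← map_mul, ← map_mul]
      simp [mul_assoc]
    simp only [h2, Finset.sum_const, Finset.card_univ, nsmul_eq_mul]
  have h3 := sum_comp_of_surjective f.rangeRestrict f.rangeRestrict_surjective
    fun n => ρ.character (s * n * (s * n))
  have h4 : (∑ p : H × H, ρ.character (s * f p * (s * f p))).re =
      (Nat.card f.rangeRestrict.ker : ℝ) *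
        (∑ n : f.range, ρ.character (s * n * (s * n))).re := by
    rw [← Complex.re_ofReal_mul, Complex.ofReal_natCast, ← h3]
    rfl
  have h5 : 0 ≤ (∑ p : H × H, ρ.character (s * f p * (s * f p))).re := by
    rw [h1, ← Complex.ofReal_natCast, Complex.re_ofReal_mul]
    exact mul_nonneg (Nat.cast_nonneg _)
      (re_sum_character_comp_nonneg ρ (f.comp ((MonoidHom.id H).prod (MonoidHom.id H))))
  rw [h4] at h5
  have h6 := nonneg_of_mul_nonneg_right h5 (by exact_mod_cast Nat.card_pos)
  convert h6

/-- The squaring homomorphism of a commutative subgroup. -/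
def sqHom (B : Subgroup K) (hB : ∀ β ∈ B, ∀ γ ∈ B, β * γ = γ * β) : B →* K where
  toFun β := β * β
  map_one' := by simp
  map_mul' β γ := by
    simp only [Subgroup.coe_mul]
    rw [mul_assoc, ← mul_assoc (γ : K), hB γ γ.2 β β.2]
    simp only [mul_assoc]

theorem NonnegFS.of_comm [Finite K] (B : Subgroup K) (hB : ∀ β ∈ B, ∀ γ ∈ B, β * γ = γ * β) :
    NonnegFS B := by
  intro _ W _ _ _ ρ
  exact re_sum_character_comp_nonneg ρ
    (sqHom (K := B) ⊤ (fun β _ γ _ => Subtype.ext (hB β β.2 γ γ.2)) |>.comp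
      Subgroup.topEquiv.symm.toMonoidHom)

theorem NonnegFS.of_dihedral [Finite K] (B : Subgroup K)
    (hB : ∀ β ∈ B, ∀ γ ∈ B, β * γ = γ * β) (t : K)
    (htB : ∀ β ∈ B, t * β * t = β⁻¹) (hK : ∀ k, k ∈ B ∨ t⁻¹ * k ∈ B) : NonnegFS K := by
  by_cases htr : t ∈ B
  · refine (NonnegFS.of_comm B hB).of_surjective B.subtype fun k => ⟨⟨k, ?_⟩, rfl⟩
    rcases hK k with h | h
    · exact h
    · exact (B.mul_mem_cancel_left (B.inv_mem htr)).mp h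
  intro _ W _ _ _ ρ
  rw [sum_eq_add_sum_coset B t htr hK, Complex.add_re]
  refine add_nonneg (re_sum_character_comp_nonneg ρ (sqHom B hB)) ?_
  have h1 : ∀ β : B, ρ.character (t * β * (t * β)) = Module.finrank ℂ W := by
    intro β
    rw [← mul_assoc, htB β β.2, inv_mul_cancel, Representation.char_one]
  simp only [h1, Finset.sum_const, nsmul_eq_mul]
  rw [← Complex.ofReal_natCast, ← Complex.ofReal_natCast, ← Complex.ofReal_mul,
    Complex.ofReal_re]
  positivity

/-- A commutative subgroup inverted by an involution `t` and normalized by `b`, with quotient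
of order at most four generated by `t` and `b`. -/
theorem NonnegFS.of_semidihedral [Finite K] (B : Subgroup K)
    (hB : ∀ β ∈ B, ∀ γ ∈ B, β * γ = γ * β) (t : K) (ht : t * t = 1)
    (htB : ∀ β ∈ B, t * β * t = β⁻¹) (htn : t ∉ B) (b : K) (hb : ∀ β ∈ B, b⁻¹ * β * b ∈ B)
    (hbb : b * b ∈ B) (htb : t * b * t * b ∈ B)
    (hK : ∀ k, (k ∈ B ∨ t⁻¹ * k ∈ B) ∨ b⁻¹ * k ∈ B ∨ (t * b)⁻¹ * k ∈ B) : NonnegFS K := by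
  have hti : t⁻¹ = t := inv_eq_of_mul_eq_one_left ht
  by_cases hbB : b ∈ B
  · refine NonnegFS.of_dihedral B hB t htB fun k => ?_
    rcases hK k with h | h | h
    · exact h
    · exact Or.inl ((B.mul_mem_cancel_left (B.inv_mem hbB)).mp h)
    · rw [_root_.mul_inv_rev, mul_assoc] at h
      exact Or.inr ((B.mul_mem_cancel_left (B.inv_mem hbB)).mp h)
  by_cases htbB : t * b ∈ B
  · refine NonnegFS.of_dihedral B hB t htB fun k => ?_
    rcases hK k with h | h | h
    · exact h
    · refine Or.inr ?_
      have := B.mul_mem htbB h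
      rwa [mul_assoc, mul_inv_cancel_left, ← hti] at this
    · exact Or.inl ((B.mul_mem_cancel_left (B.inv_mem htbB)).mp h)
  intro _ W _ _ _ ρ
  let φ : B →* K :=
    { toFun := fun β => b⁻¹ * β * b * β
      map_one' := by simp
      map_mul' := fun β γ => by
        have h := hB _ (hb γ γ.2) β β.2
        simp only [Subgroup.coe_mul]
        calc b⁻¹ * (β * γ : K) * b * (β * γ) = b⁻¹ * β * b * ((b⁻¹ * γ * b) * β) * γ := by group
          _ = _ := by rw [h]; group }
  let ψ : B →* K :=
    { toFun := fun β => b⁻¹ * (β : K)⁻¹ * b * β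
      map_one' := by simp
      map_mul' := fun β γ => by
        have h := hB _ (hb _ (B.inv_mem γ.2)) β β.2
        have h2 := hB _ (B.inv_mem β.2) _ (B.inv_mem γ.2)
        simp only [Subgroup.coe_mul]
        calc b⁻¹ * (β * γ : K)⁻¹ * b * (β * γ) = b⁻¹ * ((γ : K)⁻¹ * (β : K)⁻¹) * b * (β * γ) := by
              group
          _ = b⁻¹ * (β : K)⁻¹ * b * ((b⁻¹ * (γ : K)⁻¹ * b) * β) * γ := by rw [← h2]; group
          _ = _ := by rw [h]; group }
  have hφB : ∀ β : B, φ β ∈ B := fun β => B.mul_mem (hb β β.2) β.2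
  have hψB : ∀ β : B, ψ β ∈ B := fun β => B.mul_mem (hb _ (B.inv_mem β.2)) β.2
  have hbφ : ∀ β : B, b * β * (b * β) = b * b * φ β := fun β => by
    change _ = b * b * (b⁻¹ * β * b * β); group
  have htbψ : ∀ β : B, t * b * β * (t * b * β) = t * b * t * b * ψ β := fun β => by
    change _ = t * b * t * b * (b⁻¹ * (β : K)⁻¹ * b * β)
    rw [← htB β β.2]
    calc t * b * β * (t * b * β) = t * b * 1 * β * (t * b * β) := by group
      _ = t * b * (t * t) * β * (t * b * β) := by rw [ht]
      _ = _ := by group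
  have hsum : ∑ k, ρ.character (k * k) = (∑ β : B, ρ.character (β * β : K) +
      ∑ β : B, ρ.character (t * β * (t * β))) + (∑ β : B, ρ.character (b * β * (b * β)) +
      ∑ β : B, ρ.character (t * b * β * (t * b * β))) := by
    have h1 := sum_coset B 1 fun k => ρ.character (k * k)
    simp only [inv_one, one_mul] at h1
    rw [← h1, ← sum_coset B t fun k => ρ.character (k * k),
      ← sum_coset B b fun k => ρ.character (k * k),
      ← sum_coset B (t * b) fun k => ρ.character (k * k), ← Finset.sum_add_distrib,
      ← Finset.sum_add_distrib, ← Finset.sum_add_distrib]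
    refine Finset.sum_congr rfl fun k _ => ?_
    have key : ∀ c d : K, c⁻¹ * k ∈ B → d⁻¹ * k ∈ B → d⁻¹ * c ∈ B := fun c d hc hd => by
      have := B.mul_mem hd (B.inv_mem hc)
      simpa [mul_assoc] using this
    have k1 : ¬ (k ∈ B ∧ t⁻¹ * k ∈ B) := fun h =>
      htn (by simpa using B.inv_mem (key 1 t (by simpa using h.1) h.2))
    have k2 : ¬ (k ∈ B ∧ b⁻¹ * k ∈ B) := fun h =>
      hbB (by simpa using B.inv_mem (key 1 b (by simpa using h.1) h.2))
    have k3 : ¬ (k ∈ B ∧ (t * b)⁻¹ * k ∈ B) := fun h =>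
      htbB (B.inv_mem_iff.mp (by simpa using key 1 (t * b) (by simpa using h.1) h.2))
    have k4 : ¬ (t⁻¹ * k ∈ B ∧ b⁻¹ * k ∈ B) := fun h =>
      htbB (by simpa [hti] using key b t h.2 h.1)
    have k5 : ¬ (t⁻¹ * k ∈ B ∧ (t * b)⁻¹ * k ∈ B) := fun h =>
      hbB (by simpa using key (t * b) t h.2 h.1)
    have k6 : ¬ (b⁻¹ * k ∈ B ∧ (t * b)⁻¹ * k ∈ B) := fun h => by
      have h1 := key b (t * b) h.1 h.2
      have h2 := B.mul_mem (B.mul_mem hbb (hb _ h1)) (B.inv_mem hbb)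
      have h3 : b * b * (b⁻¹ * ((t * b)⁻¹ * b) * b) * (b * b)⁻¹ = t⁻¹ := by group
      rw [h3, hti] at h2
      exact htn h2
    have h1 := hK k
    by_cases c1 : k ∈ B
    · have c2 : t⁻¹ * k ∉ B := fun h => k1 ⟨c1, h⟩
      have c3 : b⁻¹ * k ∉ B := fun h => k2 ⟨c1, h⟩
      have c4 : (t * b)⁻¹ * k ∉ B := fun h => k3 ⟨c1, h⟩
      rw [if_pos c1, if_neg c2, if_neg c3, if_neg c4]; ring
    by_cases c2 : t⁻¹ * k ∈ B
    · have c3 : b⁻¹ * k ∉ B := fun h => k4 ⟨c2, h⟩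
      have c4 : (t * b)⁻¹ * k ∉ B := fun h => k5 ⟨c2, h⟩
      rw [if_neg c1, if_pos c2, if_neg c3, if_neg c4]; ring
    by_cases c3 : b⁻¹ * k ∈ B
    · have c4 : (t * b)⁻¹ * k ∉ B := fun h => k6 ⟨c3, h⟩
      rw [if_neg c1, if_neg c2, if_pos c3, if_neg c4]; ring
    have c4 : (t * b)⁻¹ * k ∈ B := by tauto
    rw [if_neg c1, if_neg c2, if_neg c3, if_pos c4]; ring
  have s1 : ∑ β : B, ρ.character (β * β : K) = Fintype.card B *
      (Module.finrank ℂ (Representation.invariants (ρ.comp (sqHom B hB))) : ℂ) :=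
    sum_character_comp ρ (sqHom B hB)
  have s2 : ∑ β : B, ρ.character (t * β * (t * β)) = Fintype.card B *
      (Module.finrank ℂ W : ℂ) := by
    have h1 : ∀ β : B, ρ.character (t * β * (t * β)) = Module.finrank ℂ W := by
      intro β
      rw [← mul_assoc, htB β β.2, inv_mul_cancel, Representation.char_one]
    simp only [h1, Finset.sum_const, nsmul_eq_mul, Finset.card_univ]
  have s3 := norm_sum_character_coset_le ρ φ (b * b) fun β => hB _ hbb _ (hφB β)
  have s4 := norm_sum_character_coset_le ρ ψ (t * b * t * b) fun β => hB _ htb _ (hψB β)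
  simp only [hsum, hbφ, htbψ, s1, s2, Complex.add_re]
  have s5 := (abs_le.mp ((Complex.abs_re_le_norm _).trans s3)).1
  have s6 := (abs_le.mp ((Complex.abs_re_le_norm _).trans s4)).1
  have hdim : Module.finrank ℂ (Representation.invariants (ρ.comp φ)) +
      Module.finrank ℂ (Representation.invariants (ρ.comp ψ)) ≤ Module.finrank ℂ W +
      Module.finrank ℂ (Representation.invariants (ρ.comp (sqHom B hB))) := by
    rw [← Submodule.finrank_sup_add_finrank_inf_eq]
    refine add_le_add (Submodule.finrank_le _) (Submodule.finrank_mono ?_)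
    rintro w ⟨hw1, hw2⟩ β
    have e1 : ρ (φ β) w = w := hw1 β
    have e2 : ρ (ψ β) w = w := hw2 β
    have e3 : sqHom B hB β = φ β * ψ β := by
      change (β * β : K) = b⁻¹ * β * b * β * (b⁻¹ * (β : K)⁻¹ * b * β)
      rw [← hB β β.2 _ (hb β β.2)]
      group
    change ρ (sqHom B hB β) w = w
    rw [e3, map_mul, Module.End.mul_apply, e2, e1]
  have hdim' : (Module.finrank ℂ (Representation.invariants (ρ.comp φ)) : ℝ) +
      Module.finrank ℂ (Representation.invariants (ρ.comp ψ)) ≤ Module.finrank ℂ W +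
      Module.finrank ℂ (Representation.invariants (ρ.comp (sqHom B hB))) := by exact_mod_cast hdim
  have hmul := mul_le_mul_of_nonneg_left hdim' (Nat.cast_nonneg (α := ℝ) (Fintype.card B))
  simp only [← Complex.ofReal_natCast, ← Complex.ofReal_mul, Complex.ofReal_re]
  nlinarith [s5, s6, hmul]

end Closure

section Parity

theorem exists_isIntegral_sum {ι : Type*} (s : Finset ι) (n : ℂ) (f : ι → ℂ)
    (h : ∀ i ∈ s, ∃ z, IsIntegral ℤ z ∧ f i = n * z) :
    ∃ z, IsIntegral ℤ z ∧ ∑ i ∈ s, f i = n * z := by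
  choose! z hz hf using h
  exact ⟨∑ i ∈ s, z i, IsIntegral.sum _ hz, by
    rw [Finset.mul_sum]; exact Finset.sum_congr rfl hf⟩

/-- A sum of an invariant function over a finite `Γ`-set is divisible by the order of `Γ` as soon
as each value is divisible by the order of the stabilizer. -/
theorem exists_isIntegral_sum_of_stabilizer {Γ Ω : Type} [Group Γ] [Finite Γ] [Fintype Ω]
    [MulAction Γ Ω] (Z : Ω → ℂ) (hinv : ∀ (γ : Γ) ω, Z (γ • ω) = Z ω)
    (h : ∀ ω, ∃ z, IsIntegral ℤ z ∧ Z ω = Nat.card (MulAction.stabilizer Γ ω) * z) :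
    ∃ z, IsIntegral ℤ z ∧ ∑ ω, Z ω = Nat.card Γ * z := by
  have : Fintype Γ := Fintype.ofFinite Γ
  have e := MulAction.selfEquivSigmaOrbits Γ Ω
  have h1 : ∑ ω, Z ω = ∑ q : MulAction.orbitRel.Quotient Γ Ω,
      ∑ ω ∈ Finset.univ.filter (fun ω => Quotient.mk'' ω = q), Z ω :=
    (Finset.sum_fiberwise_of_maps_to (fun _ _ => Finset.mem_univ _) _).symm
  rw [h1]
  refine exists_isIntegral_sum _ _ _ fun q _ => ?_
  obtain ⟨ω, rfl⟩ := Quotient.exists_rep q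
  obtain ⟨z, hz, hZ⟩ := h ω
  refine ⟨z, hz, ?_⟩
  have h2 : ∀ ω' ∈ Finset.univ.filter (fun ω' : Ω =>
      (Quotient.mk'' ω' : MulAction.orbitRel.Quotient Γ Ω) = ⟦ω⟧), Z ω' = Z ω := by
    intro ω' hω'
    obtain ⟨γ, rfl⟩ : ω' ∈ MulAction.orbit Γ ω :=
      Quotient.exact' (Finset.mem_filter.mp hω').2
    exact hinv γ ω
  have h3 : (Finset.univ.filter (fun ω' : Ω =>
      (Quotient.mk'' ω' : MulAction.orbitRel.Quotient Γ Ω) = ⟦ω⟧)).card =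
      Fintype.card (MulAction.orbit Γ ω) := by
    rw [← Set.toFinset_card]
    congr 1
    ext ω'
    rw [Finset.mem_filter, Set.mem_toFinset]
    exact ⟨fun h => Quotient.exact' h.2, fun h => ⟨Finset.mem_univ _, Quotient.sound' h⟩⟩
  rw [Finset.sum_congr rfl h2, Finset.sum_const, h3, nsmul_eq_mul, hZ,
    Nat.card_eq_fintype_card, Nat.card_eq_fintype_card, ← mul_assoc, ← Nat.cast_mul,
    MulAction.card_orbit_mul_card_stabilizer_eq_card_group]

variable {G W : Type} [Group G] [AddCommGroup W] [Module ℂ W] [FiniteDimensional ℂ W]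

/-- Every element of a finite group is uniquely a product of commuting elements of orders
dividing the two coprime factors of the order of the group. -/
theorem sum_eq_sum_commute [Fintype G] {r s : ℕ} (hrs : r.Coprime s)
    (hG : Fintype.card G = r * s) (f : G → ℂ) :
    ∑ g, f g = ∑ x : G, ∑ u : G,
      if x ^ r = 1 ∧ u ^ s = 1 ∧ x * u = u * x then f (x * u) else 0 := by
  obtain ⟨e, he1, he2⟩ := Nat.chineseRemainder hrs 1 0
  obtain ⟨e', he1', he2'⟩ := Nat.chineseRemainder hrs 0 1
  have hpow : ∀ (g : G) (n a b : ℕ), g ^ n = 1 → a ≡ b [MOD n] → g ^ a = g ^ b := by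
    intro g n a b hg hab
    exact pow_eq_pow_iff_modEq.mpr (hab.of_dvd (orderOf_dvd_of_pow_eq_one hg))
  have hsum : ∀ g : G, g ^ e * g ^ e' = g := by
    intro g
    rw [← pow_add]
    conv_rhs => rw [← pow_one g]
    refine hpow g (r * s) _ _ (hG ▸ pow_card_eq_one) ?_
    refine (Nat.modEq_and_modEq_iff_modEq_mul hrs).mp ⟨?_, ?_⟩
    · simpa using he1.add he1'
    · simpa using he2.add he2'
  have hr : ∀ g : G, (g ^ e) ^ r = 1 := by
    intro g
    rw [← pow_mul]
    have : e * r ≡ 0 [MOD r * s] := by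
      obtain ⟨k, hk⟩ := (Nat.modEq_zero_iff_dvd).mp he2
      exact Nat.modEq_zero_iff_dvd.mpr ⟨k, by rw [hk]; ring⟩
    rw [hpow g (r * s) _ 0 (hG ▸ pow_card_eq_one) this, pow_zero]
  have hs : ∀ g : G, (g ^ e') ^ s = 1 := by
    intro g
    rw [← pow_mul]
    have : e' * s ≡ 0 [MOD r * s] := by
      obtain ⟨k, hk⟩ := (Nat.modEq_zero_iff_dvd).mp he1'
      exact Nat.modEq_zero_iff_dvd.mpr ⟨k, by rw [hk]; ring⟩
    rw [hpow g (r * s) _ 0 (hG ▸ pow_card_eq_one) this, pow_zero]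
  rw [← Finset.sum_product', Finset.univ_product_univ, ← Finset.sum_filter]
  refine Finset.sum_bij' (fun g _ => (g ^ e, g ^ e')) (fun p _ => p.1 * p.2) ?_ ?_ ?_ ?_ ?_
  · intro g _
    simp only [Finset.mem_filter, Finset.mem_univ, true_and]
    exact ⟨hr g, hs g, by rw [← pow_add, ← pow_add, add_comm]⟩
  · intro p _; exact Finset.mem_univ _
  · intro g _; exact hsum g
  · rintro ⟨x, u⟩ hp
    simp only [Finset.mem_filter, Finset.mem_univ, true_and] at hp
    obtain ⟨h1, h2, h3⟩ := hp
    have hc : Commute x u := h3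
    simp only [hc.mul_pow]
    rw [hpow x r e 1 h1 he1, hpow u s e 0 h2 he2, hpow x r e' 0 h1 he1', hpow u s e' 1 h2 he2']
    simp
  · intro g _; rw [hsum]

theorem character_inv_of_invariantForm (ρ : Representation ℂ G W)
    {ω : W →ₗ[ℂ] W →ₗ[ℂ] ℂ} (hω : InvariantForm ρ ω) (hinj : Function.Injective ω) (g : G) :
    ρ.character g⁻¹ = ρ.character g := by
  let e : W ≃ₗ[ℂ] (W →ₗ[ℂ] ℂ) := LinearEquiv.ofInjectiveOfFinrankEq ω hinj
    (Subspace.dual_finrank_eq (K := ℂ) (V := W)).symm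
  rw [← Representation.char_dual]
  refine (congrFun (Representation.char_iso (ρ := ρ) (σ := ρ.dual)
    (Representation.Equiv.mk e fun g => ?_)) g).symm
  ext v w
  change ω (ρ g v) w = ω v (ρ g⁻¹ w)
  rw [← hω g v, ← Module.End.mul_apply (ρ g), ← map_mul, mul_inv_cancel, map_one]
  rfl

theorem sum_character_mul_inv [Fintype G] (ρ : Representation ℂ G W) (hρ : ρ.IsIrreducible) :
    ∑ g, ρ.character g * ρ.character g⁻¹ = Fintype.card G := by
  have h0 : (Nat.card G : ℂ) ≠ 0 := by exact_mod_cast Nat.card_pos.ne'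
  have : Invertible (Nat.card G : ℂ) := invertibleOfNonzero h0
  have h := Representation.char_orthonormal ρ ρ
  rw [if_pos ⟨Representation.Equiv.refl ρ⟩] at h
  rw [← Nat.card_eq_fintype_card]
  field_simp at h
  exact h

end Parity

section Parity

variable {G : Type} [Group G]

/-- Sylow-type conjugation inside the extended centralizer of `x`. -/
theorem exists_conj_mem_of_isPGroup [Finite G] (x : G) (K T : Subgroup G)
    (hK : ¬ 2 ∣ K.relIndex (Subgroup.centralizer {x})) (k : G) (hkK : k ∈ K)
    (hk : k * x * k⁻¹ = x⁻¹) (hT : IsPGroup 2 T)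
    (hTx : ∀ t ∈ T, t * x * t⁻¹ = x ∨ t * x * t⁻¹ = x⁻¹) :
    ∃ c, c * x = x * c ∧ ∀ t ∈ T, c⁻¹ * t * c ∈ K := by
  let C := Subgroup.centralizer ({x} : Set G)
  have hC : ∀ c, c ∈ C ↔ c * x * c⁻¹ = x := fun c => by
    rw [Subgroup.mem_centralizer_singleton_iff, mul_inv_eq_iff_eq_mul, eq_comm]
  let O := MulAction.orbit C ((1 : G) : G ⧸ K)
  have hO : ∀ c ∈ C, ∀ κ ∈ K, ((c * κ : G) : G ⧸ K) ∈ O := fun c hc κ hκ =>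
    ⟨⟨c, hc⟩, by
      change ((c * 1 : G) : G ⧸ K) = _
      rw [QuotientGroup.eq]
      simpa using hκ⟩
  have hmem : ∀ t ∈ T, ∀ y ∈ O, t • y ∈ O := by
    rintro t ht _ ⟨⟨c, hc⟩, rfl⟩
    change ((t * (c * 1) : G) : G ⧸ K) ∈ O
    rw [mul_one]
    rcases hTx t ht with h | h
    · simpa using hO (t * c) (C.mul_mem ((hC t).mpr h) hc) 1 K.one_mem
    · have h2 : t * c = t * c * k⁻¹ * k := by group
      rw [h2]
      refine hO _ ?_ k hkK
      rw [hC] at hc ⊢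
      have hk' : k⁻¹ * x * k = x⁻¹ := by
        rw [← _root_.inv_inj, ← hk]; simp only [_root_.mul_inv_rev, inv_inv, hk]
        have : x⁻¹ = k * x * k⁻¹ := hk.symm
        simp [mul_assoc, this]
      have hc' : c * x⁻¹ * c⁻¹ = x⁻¹ := by
        rw [← _root_.inv_inj]; simpa [mul_assoc] using hc
      have h' : t * x⁻¹ * t⁻¹ = x := by
        rw [← _root_.inv_inj]; simpa [mul_assoc] using h
      calc t * c * k⁻¹ * x * (t * c * k⁻¹)⁻¹ = t * (c * (k⁻¹ * x * k) * c⁻¹) * t⁻¹ := by group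
        _ = x := by rw [hk', hc', h']
  let _ : MulAction T O :=
    { smul := fun t y => ⟨(t : G) • (y : G ⧸ K), hmem t t.2 y y.2⟩
      one_smul := fun y => Subtype.ext (one_smul G (y : G ⧸ K))
      mul_smul := fun s t y => Subtype.ext (mul_smul (s : G) t (y : G ⧸ K)) }
  have hcard : Nat.card O = K.relIndex C := by
    rw [Nat.card_coe_set_eq, ← MulAction.index_stabilizer]
    congr 1
    ext c
    rw [MulAction.mem_stabilizer_iff, Subgroup.mem_subgroupOf]
    change ((c * 1 : G) : G ⧸ K) = _ ↔ _
    rw [mul_one, eq_comm, QuotientGroup.eq]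
    simp
  obtain ⟨⟨_, ⟨c, hc⟩, rfl⟩, hfix⟩ :=
    hT.nonempty_fixed_point_of_prime_not_dvd_card O (by rwa [hcard])
  refine ⟨c, mul_inv_eq_iff_eq_mul.mp ((hC c).mp hc), fun t ht => ?_⟩
  have h := congrArg Subtype.val (hfix ⟨t, ht⟩)
  have h2 : ((t * (c * 1) : G) : G ⧸ K) = ((c * 1 : G) : G ⧸ K) := h
  rw [mul_one, eq_comm, QuotientGroup.eq] at h2
  rwa [mul_assoc]

end Parity

section Parity

variable {G W : Type} [Group G] [AddCommGroup W] [Module ℂ W] [FiniteDimensional ℂ W]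

theorem exists_isIntegral_sum_sq [Finite G] {T : Type} [Group T] [Fintype T]
    (ρ : Representation ℂ G W) (φ : T →* G) (x : G) (hx : ∀ u, x * φ u = φ u * x) :
    ∃ z, IsIntegral ℤ z ∧ ∑ u, ρ.character (x * φ u) ^ 2 = Fintype.card T * z := by
  obtain ⟨z, hz, h⟩ := exists_sum_character_coset_integral (ρ.tprod ρ) φ x hx
  refine ⟨z, hz, h ▸ Finset.sum_congr rfl fun u _ => ?_⟩
  rw [Representation.char_tensor, Pi.mul_apply, sq]

theorem exists_isIntegral_sum_mul_inv [Finite G] {T : Type} [Group T] [Fintype T]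
    (ρ : Representation ℂ G W) (φ : T →* G) (x : G) (hx : ∀ u, x * φ u = φ u * x) :
    ∃ z, IsIntegral ℤ z ∧
      ∑ u, ρ.character (x * φ u) * ρ.character (x * φ u)⁻¹ = Fintype.card T * z := by
  obtain ⟨z, hz, h⟩ := exists_sum_character_coset_integral (ρ.tprod ρ.dual) φ x hx
  refine ⟨z, hz, h ▸ Finset.sum_congr rfl fun u _ => ?_⟩
  rw [Representation.char_tensor, Pi.mul_apply, Representation.char_dual]

/-- If `x` is inverted inside a group with nonnegative Frobenius-Schur sums, then the sum of the
squares of a symplectic character over a coset is even. -/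
theorem NonnegFS.exists_isIntegral_sum_sq_even [Finite G] (K T : Subgroup G)
    [Fintype T] (hK : NonnegFS K)
    (ρ : Representation ℂ G W) {ω : W →ₗ[ℂ] W →ₗ[ℂ] ℂ} (hω : InvariantForm ρ ω)
    (halt : ∀ v w, ω w v = -ω v w) (hinj : Function.Injective ω) (x : G) (hxK : x ∈ K)
    (hTK : T ≤ K) (hxT : ∀ u ∈ T, x * u = u * x) (k : G) (hkK : k ∈ K)
    (hkx : k * x * k⁻¹ = x⁻¹) (hkT : ∀ u ∈ T, k * u * k⁻¹ ∈ T) :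
    ∃ z, IsIntegral ℤ z ∧ ∑ u : T, ρ.character (x * u) ^ 2 = 2 * Nat.card T * z := by
  have : Fintype K := Fintype.ofFinite K
  obtain ⟨L, _, _, _, η, hη⟩ := hK.exists_character_eq_add_inv (ρ.comp K.subtype)
    (ω := ω) (fun g v w => hω g v w) halt hinj
  let φ : T →* K := Subgroup.inclusion hTK
  let x' : K := ⟨x, hxK⟩
  let k' : K := ⟨k, hkK⟩
  have hx' : ∀ u, x' * φ u = φ u * x' := fun u => Subtype.ext (hxT u u.2)
  have hkx' : k' * x' * k'⁻¹ = x'⁻¹ := Subtype.ext hkx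
  obtain ⟨z1, hz1, h1⟩ := exists_isIntegral_sum_sq η φ x' hx'
  obtain ⟨z2, hz2, h2⟩ := exists_isIntegral_sum_mul_inv η φ x' hx'
  refine ⟨z1 + z2, hz1.add hz2, ?_⟩
  have hχ : ∀ u : T, ρ.character (x * u) =
      η.character (x' * φ u) + η.character (x' * φ u)⁻¹ := fun u => hη (x' * φ u)
  have h3 : ∑ u, η.character (x' * φ u)⁻¹ ^ 2 = ∑ u, η.character (x' * φ u) ^ 2 := by
    let c : T → T := fun u => ⟨k * u * k⁻¹, hkT u u.2⟩
    have hc : Function.Bijective c := by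
      rw [← Finite.injective_iff_bijective]
      intro u v huv
      have := congrArg Subtype.val huv
      exact Subtype.ext (by simpa [c] using this)
    rw [← Equiv.sum_comp (Equiv.inv T), ← Function.Bijective.sum_comp hc
      fun u => η.character (x' * φ (Equiv.inv T u))⁻¹ ^ 2]
    refine Finset.sum_congr rfl fun u _ => ?_
    rw [← Representation.char_conj η (x' * φ u) k']
    congr 2
    have e1 : φ (Equiv.inv T (c u)) = (k' * φ u * k'⁻¹)⁻¹ := rfl
    rw [e1, _root_.mul_inv_rev, inv_inv, ← hkx', hx' u]
    group
  simp only [hχ, add_sq, Finset.sum_add_distrib, h3, mul_assoc, ← Finset.mul_sum, h1, h2]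
  rw [Nat.card_eq_fintype_card]
  ring

end Parity

section Parity

variable {G : Type} [Group G]

/-- The action of `G × {±1}` on pairs, by conjugation and inversion on the first factor. -/
@[reducible] def pairAction (G Y : Type) [Group G] [MulAction G Y] :
    MulAction (G × ℤˣ) (G × Y) where
  smul γ ω := (γ.1 * ω.1 ^ (γ.2 : ℤ) * γ.1⁻¹, γ.1 • ω.2)
  one_smul ω := by
    change ((1 : G) * ω.1 ^ ((1 : ℤˣ) : ℤ) * (1 : G)⁻¹, (1 : G) • ω.2) = ω
    simp
  mul_smul γ δ ω := by
    change ((γ.1 * δ.1) * ω.1 ^ ((γ.2 * δ.2 : ℤˣ) : ℤ) * (γ.1 * δ.1)⁻¹, (γ.1 * δ.1) • ω.2) =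
      (γ.1 * (δ.1 * ω.1 ^ (δ.2 : ℤ) * δ.1⁻¹) ^ (γ.2 : ℤ) * γ.1⁻¹, γ.1 • δ.1 • ω.2)
    rw [mul_smul, conj_zpow, ← _root_.zpow_mul, Units.val_mul, mul_comm (γ.2 : ℤ)]
    simp [mul_assoc]

/-- The sum of the squares of the values of a function at elements whose first part is `x` and
whose second part stabilizes `y`. -/
def localSum {Y : Type} [Fintype G] [MulAction G Y] (χ : G → ℂ) (r : ℕ) (ω : G × Y) : ℂ :=
  ∑ u : G, if ω.1 ^ r = 1 ∧ ω.1 * u = u * ω.1 ∧ u • ω.2 = ω.2 then χ (ω.1 * u) ^ 2 else 0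

theorem localSum_smul {Y : Type} [Fintype G] [MulAction G Y] (χ : G → ℂ) (r : ℕ)
    (hconj : ∀ g h, χ (g * h * g⁻¹) = χ h) (hinv : ∀ g, χ g⁻¹ = χ g) (γ : G × ℤˣ) (ω : G × Y) :
    localSum χ r ((pairAction G Y).smul γ ω) = localSum χ r ω := by
  obtain ⟨g, ε⟩ := γ
  obtain ⟨x, y⟩ := ω
  change localSum χ r (g * x ^ (ε : ℤ) * g⁻¹, g • y) = _
  have hε : ∀ a b : G, a ^ (ε : ℤ) = b ^ (ε : ℤ) ↔ a = b := by
    intro a b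
    rcases Int.units_eq_one_or ε with rfl | rfl <;> simp
  have hχ : ∀ h : G, χ (h ^ (ε : ℤ)) = χ h := by
    intro h
    rcases Int.units_eq_one_or ε with rfl | rfl <;> simp [hinv]
  have hb : Function.Bijective fun u : G => g * u ^ (ε : ℤ) * g⁻¹ := by
    rw [← Finite.injective_iff_bijective]
    intro u v huv
    simpa [hε] using huv
  unfold localSum
  rw [← hb.sum_comp]
  refine Finset.sum_congr rfl fun u _ => ?_
  have h1 : (g * x ^ (ε : ℤ) * g⁻¹) ^ r = 1 ↔ x ^ r = 1 := by
    rw [conj_pow, conj_eq_one_iff, ← zpow_natCast, ← _root_.zpow_mul, mul_comm, _root_.zpow_mul,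
      zpow_natCast]
    rcases Int.units_eq_one_or ε with rfl | rfl <;> simp
  have h2 : g * x ^ (ε : ℤ) * g⁻¹ * (g * u ^ (ε : ℤ) * g⁻¹) =
      g * u ^ (ε : ℤ) * g⁻¹ * (g * x ^ (ε : ℤ) * g⁻¹) ↔ x * u = u * x := by
    rcases Int.units_eq_one_or ε with rfl | rfl
    · simp only [Units.val_one, zpow_one, mul_assoc, inv_mul_cancel_left, mul_right_inj]
      rw [← mul_assoc, ← mul_assoc, mul_left_inj]
    · simp only [Units.val_neg, Units.val_one, _root_.zpow_neg, zpow_one, mul_assoc,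
        inv_mul_cancel_left, mul_right_inj]
      rw [← mul_assoc, ← mul_assoc, mul_left_inj, ← _root_.inv_inj]
      simp [eq_comm]
  have h3 : (g * u ^ (ε : ℤ) * g⁻¹) • g • y = g • y ↔ u • y = y := by
    rw [smul_smul, inv_mul_cancel_right, mul_smul, smul_left_cancel_iff]
    rcases Int.units_eq_one_or ε with rfl | rfl
    · simp
    · simp only [Units.val_neg, Units.val_one, _root_.zpow_neg, zpow_one]
      rw [inv_smul_eq_iff, eq_comm]
  simp only [h1, h2, h3]
  by_cases hc : x ^ r = 1 ∧ x * u = u * x ∧ u • y = y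
  · rw [if_pos hc, if_pos hc]
    congr 1
    rw [← hχ (x * u), ← hconj g ((x * u) ^ (ε : ℤ)), (show Commute x u from hc.2.1).mul_zpow]
    congr 1
    simp only [mul_assoc, inv_mul_cancel_left]
  · rw [if_neg hc, if_neg hc]

theorem exists_isIntegral_localSum {W : Type} [AddCommGroup W] [Module ℂ W]
    [FiniteDimensional ℂ W] [Fintype G] {Y : Type} [MulAction G Y]
    (hY : ∀ y : Y, IsPGroup 2 (MulAction.stabilizer G y)) (ρ : Representation ℂ G W)
    {ω : W →ₗ[ℂ] W →ₗ[ℂ] ℂ} (hω : InvariantForm ρ ω)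
    (halt : ∀ v w, ω w v = -ω v w) (hinj : Function.Injective ω) (r : ℕ)
    (h : ∀ x : G, x ^ r = 1 → ∃ K : Subgroup G, NonnegFS K ∧ x ∈ K ∧
      ¬ 2 ∣ K.relIndex (Subgroup.centralizer {x}) ∧ ∃ k ∈ K, k * x * k⁻¹ = x⁻¹) (p : G × Y) :
    ∃ z, IsIntegral ℤ z ∧ localSum ρ.character r p =
      (Nat.card (@MulAction.stabilizer _ _ _ (pairAction G Y) p) : ℂ) * z := by
  obtain ⟨x, y⟩ := p
  let _ := pairAction G Y
  by_cases hx : x ^ r = 1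
  swap
  · exact ⟨0, isIntegral_zero, by simp [localSum, hx]⟩
  let T : Subgroup G := Subgroup.centralizer {x} ⊓ MulAction.stabilizer G y
  have hT : ∀ u, u ∈ T ↔ x * u = u * x ∧ u • y = y := fun u => by
    rw [Subgroup.mem_inf, Subgroup.mem_centralizer_singleton_iff, MulAction.mem_stabilizer_iff]
    constructor <;> rintro ⟨h1, h2⟩ <;> exact ⟨h1.symm, h2⟩
  have hsum : localSum ρ.character r (x, y) = ∑ u : T, ρ.character (x * u) ^ 2 := by
    have h1 : ∀ u : G, (x ^ r = 1 ∧ x * u = u * x ∧ u • y = y) ↔ u ∈ T := fun u => by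
      rw [hT]; exact and_iff_right hx
    simp only [localSum, h1]
    rw [← Finset.sum_filter]
    exact Finset.sum_subtype (f := fun u => ρ.character (x * u) ^ 2) _ (by simp)
  have hstab : ∀ γ : G × ℤˣ, γ ∈ MulAction.stabilizer (G × ℤˣ) ((x, y) : G × Y) ↔
      γ.1 * x ^ (γ.2 : ℤ) * γ.1⁻¹ = x ∧ γ.1 • y = y := fun γ => by
    rw [MulAction.mem_stabilizer_iff]
    exact Prod.ext_iff
  let f : T →* MulAction.stabilizer (G × ℤˣ) ((x, y) : G × Y) :=
    { toFun := fun u => ⟨(u, 1), (hstab _).mpr (by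
        have := (hT u).mp u.2
        refine ⟨?_, this.2⟩
        simp [← this.1])⟩
      map_one' := rfl
      map_mul' := fun u v => Subtype.ext (Prod.ext rfl (mul_one 1).symm) }
  have hf : Function.Injective f := fun u v huv =>
    Subtype.ext (congrArg (fun γ => γ.1.1) huv)
  by_cases hk : ∃ k : G, k • y = y ∧ k * x * k⁻¹ = x⁻¹
  · obtain ⟨k, hky, hkx⟩ := hk
    obtain ⟨K, hK, hxK, hrel, k₁, hk₁K, hk₁⟩ := h x hx
    let f2 : MulAction.stabilizer (G × ℤˣ) ((x, y) : G × Y) →* G :=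
      (MonoidHom.fst G ℤˣ).comp (Subgroup.subtype _)
    have hf2 : ∀ t ∈ f2.range, t • y = y ∧ (t * x * t⁻¹ = x ∨ t * x * t⁻¹ = x⁻¹) := by
      rintro _ ⟨⟨⟨t, ε⟩, ht⟩, rfl⟩
      obtain ⟨h1, h2⟩ := (hstab _).mp ht
      refine ⟨h2, ?_⟩
      rcases Int.units_eq_one_or ε with rfl | rfl
      · left
        change t * x * t⁻¹ = x
        simpa using h1
      · right
        have h3 : t * x⁻¹ * t⁻¹ = x := by simpa using h1
        change t * x * t⁻¹ = x⁻¹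
        rw [← _root_.inv_inj]
        simpa [mul_assoc] using h3
    have hpg : IsPGroup 2 f2.range := (hY y).to_le fun t ht => (hf2 t ht).1
    obtain ⟨c, hc, hcK⟩ := exists_conj_mem_of_isPGroup x K f2.range hrel k₁ hk₁K hk₁ hpg
      fun t ht => (hf2 t ht).2
    let K' := K.map (MulAut.conj c).toMonoidHom
    have hK'mem : ∀ g, g ∈ K' ↔ c⁻¹ * g * c ∈ K := fun g => by
      rw [Subgroup.mem_map_equiv]
      simp
    have hK' : NonnegFS K' := hK.of_mulEquiv (K.equivMapOfInjective _ (MulAut.conj c).injective)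
    have hTr : ∀ u ∈ T, u ∈ f2.range := fun u hu => ⟨f ⟨u, hu⟩, rfl⟩
    have hkr : k ∈ f2.range := ⟨⟨(k, -1), (hstab _).mpr ⟨by
      change k * x ^ (-1 : ℤ) * k⁻¹ = x
      rw [_root_.zpow_neg_one, ← _root_.inv_inj]
      simpa [mul_assoc] using hkx, hky⟩⟩, rfl⟩
    obtain ⟨z, hz, hz2⟩ := hK'.exists_isIntegral_sum_sq_even K' T ρ hω halt hinj x
      ((hK'mem x).mpr (by rw [mul_assoc, ← hc, inv_mul_cancel_left]; exact hxK))
      (fun u hu => (hK'mem u).mpr (hcK u (hTr u hu))) (fun u hu => ((hT u).mp hu).1) k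
      ((hK'mem k).mpr (hcK k hkr)) hkx (fun u hu => by
        obtain ⟨hu1, hu2⟩ := (hT u).mp hu
        refine (hT _).mpr ⟨?_, ?_⟩
        · have h4 : x = k * x⁻¹ * k⁻¹ := by
            rw [← _root_.inv_inj]
            simpa [mul_assoc] using hkx.symm
          have h5 : x⁻¹ * u = u * x⁻¹ := ((show Commute x u from hu1).inv_left).eq
          calc x * (k * u * k⁻¹) = k * (x⁻¹ * u) * k⁻¹ := by
                nth_rewrite 1 [h4]
                simp [mul_assoc]
            _ = k * u * k⁻¹ * x := by
                rw [h5]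
                nth_rewrite 2 [h4]
                simp [mul_assoc]
        · rw [mul_smul, mul_smul, inv_smul_eq_iff.mpr hky.symm, hu2, hky])
    have hdvd : Nat.card (MulAction.stabilizer (G × ℤˣ) ((x, y) : G × Y)) ∣ 2 * Nat.card T := by
      let p2 : MulAction.stabilizer (G × ℤˣ) ((x, y) : G × Y) →* ℤˣ :=
        (MonoidHom.snd G ℤˣ).comp (Subgroup.subtype _)
      have hker : p2.ker = f.range := by
        ext ⟨⟨g, ε⟩, hg⟩
        constructor
        · intro hε
          obtain rfl : ε = 1 := hε
          obtain ⟨h1, h2⟩ := (hstab _).mp hg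
          have h3 : g * x * g⁻¹ = x := by simpa using h1
          exact ⟨⟨g, (hT g).mpr ⟨(mul_inv_eq_iff_eq_mul.mp h3).symm, h2⟩⟩, rfl⟩
        · rintro ⟨u, hu⟩
          rw [← hu]
          rfl
      rw [← p2.ker.card_mul_index, Subgroup.index_ker, hker,
        ← Nat.card_congr (MonoidHom.ofInjective hf).toEquiv, mul_comm]
      refine mul_dvd_mul_right ?_ _
      have h6 := Subgroup.card_subgroup_dvd_card p2.range
      have h7 : Nat.card ℤˣ = 2 := by rw [Nat.card_eq_fintype_card]; rfl
      rwa [h7] at h6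
    obtain ⟨d, hd⟩ := hdvd
    refine ⟨d * z, (isIntegral_algebraMap (R := ℤ) (x := (d : ℤ))).mul hz, ?_⟩
    rw [hsum, hz2, ← mul_assoc, ← Nat.cast_mul, ← hd]
    push_cast
    ring
  · have hsurj : Function.Surjective f := by
      rintro ⟨⟨g, ε⟩, hg⟩
      obtain ⟨h1, h2⟩ := (hstab _).mp hg
      rcases Int.units_eq_one_or ε with rfl | rfl
      · refine ⟨⟨g, (hT g).mpr ⟨?_, h2⟩⟩, rfl⟩
        have h3 : g * x * g⁻¹ = x := by simpa using h1
        exact (mul_inv_eq_iff_eq_mul.mp h3).symm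
      · refine absurd ⟨g, h2, ?_⟩ hk
        have h3 : g * x⁻¹ * g⁻¹ = x := by simpa using h1
        rw [← _root_.inv_inj]
        simpa [mul_assoc] using h3
    obtain ⟨z, hz, hz2⟩ := exists_isIntegral_sum_sq ρ T.subtype x fun u => ((hT u).mp u.2).1
    refine ⟨z, hz, ?_⟩
    rw [hsum, ← Nat.card_congr (Equiv.ofBijective f ⟨hf, hsurj⟩), Nat.card_eq_fintype_card]
    exact hz2

end Parity

section Local

theorem not_isIntegral_of_odd {r : ℕ} (hr : Odd r) {z : ℂ} (hz : IsIntegral ℤ z) :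
    (r : ℂ) ≠ 2 * z := by
  intro h
  have h1 : z = algebraMap ℚ ℂ (r / 2) := by
    rw [map_div₀, map_natCast, map_ofNat, h]
    ring
  rw [h1, isIntegral_algebraMap_iff (algebraMap ℚ ℂ).injective,
    IsIntegrallyClosed.isIntegral_iff] at hz
  obtain ⟨y, hy⟩ := hz
  have h2 : ((2 * y : ℤ) : ℚ) = (r : ℤ) := by
    push_cast
    simp only [eq_intCast] at hy
    rw [hy]
    ring
  have h3 := Int.cast_injective h2
  obtain ⟨k, rfl⟩ := hr
  push_cast at h3
  omega

variable {G : Type} [Group G]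

theorem isPGroup_stabilizer_quotient (P : Subgroup G) (hP : IsPGroup 2 P) (q : G ⧸ P) :
    IsPGroup 2 (MulAction.stabilizer G q) := by
  rintro ⟨g, hg⟩
  obtain ⟨a, rfl⟩ := QuotientGroup.mk_surjective q
  have h1 : a⁻¹ * g * a ∈ P := by
    have := MulAction.mem_stabilizer_iff.mp hg
    rw [mul_assoc]
    exact QuotientGroup.eq.mp this.symm
  obtain ⟨k, hk⟩ := hP ⟨_, h1⟩
  refine ⟨k, Subtype.ext ?_⟩
  have h2 : (a⁻¹ * g * a⁻¹⁻¹) ^ 2 ^ k = 1 := by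
    rw [inv_inv]
    exact congrArg Subtype.val hk
  rw [conj_pow, conj_eq_one_iff] at h2
  exact h2

/-- There is a finite `G`-set whose point stabilizers are `2`-groups and on which the number of
fixed points of a `2`-element is `1` modulo twice the `2`-part of the order of `G`. -/
theorem exists_mulAction_card_fixed [Finite G] {r a : ℕ} (hr : Odd r)
    (hG : Nat.card G = r * 2 ^ a) :
    ∃ (Y : Type) (_ : Fintype Y) (_ : MulAction G Y),
      (∀ y : Y, IsPGroup 2 (MulAction.stabilizer G y)) ∧ ∀ u : G,
        ∃ n : ℤ, (Nat.card {y : Y // u • y = y} : ℤ) =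
          if u ^ 2 ^ a = 1 then 1 + 2 * 2 ^ a * n else 0 := by
  have : Fact (Nat.Prime 2) := ⟨Nat.prime_two⟩
  obtain ⟨P⟩ : Nonempty (Sylow 2 G) := inferInstance
  have hPcard : Nat.card P = 2 ^ a := by
    rw [P.card_eq_multiplicity, hG, Nat.factorization_mul (by rintro rfl; simp at hr) (by positivity)]
    simp [Nat.factorization_eq_zero_of_not_dvd hr.not_two_dvd_nat,
      Nat.prime_two.factorization_self]
  let Q := G ⧸ (P : Subgroup G)
  have : Fintype Q := Fintype.ofFinite _
  have hQcard : Nat.card Q = r := by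
    have := (P : Subgroup G).card_mul_index
    rw [hG, Subgroup.index_eq_card] at this
    change Nat.card P * _ = _ at this
    rw [hPcard, mul_comm] at this
    exact Nat.eq_of_mul_eq_mul_right (by positivity) this
  let N := Nat.totient (2 ^ (a + 1))
  have hN : 0 < N := Nat.totient_pos.mpr (by positivity)
  have hst : ∀ q : Q, IsPGroup 2 (MulAction.stabilizer G q) :=
    isPGroup_stabilizer_quotient _ P.isPGroup'
  have hle : ∀ y : Fin N → Q, MulAction.stabilizer G y ≤ MulAction.stabilizer G (y ⟨0, hN⟩) :=
    fun y g hg => congrFun (MulAction.mem_stabilizer_iff.mp hg) ⟨0, hN⟩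
  refine ⟨Fin N → Q, inferInstance, inferInstance, fun y => (hst _).to_le (hle y), fun u => ?_⟩
  have hcard : Nat.card {y : Fin N → Q // u • y = y} = Nat.card {q : Q // u • q = q} ^ N := by
    let e : {y : Fin N → Q // u • y = y} ≃ (Fin N → {q : Q // u • q = q}) :=
      (Equiv.subtypeEquivRight fun y => funext_iff).trans
        (Equiv.subtypePiEquivPi (p := fun _ q => u • q = q))
    rw [Nat.card_congr e]
    simp
  rw [hcard]
  split_ifs with hu
  · have hpu : IsPGroup 2 (Subgroup.zpowers u) := by
      rintro ⟨_, k, rfl⟩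
      refine ⟨a, Subtype.ext ?_⟩
      change (u ^ k) ^ 2 ^ a = 1
      rw [← zpow_natCast, ← _root_.zpow_mul, mul_comm, _root_.zpow_mul, zpow_natCast, hu, _root_.one_zpow]
    have hfix := hpu.card_modEq_card_fixedPoints Q
    have hfix2 : Nat.card (MulAction.fixedPoints (Subgroup.zpowers u) Q) =
        Nat.card {q : Q // u • q = q} := by
      refine Nat.card_congr (Equiv.subtypeEquivRight fun q => ⟨fun h => h ⟨u, 1, zpow_one u⟩, ?_⟩)
      rintro h ⟨g, hg⟩
      exact (Subgroup.zpowers_le.mpr (MulAction.mem_stabilizer_iff.mpr h)) hg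
    rw [hQcard, hfix2] at hfix
    have hodd : Odd (Nat.card {q : Q // u • q = q}) := by
      rw [Nat.odd_iff, ← hfix, Nat.odd_iff.mp hr]
    have h1 : _ ^ N ≡ 1 [MOD 2 ^ (a + 1)] :=
      Nat.ModEq.pow_totient ((Nat.coprime_two_right.mpr hodd).pow_right (a + 1))
    have h2 := (Int.natCast_modEq_iff.mpr h1).symm.dvd
    obtain ⟨n, hn⟩ := h2
    refine ⟨n, ?_⟩
    push_cast at hn ⊢
    rw [pow_succ] at hn
    linarith
  · refine ⟨0, ?_⟩
    rw [Nat.cast_eq_zero, pow_eq_zero_iff hN.ne', Nat.card_eq_zero]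
    refine Or.inl ⟨?_⟩
    rintro ⟨q, hq⟩
    apply hu
    obtain ⟨k, hk⟩ := hst q ⟨u, hq⟩
    have hk' : u ^ 2 ^ k = 1 := congrArg Subtype.val hk
    rw [← orderOf_dvd_iff_pow_eq_one] at hk' ⊢
    refine Nat.Coprime.dvd_of_dvd_mul_left ?_ (hG ▸ orderOf_dvd_natCard u)
    exact Nat.Coprime.coprime_dvd_left hk' (Nat.Coprime.pow_left _
      (Nat.coprime_two_left.mpr hr))

/-- A finite group has nonnegative Frobenius-Schur sums if each of its elements of odd order is
inverted in a subgroup which has this property and contains a Sylow `2`-subgroup of the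
centralizer of that element. -/
theorem NonnegFS.of_local [Finite G] (h : ∀ x : G, Odd (orderOf x) → ∃ K : Subgroup G,
    NonnegFS K ∧ x ∈ K ∧ ¬ 2 ∣ K.relIndex (Subgroup.centralizer {x}) ∧
    ∃ k ∈ K, k * x * k⁻¹ = x⁻¹) : NonnegFS G := by
  refine nonnegFS_of_irreducible fun _ W _ _ _ ρ hρ => ?_
  by_contra hneg
  obtain ⟨ω, hω, halt, hinj⟩ : ∃ ω : W →ₗ[ℂ] W →ₗ[ℂ] ℂ, InvariantForm ρ ω ∧
      (∀ v w, ω w v = -ω v w) ∧ Function.Injective ω := by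
    rcases frobeniusSchur_irreducible ρ hρ with h0 | ⟨c, hc, hsum, ⟨ω, h0, hω⟩, hsymm⟩
    · exact absurd (by rw [h0.1]; exact le_rfl) hneg
    · rcases hc with rfl | rfl
      · exact absurd (by rw [hsum]; simp) hneg
      · exact ⟨ω, hω, fun v w => by rw [hsymm ω hω]; simp, hω.injective hρ h0⟩
  obtain ⟨a, r, hr2, hcard⟩ := Nat.exists_eq_two_pow_mul_odd (n := Nat.card G) Nat.card_pos.ne'
  rw [mul_comm] at hcard
  obtain ⟨Y, _, _, hY, hfix⟩ := exists_mulAction_card_fixed hr2 hcard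
  choose n hn using hfix
  have hinv := character_inv_of_invariantForm ρ hω hinj
  obtain ⟨z, hz, hsum⟩ := @exists_isIntegral_sum_of_stabilizer (G × ℤˣ) (G × Y) _ _ _
    (pairAction G Y) (localSum ρ.character r)
    (localSum_smul ρ.character r (fun g h => Representation.char_conj ρ h g) hinv)
    (exists_isIntegral_localSum hY ρ hω halt hinj r fun x hx => h x
      (hr2.of_dvd_nat (orderOf_dvd_of_pow_eq_one hx)))
  have hexp : ∑ p : G × Y, localSum ρ.character r p = ∑ x : G, ∑ u : G,
      if x ^ r = 1 ∧ u ^ 2 ^ a = 1 ∧ x * u = u * x then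
        ρ.character (x * u) ^ 2 * (1 + 2 * 2 ^ a * n u) else 0 := by
    rw [Fintype.sum_prod_type]
    refine Finset.sum_congr rfl fun x _ => ?_
    unfold localSum
    rw [Finset.sum_comm]
    refine Finset.sum_congr rfl fun u _ => ?_
    have h1 : ((Finset.univ.filter fun y : Y => u • y = y).card : ℂ) =
        if u ^ 2 ^ a = 1 then 1 + 2 * 2 ^ a * (n u : ℂ) else 0 := by
      have h2 := congrArg (Int.cast : ℤ → ℂ) (hn u)
      rw [Nat.card_eq_fintype_card, Fintype.card_subtype] at h2
      simpa [apply_ite (Int.cast : ℤ → ℂ)] using h2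
    by_cases hc : x ^ r = 1 ∧ x * u = u * x
    · simp only [hc.1, hc.2, true_and, and_true]
      rw [← Finset.sum_filter, Finset.sum_const, nsmul_eq_mul, h1]
      split_ifs <;> ring
    · rw [if_neg fun h => hc ⟨h.1, h.2.2⟩]
      exact Finset.sum_eq_zero fun y _ => if_neg fun h => hc ⟨h.1, h.2.1⟩
  have hchar := sum_character_mul_inv ρ hρ
  simp only [hinv, ← sq] at hchar
  rw [sum_eq_sum_commute ((Nat.coprime_two_right.mpr hr2).pow_right a)
    (by rw [← Nat.card_eq_fintype_card, hcard])] at hchar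
  have hint : ∀ g, IsIntegral ℤ (ρ.character g) := fun g =>
    isIntegral_trace_of_pow_eq_one (orderOf_pos g) (by
      rw [← map_pow, pow_orderOf_eq_one, map_one])
  let w : ℂ := ∑ x : G, ∑ u : G,
      if x ^ r = 1 ∧ u ^ 2 ^ a = 1 ∧ x * u = u * x then ρ.character (x * u) ^ 2 * n u else 0
  have hw : IsIntegral ℤ w := by
    refine IsIntegral.sum _ fun x _ => IsIntegral.sum _ fun u _ => ?_
    split_ifs
    · exact ((hint _).pow 2).mul (isIntegral_algebraMap (R := ℤ) (x := n u))
    · exact isIntegral_zero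
  have hsplit : ∑ p : G × Y, localSum ρ.character r p =
      Fintype.card G + 2 * 2 ^ a * w := by
    rw [hexp, ← hchar, Finset.mul_sum, ← Finset.sum_add_distrib]
    refine Finset.sum_congr rfl fun x _ => ?_
    rw [Finset.mul_sum, ← Finset.sum_add_distrib]
    refine Finset.sum_congr rfl fun u _ => ?_
    split_ifs <;> ring
  refine not_isIntegral_of_odd hr2 (z := r * z - w)
    (((isIntegral_algebraMap (R := ℤ) (x := (r : ℤ))).mul hz).sub hw) ?_
  have h3 : (Nat.card (G × ℤˣ) : ℂ) = r * 2 ^ a * 2 := by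
    rw [Nat.card_prod, hcard, Nat.card_eq_fintype_card (α := ℤˣ)]
    push_cast
    rfl
  rw [hsplit, h3, ← Nat.card_eq_fintype_card, hcard] at hsum
  push_cast at hsum
  have h4 : (2 ^ a : ℂ) ≠ 0 := pow_ne_zero _ two_ne_zero
  apply mul_right_cancel₀ h4
  linear_combination hsum

theorem not_dvd_relIndex_of_sylow [Finite G] {C K : Subgroup G} (S : Sylow 2 C)
    (hS : ∀ s ∈ S, (s : G) ∈ K) : ¬ 2 ∣ K.relIndex C := by
  intro h
  refine S.not_dvd_index (h.trans ?_)
  exact Subgroup.index_dvd_of_le fun s hs => hS s hs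

end Local

section TwoGroup

variable {S : Type} [Group S]

theorem IsPGroup.exists_mem_normal_central [Finite S] (hS : IsPGroup 2 S) (N : Subgroup S)
    [N.Normal] (hN : N ≠ ⊥) : ∃ c ∈ N, c ≠ 1 ∧ c * c = 1 ∧ ∀ s, s * c * s⁻¹ = c := by
  have : Fact (Nat.Prime 2) := ⟨Nat.prime_two⟩
  have hN' : Nontrivial N := (Subgroup.nontrivial_iff_ne_bot N).mpr hN
  have hdvd : 2 ∣ Nat.card N := by
    obtain ⟨n, hn0, hn⟩ := (hS.to_subgroup N).nontrivial_iff_card.mp hN'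
    exact hn.symm ▸ dvd_pow_self _ (ne_of_gt hn0)
  obtain ⟨c, hc, hc1⟩ := (hS.of_equiv ConjAct.toConjAct)
    |>.exists_fixed_point_of_prime_dvd_card_of_fixed_point N hdvd (a := 1)
      (fun g => smul_one g)
  have hcent : ∀ s, s * (c : S) * s⁻¹ = c := fun s => by
    have := congrArg Subtype.val (hc (ConjAct.toConjAct s))
    rwa [ConjAct.Subgroup.val_conj_smul, ConjAct.toConjAct_smul] at this
  obtain ⟨k, hk⟩ := IsPGroup.iff_orderOf.mp hS (c : S)
  have hc1' : (c : S) ≠ 1 := fun h => hc1 (Subtype.ext h.symm)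
  rcases k with _ | k
  · exact absurd (orderOf_eq_one_iff.mp (by rw [hk, pow_zero])) hc1'
  refine ⟨(c : S) ^ 2 ^ k, N.pow_mem c.2 _, ?_, ?_, fun s => ?_⟩
  · intro h
    have := Nat.le_of_dvd (by positivity) (orderOf_dvd_of_pow_eq_one h)
    rw [hk, pow_succ] at this
    have : 0 < 2 ^ k := by positivity
    omega
  · rw [← sq, ← pow_mul, ← pow_succ, ← hk, pow_orderOf_eq_one]
  · rw [← conj_pow, hcent]

theorem IsPGroup.exists_mem_normal_central_mod [Finite S] (hS : IsPGroup 2 S) (A C : Subgroup S)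
    [A.Normal] [C.Normal] (hCA : ¬ C ≤ A) :
    ∃ c ∈ C, c ∉ A ∧ c * c ∈ A ∧ ∀ s, ∃ a ∈ A, s * c * s⁻¹ = c * a := by
  have hN : C.map (QuotientGroup.mk' A) ≠ ⊥ := by
    rw [Ne, Subgroup.map_eq_bot_iff, QuotientGroup.ker_mk']
    exact hCA
  have := (‹C.Normal›).map (QuotientGroup.mk' A)
    (QuotientGroup.mk'_surjective A)
  obtain ⟨_, ⟨c, hc, rfl⟩, hc1, hc2, hc3⟩ :=
    (hS.to_quotient A).exists_mem_normal_central (C.map (QuotientGroup.mk' A)) hN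
  refine ⟨c, hc, ?_, ?_, fun s => ⟨c⁻¹ * (s * c * s⁻¹), ?_, by group⟩⟩
  · intro h
    exact hc1 ((QuotientGroup.eq_one_iff c).mpr h)
  · rw [← QuotientGroup.eq_one_iff]
    exact hc2
  · exact QuotientGroup.eq.mp (hc3 (s : S ⧸ A)).symm

/-- An abelian normal subgroup generated by a cyclic subgroup of index two which is not
contained in a bigger cyclic group contains a further involution. -/
theorem exists_mul_self_eq_one_of_cyclic {g c : S} {k : ℕ} (hg : orderOf g = 2 ^ k)
    (hgc : c * g = g * c) (hcc : c * c ∈ Subgroup.zpowers g) :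
    g ∈ Subgroup.zpowers c ∨ ∃ d, d * d = 1 ∧ ∃ n : ℤ, d = c * g ^ n := by
  obtain ⟨j, hj⟩ := hcc
  have hcomm : Commute c g := hgc
  rcases Int.even_or_odd' j with ⟨l, rfl | rfl⟩
  · right
    refine ⟨c * g ^ (-l), ?_, -l, rfl⟩
    rw [(hcomm.zpow_right _).symm.mul_mul_mul_comm, ← hj]
    change g ^ (2 * l) * _ = _
    rw [← _root_.zpow_add, ← _root_.zpow_add]
    ring_nf
    simp
  · left
    have hcop : IsCoprime (2 * l + 1) ((2 : ℤ) ^ k) := by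
      refine IsCoprime.pow_right ?_
      exact ⟨1, -l, by ring⟩
    obtain ⟨u, v, huv⟩ := hcop
    refine ⟨2 * u, ?_⟩
    change c ^ (2 * u) = g
    have h1 : c ^ (2 : ℤ) = g ^ (2 * l + 1) := by
      rw [zpow_two]; exact hj.symm
    rw [_root_.zpow_mul, h1, ← _root_.zpow_mul]
    have h2 : (2 * l + 1) * u = 1 + (2 : ℤ) ^ k * (-v) := by linear_combination huv
    rw [h2, _root_.zpow_add, zpow_one, _root_.zpow_mul]
    have h3 : g ^ ((2 : ℤ) ^ k) = 1 := by
      have : ((2 : ℤ) ^ k) = ((2 ^ k : ℕ) : ℤ) := by push_cast; rfl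
      rw [this, zpow_natCast, ← hg, pow_orderOf_eq_one]
    rw [h3, _root_.one_zpow, mul_one]

theorem zpow_eq_one_iff_dvd {g : S} {k : ℕ} (hg : orderOf g = 2 ^ k) (n : ℤ) :
    g ^ n = 1 ↔ (2 : ℤ) ^ k ∣ n := by
  rw [← orderOf_dvd_iff_zpow_eq_one, hg]
  push_cast
  rfl

/-- The elements of square one in a cyclic `2`-group. -/
theorem eq_one_or_eq_of_mul_self {g z : S} {k : ℕ} (hg : orderOf g = 2 ^ k)
    (hz : z ∈ Subgroup.zpowers g) (hz1 : z ≠ 1) (hz2 : z * z = 1) {a : S}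
    (ha : a ∈ Subgroup.zpowers g) (ha2 : a * a = 1) : a = 1 ∨ a = z := by
  have key : ∀ b ∈ Subgroup.zpowers g, b * b = 1 → b = 1 ∨ b = g ^ ((2 : ℤ) ^ (k - 1)) := by
    rintro _ ⟨n, rfl⟩ hb
    change g ^ n * g ^ n = 1 at hb
    change g ^ n = 1 ∨ g ^ n = _
    rw [← _root_.zpow_add, zpow_eq_one_iff_dvd hg] at hb
    rcases k with _ | k
    · left; rw [zpow_eq_one_iff_dvd hg]; simp
    · obtain ⟨m, hm⟩ := hb
      have hn : n = 2 ^ k * m := by rw [pow_succ] at hm; linarith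
      rcases Int.even_or_odd' m with ⟨t, rfl | rfl⟩
      · left
        rw [zpow_eq_one_iff_dvd hg]
        exact ⟨t, by rw [hn]; ring⟩
      · right
        have : n = 2 ^ k + 2 ^ (k + 1) * t := by rw [hn]; ring
        rw [this, _root_.zpow_add, (zpow_eq_one_iff_dvd hg _).mpr ⟨t, rfl⟩]
        simp
  rcases key a ha ha2 with h | h
  · exact Or.inl h
  · rcases key z hz hz2 with h' | h'
    · exact absurd h' hz1
    · exact Or.inr (h.trans h'.symm)

/-- In a `2`-group in which `z` is a central involution and every involution whose conjugates
are its multiples by `1` and `z` is trivial modulo `z`, there is a self-centralizing cyclic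
normal subgroup containing `z`. -/
theorem exists_selfCentralizing_cyclic [Finite S] (hS : IsPGroup 2 S) {z : S} (hz1 : z ≠ 1)
    (hz2 : z * z = 1) (hzc : ∀ s, s * z * s⁻¹ = z)
    (hP : ∀ a, a * a = 1 → (∀ s, s * a * s⁻¹ = a ∨ s * a * s⁻¹ = a * z) → a = 1 ∨ a = z) :
    ∃ g, z ∈ Subgroup.zpowers g ∧ (Subgroup.zpowers g).Normal ∧
      ∀ c, c * g = g * c → c ∈ Subgroup.zpowers g := by
  let X : Set S := {g | z ∈ Subgroup.zpowers g ∧ (Subgroup.zpowers g).Normal}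
  have hzX : z ∈ X := by
    refine ⟨Subgroup.mem_zpowers z, ⟨?_⟩⟩
    rintro _ ⟨n, rfl⟩ s
    refine ⟨n, ?_⟩
    change z ^ n = s * z ^ n * s⁻¹
    rw [← conj_zpow, hzc]
  obtain ⟨g, ⟨hzg, hgn⟩, hmax⟩ := Set.exists_max_image X orderOf X.toFinite ⟨z, hzX⟩
  refine ⟨g, hzg, hgn, ?_⟩
  have : Fact (Nat.Prime 2) := ⟨Nat.prime_two⟩
  obtain ⟨k, hk⟩ := IsPGroup.iff_orderOf.mp hS g
  let C := Subgroup.centralizer (Subgroup.zpowers g : Set S)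
  have hC : ∀ c, c ∈ C ↔ c * g = g * c := by
    intro c
    rw [Subgroup.mem_centralizer_iff]
    constructor
    · intro h; exact (h g (Subgroup.mem_zpowers g)).symm
    · rintro h _ ⟨n, rfl⟩
      exact ((show Commute c g from h).zpow_right n).eq.symm
  by_contra! hne
  obtain ⟨c₀, hc₀, hc₀'⟩ := hne
  obtain ⟨c, hcC, hcA, hccA, hconj⟩ := hS.exists_mem_normal_central_mod (Subgroup.zpowers g) C
    fun h => hc₀' (h ((hC c₀).mpr hc₀))
  have hcg := (hC c).mp hcC
  rcases exists_mul_self_eq_one_of_cyclic hk hcg hccA with hgc | ⟨d, hd2, n, hd⟩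
  · have hcX : c ∈ X := by
      refine ⟨(Subgroup.zpowers_le.mpr hgc) hzg, ⟨?_⟩⟩
      rintro _ ⟨n, rfl⟩ s
      change s * c ^ n * s⁻¹ ∈ _
      rw [← conj_zpow]
      refine Subgroup.zpow_mem _ ?_ n
      obtain ⟨a, ha, h⟩ := hconj s
      rw [h]
      exact Subgroup.mul_mem _ (Subgroup.mem_zpowers c) ((Subgroup.zpowers_le.mpr hgc) ha)
    have hle := hmax c hcX
    have hsub : Subgroup.zpowers g ≤ Subgroup.zpowers c := Subgroup.zpowers_le.mpr hgc
    rw [← Nat.card_zpowers, ← Nat.card_zpowers] at hle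
    have := Subgroup.eq_of_le_of_card_ge hsub hle
    exact hcA (this ▸ Subgroup.mem_zpowers c)
  · have hgn' : g ^ n ∈ Subgroup.zpowers g := ⟨n, rfl⟩
    have hdA : d ∉ Subgroup.zpowers g := fun h => hcA (by
      rw [hd] at h
      exact (Subgroup.mul_mem_cancel_right _ hgn').mp h)
    have hdg : Commute d g := by
      rw [hd]
      exact (show Commute c g from hcg).mul_left ((Commute.refl g).zpow_left n)
    have hds : ∀ s, s * d * s⁻¹ = d ∨ s * d * s⁻¹ = d * z := by
      intro s
      obtain ⟨a, ha, h⟩ := hconj s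
      have h1 : ∃ b ∈ Subgroup.zpowers g, s * d * s⁻¹ = d * b := by
        refine ⟨(g ^ n)⁻¹ * a * (s * g ^ n * s⁻¹), ?_, ?_⟩
        · exact Subgroup.mul_mem _ (Subgroup.mul_mem _ (Subgroup.inv_mem _ hgn') ha)
            (hgn.conj_mem _ hgn' s)
        · rw [hd]
          calc s * (c * g ^ n) * s⁻¹ = (s * c * s⁻¹) * (s * g ^ n * s⁻¹) := by group
            _ = _ := by rw [h]; group
      obtain ⟨b, hb, hsd⟩ := h1
      have hdb : Commute d b := by
        obtain ⟨l, rfl⟩ := hb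
        exact hdg.zpow_right l
      have hb2 : b * b = 1 := by
        have h2 : (s * d * s⁻¹) * (s * d * s⁻¹) = 1 := by
          calc _ = s * (d * d) * s⁻¹ := by group
            _ = 1 := by rw [hd2]; group
        rw [hsd, hdb.symm.mul_mul_mul_comm, hd2, one_mul] at h2
        exact h2
      rcases eq_one_or_eq_of_mul_self hk hzg hz1 hz2 hb hb2 with rfl | rfl
      · left; rw [hsd, mul_one]
      · right; exact hsd
    rcases hP d hd2 hds with h | h
    · exact hdA (h ▸ Subgroup.one_mem _)
    · exact hdA (h ▸ hzg)

theorem cyclic_or_index_two [Finite S] (hS : IsPGroup 2 S) {z : S} (hz1 : z ≠ 1)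
    (hz2 : z * z = 1) (hzc : ∀ s, s * z * s⁻¹ = z)
    (hP : ∀ a, a * a = 1 → (∀ s, s * a * s⁻¹ = a ∨ s * a * s⁻¹ = a * z) → a = 1 ∨ a = z) :
    ∃ g, (Subgroup.zpowers g).Normal ∧ ((∀ s, s ∈ Subgroup.zpowers g) ∨
      (∃ i ∈ Subgroup.zpowers g, i * i = z) ∧ ∃ b, b ∉ Subgroup.zpowers g ∧
        b * b ∈ Subgroup.zpowers g ∧
        ∀ s, s ∈ Subgroup.zpowers g ∨ b⁻¹ * s ∈ Subgroup.zpowers g) := by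
  obtain ⟨g, hzg, hgn, hcent⟩ := exists_selfCentralizing_cyclic hS hz1 hz2 hzc hP
  refine ⟨g, hgn, ?_⟩
  have : Fact (Nat.Prime 2) := ⟨Nat.prime_two⟩
  obtain ⟨k, hk⟩ := IsPGroup.iff_orderOf.mp hS g
  have hone := zpow_eq_one_iff_dvd hk
  by_cases hgz : ∀ s, s * g * s⁻¹ = g
  · exact Or.inl fun s => hcent s (mul_inv_eq_iff_eq_mul.mp (hgz s))
  right
  obtain ⟨e, rfl⟩ : ∃ e, k = e + 2 := by
    rcases k with _ | _ | e
    · refine absurd (fun s => ?_) hgz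
      have hg1 : g = 1 := orderOf_eq_one_iff.mp (by rw [hk, pow_zero])
      simp [hg1]
    · refine absurd (fun s => ?_) hgz
      have hg2 : g * g = 1 := by
        rw [← sq, ← (show orderOf g = 2 by rw [hk]; rfl), pow_orderOf_eq_one]
      rcases eq_one_or_eq_of_mul_self hk hzg hz1 hz2 (Subgroup.mem_zpowers g) hg2 with rfl | rfl
      · simp
      · exact hzc s
    · exact ⟨e, rfl⟩
  have hzpow : g ^ ((2 : ℤ) ^ (e + 1)) = z := by
    refine (eq_one_or_eq_of_mul_self hk hzg hz1 hz2 ⟨_, rfl⟩ ?_).resolve_left ?_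
    · change g ^ ((2 : ℤ) ^ (e + 1)) * g ^ ((2 : ℤ) ^ (e + 1)) = 1
      rw [← _root_.zpow_add, hone]
      exact ⟨1, by ring⟩
    · change g ^ ((2 : ℤ) ^ (e + 1)) ≠ 1
      rw [Ne, hone]
      rintro ⟨t, ht⟩
      rw [pow_succ 2 (e + 1), mul_assoc] at ht
      have : (2 : ℤ) ^ (e + 1) ≠ 0 := by positivity
      have h1 : (1 : ℤ) = 2 * t := by
        apply mul_left_cancel₀ this
        linarith
      omega
  have hi2 : g ^ ((2 : ℤ) ^ e) * g ^ ((2 : ℤ) ^ e) = z := by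
    rw [← _root_.zpow_add, ← hzpow]
    congr 1
    ring
  refine ⟨⟨g ^ ((2 : ℤ) ^ e), ⟨_, rfl⟩, hi2⟩, ?_⟩
  set i := g ^ ((2 : ℤ) ^ e) with hi
  have hiA : i ∈ Subgroup.zpowers g := ⟨_, rfl⟩
  have hcommA : ∀ a ∈ Subgroup.zpowers g, Commute a g := by
    rintro _ ⟨n, rfl⟩
    exact (Commute.refl g).zpow_left n
  have hcommA' : ∀ a ∈ Subgroup.zpowers g, ∀ b ∈ Subgroup.zpowers g, Commute a b := by
    rintro a ha _ ⟨n, rfl⟩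
    exact (hcommA a ha).zpow_right n
  have hconj : ∀ s, s * i * s⁻¹ = i ∨ s * i * s⁻¹ = i * z := by
    intro s
    have h1 := hgn.conj_mem _ hiA s
    have h2 := Subgroup.mul_mem _ (Subgroup.inv_mem _ hiA) h1
    have h3 : (i⁻¹ * (s * i * s⁻¹)) * (i⁻¹ * (s * i * s⁻¹)) = 1 := by
      rw [(hcommA' _ h1 _ (Subgroup.inv_mem _ hiA)).mul_mul_mul_comm]
      calc _ = (i * i)⁻¹ * (s * (i * i) * s⁻¹) := by group
        _ = 1 := by rw [hi2, hzc]; group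
    rcases eq_one_or_eq_of_mul_self hk hzg hz1 hz2 h2 h3 with h | h
    · left; exact (inv_mul_eq_one.mp h).symm
    · right; exact inv_mul_eq_iff_eq_mul.mp h
  have hS₀ : ∀ s, s * i * s⁻¹ = i → s ∈ Subgroup.zpowers g := by
    intro s₀ hs₀
    by_contra hs₀A
    obtain ⟨s, hsi, hsA, hssA⟩ : ∃ s, Commute s i ∧ s ∉ Subgroup.zpowers g ∧
        s * s ∈ Subgroup.zpowers g := by
      obtain ⟨n, hn⟩ := hS s₀
      have hex : ∃ n, s₀ ^ 2 ^ n ∈ Subgroup.zpowers g := ⟨n, hn ▸ Subgroup.one_mem _⟩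
      have h1 := Nat.find_spec hex
      rcases hm : Nat.find hex with _ | m
      · rw [hm, pow_zero, pow_one] at h1
        exact absurd h1 hs₀A
      · rw [hm] at h1
        refine ⟨s₀ ^ 2 ^ m, ?_, Nat.find_min hex (by omega), ?_⟩
        · exact Commute.pow_left (mul_inv_eq_iff_eq_mul.mp hs₀) _
        · rw [← sq, ← pow_mul, ← pow_succ]
          exact h1
    have hsg : s * g * s⁻¹ = g * z := by
      obtain ⟨m, hm⟩ := hgn.conj_mem _ (Subgroup.mem_zpowers g) s
      change g ^ m = s * g * s⁻¹ at hm
      have h1 : g ^ (m * 2 ^ e) = g ^ ((2 : ℤ) ^ e) := by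
        rw [_root_.zpow_mul, hm, conj_zpow, ← hi, hsi.eq, mul_inv_cancel_right]
      have h2 : g ^ (m * m) = g := by
        rw [_root_.zpow_mul, hm, conj_zpow, hm]
        calc _ = s * s * g * (s * s)⁻¹ := by group
          _ = g := by rw [(hcommA _ hssA).eq, mul_inv_cancel_right]
      have h1' : (2 : ℤ) ^ (e + 2) ∣ m * 2 ^ e - 2 ^ e := by
        rw [← hone, _root_.zpow_sub, h1, mul_inv_cancel]
      have h2' : (2 : ℤ) ^ (e + 2) ∣ m * m - 1 := by
        rw [← hone, _root_.zpow_sub, h2, zpow_one, mul_inv_cancel]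
      obtain ⟨t, ht⟩ := h1'
      have hmt : m = 1 + 4 * t := by
        have h3 : (2 : ℤ) ^ e ≠ 0 := by positivity
        apply mul_right_cancel₀ h3
        rw [pow_add] at ht
        linarith
      have hdvd : (2 : ℤ) ^ (e + 2) ∣ 4 * t + 4 * t := by
        have hcop : IsCoprime (2 : ℤ) (1 + 2 * t) := ⟨-t, 1, by ring⟩
        refine hcop.pow_left.dvd_of_dvd_mul_right ?_
        rw [hmt] at h2'
        rw [show (4 * t + 4 * t) * (1 + 2 * t) = (1 + 4 * t) * (1 + 4 * t) - 1 by ring]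
        exact h2'
      rcases eq_one_or_eq_of_mul_self hk hzg hz1 hz2 ⟨4 * t, rfl⟩
        (by
          change g ^ (4 * t) * g ^ (4 * t) = 1
          rw [← _root_.zpow_add, hone]
          exact hdvd) with h | h <;> change g ^ (4 * t) = _ at h
      · refine absurd (hcent s (mul_inv_eq_iff_eq_mul.mp ?_)) hsA
        rw [← hm, hmt, _root_.zpow_add, h, zpow_one, mul_one]
      · rw [← hm, hmt, _root_.zpow_add, h, zpow_one]
    obtain ⟨e, rfl⟩ : ∃ e', e = e' + 1 := by
      rcases e with _ | e
      · refine absurd (hcent s ?_) hsA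
        have : i = g := by rw [hi]; simp
        rw [← this]
        exact hsi
      · exact ⟨e, rfl⟩
    let M : ℤ := 1 + 2 ^ (e + 2)
    have hM : ∀ a ∈ Subgroup.zpowers g, s * a * s⁻¹ = a ^ M := by
      rintro _ ⟨n, rfl⟩
      change s * g ^ n * s⁻¹ = (g ^ n) ^ M
      rw [← conj_zpow, hsg, ← _root_.zpow_mul, mul_comm n, _root_.zpow_mul, _root_.zpow_add,
        hzpow, zpow_one]
    obtain ⟨j, hj⟩ := hssA
    change g ^ j = s * s at hj
    obtain ⟨j, rfl⟩ : ∃ j', j = 2 * j' := by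
      have h1 := hM _ ⟨j, rfl⟩
      change s * g ^ j * s⁻¹ = (g ^ j) ^ M at h1
      rw [hj] at h1
      have h2 : (s * s) ^ ((2 : ℤ) ^ (e + 2)) = 1 := by
        rw [_root_.zpow_add, zpow_one] at h1
        rw [← mul_right_inj (s * s), ← h1]
        group
      rw [← hj, ← _root_.zpow_mul, hone] at h2
      obtain ⟨t, ht⟩ := h2
      refine ⟨t, ?_⟩
      have h3 : (2 : ℤ) ^ (e + 2) ≠ 0 := by positivity
      apply mul_right_cancel₀ h3
      rw [ht]
      ring
    let l : ℤ := -j * (1 - 2 ^ (e + 1))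
    let w := g ^ l * s
    have hw2 : w * w = 1 := by
      calc w * w = g ^ l * (s * g ^ l * s⁻¹) * (s * s) := by simp only [w]; group
        _ = g ^ (l + l * M + 2 * j) := by
          rw [hM _ ⟨l, rfl⟩, ← hj]
          change g ^ l * (g ^ l) ^ M * _ = _
          rw [← _root_.zpow_mul, ← _root_.zpow_add, ← _root_.zpow_add]
        _ = 1 := by
          rw [hone]
          refine ⟨j * 2 ^ e, ?_⟩
          simp only [l, M]
          ring
    have hwM : ∀ a ∈ Subgroup.zpowers g, w * a * w⁻¹ = a ^ M := by
      intro a ha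
      rw [← hM a ha]
      calc w * a * w⁻¹ = g ^ l * (s * a * s⁻¹) * (g ^ l)⁻¹ := by simp only [w]; group
        _ = _ := by
          rw [(hcommA' _ ⟨l, rfl⟩ _ (hgn.conj_mem a ha s)).eq, mul_inv_cancel_right]
    have hwA : w ∉ Subgroup.zpowers g := fun h =>
      hsA ((Subgroup.mul_mem_cancel_left _ (Subgroup.zpow_mem _ (Subgroup.mem_zpowers g) l)).mp h)
    have hwr : ∀ r, r * w * r⁻¹ = w ∨ r * w * r⁻¹ = w * z := by
      intro r
      have hα : w⁻¹ * (r * w * r⁻¹) ∈ Subgroup.zpowers g := by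
        apply hcent
        rw [← mul_inv_eq_iff_eq_mul]
        have h1 : r⁻¹ * g * r ∈ Subgroup.zpowers g := by
          simpa using hgn.conj_mem _ (Subgroup.mem_zpowers g) r⁻¹
        calc _ = w⁻¹ * (r * (w * (r⁻¹ * g * r) * w⁻¹) * r⁻¹) * w := by group
          _ = w⁻¹ * (r * (r⁻¹ * g * r) * r⁻¹) ^ M * w := by rw [hwM _ h1, conj_zpow]
          _ = w⁻¹ * g ^ M * w := by group
          _ = g := by rw [← hwM _ (Subgroup.mem_zpowers g)]; group
      obtain ⟨n, hn⟩ := hα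
      change g ^ n = _ at hn
      have hrw : r * w * r⁻¹ = w * g ^ n := by rw [hn]; group
      have h1 : g ^ (n * M + n) = 1 := by
        rw [_root_.zpow_add, _root_.zpow_mul, ← hwM _ ⟨n, rfl⟩]
        change w * g ^ n * w⁻¹ * g ^ n = 1
        have hwi : w⁻¹ = w := inv_eq_of_mul_eq_one_left hw2
        rw [hwi, mul_assoc (w * g ^ n), ← hrw]
        calc _ = r * (w * w) * r⁻¹ := by group
          _ = 1 := by rw [hw2]; group
      rw [hone] at h1
      have h2 : (2 : ℤ) ^ (e + 1 + 2) ∣ n + n := by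
        have hcop : IsCoprime (2 : ℤ) (1 + 2 ^ (e + 1)) := ⟨-2 ^ e, 1, by ring⟩
        refine hcop.pow_left.dvd_of_dvd_mul_right ?_
        rw [show (n + n) * (1 + 2 ^ (e + 1)) = n * M + n by simp only [M]; ring]
        exact h1
      rcases eq_one_or_eq_of_mul_self hk hzg hz1 hz2 ⟨n, rfl⟩
        (by
          change g ^ n * g ^ n = 1
          rw [← _root_.zpow_add, hone]
          exact h2) with h | h <;> change g ^ n = _ at h
      · left; rw [hrw, h, mul_one]
      · right; rw [hrw, h]
    rcases hP w hw2 hwr with h | h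
    · exact hwA (h ▸ Subgroup.one_mem _)
    · exact hwA (h ▸ hzg)
  obtain ⟨b, hb⟩ : ∃ b, b ∉ Subgroup.zpowers g := by
    by_contra! h
    exact hgz fun s => mul_inv_eq_iff_eq_mul.mpr (hcommA s (h s))
  have hconj' : ∀ s, s ∉ Subgroup.zpowers g → s * i * s⁻¹ = i * z := fun s hs =>
    (hconj s).resolve_left fun h => hs (hS₀ s h)
  have hiz : ∀ s, s ∉ Subgroup.zpowers g → s⁻¹ * i * s = i * z := by
    intro s hs
    simpa using hconj' s⁻¹ fun h => hs ((Subgroup.inv_mem_iff _).mp h)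
  have hmul : ∀ s, s ∉ Subgroup.zpowers g → b⁻¹ * s ∈ Subgroup.zpowers g := by
    intro s hs
    apply hS₀
    calc b⁻¹ * s * i * (b⁻¹ * s)⁻¹ = b⁻¹ * (s * i * s⁻¹) * b := by group
      _ = (b⁻¹ * i * b) * (b⁻¹ * z * b⁻¹⁻¹) := by rw [hconj' s hs]; group
      _ = i := by rw [hiz b hb, hzc, mul_assoc, hz2, mul_one]
  refine ⟨b, hb, ?_, fun s => ?_⟩
  · have h1 := hmul b⁻¹ fun h => hb ((Subgroup.inv_mem_iff _).mp h)
    rw [← Subgroup.inv_mem_iff]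
    simpa using h1
  · by_cases h : s ∈ Subgroup.zpowers g
    · exact Or.inl h
    · exact Or.inr (hmul s h)

end TwoGroup

section QuadraticSpace

open Polynomial

variable {F : Type} [Field F] {V : Type} [AddCommGroup V] [Module F V]

/-- A symmetric bilinear form with zero radical. -/
def SymmNondeg (B : LinearMap.BilinForm F V) : Prop :=
  (∀ v w, B v w = B w v) ∧ ∀ v, (∀ w, B v w = 0) → v = 0

/-- The restriction of `B` to the subspace `U` has zero radical. -/
def NondegOn (B : LinearMap.BilinForm F V) (U : Submodule F V) : Prop :=
  ∀ v ∈ U, (∀ w ∈ U, B v w = 0) → v = 0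

/-- No proper nonzero `g`-invariant subspace is nondegenerate. -/
def Indec (B : LinearMap.BilinForm F V) (g : Module.End F V) : Prop :=
  ∀ U : Submodule F V, (∀ u ∈ U, g u ∈ U) → NondegOn B U → U = ⊥ ∨ U = ⊤

/-- The endomorphism `y` is self-adjoint for `B`. -/
def SelfAdj (B : LinearMap.BilinForm F V) (y : Module.End F V) : Prop :=
  ∀ v w, B (y v) w = B v (y w)

/-- The endomorphism `y` is skew-adjoint for `B`. -/
def SkewAdj (B : LinearMap.BilinForm F V) (y : Module.End F V) : Prop :=
  ∀ v w, B (y v) w = -B v (y w)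

/-- The endomorphism `g` preserves `B`. -/
def IsIsom (B : LinearMap.BilinForm F V) (g : Module.End F V) : Prop :=
  ∀ v w, B (g v) (g w) = B v w

variable {B : LinearMap.BilinForm F V}

theorem SymmNondeg.isCompl [FiniteDimensional F V] (hB : SymmNondeg B) {U : Submodule F V}
    (hU : NondegOn B U) : IsCompl U (B.orthogonal U) := by
  have hr : B.IsRefl := fun v w h => by rw [hB.1]; exact h
  apply LinearMap.BilinForm.isCompl_orthogonal_of_restrict_nondegenerate hr
  have hrr : (B.restrict U).IsRefl := fun v w h => hr v.1 w.1 h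
  refine (LinearMap.IsRefl.nondegenerate_iff_separatingLeft hrr).2 ?_
  intro v hv
  exact Subtype.ext (hU v.1 v.2 fun w hw => hv ⟨w, hw⟩)

theorem SymmNondeg.mem_orthogonal (hB : SymmNondeg B) {U : Submodule F V} {v : V} :
    v ∈ B.orthogonal U ↔ ∀ u ∈ U, B v u = 0 := by
  rw [LinearMap.BilinForm.mem_orthogonal_iff]
  exact forall₂_congr fun u _ => by rw [hB.1 v u]

theorem SymmNondeg.nondegOn_orthogonal [FiniteDimensional F V] (hB : SymmNondeg B)
    {U : Submodule F V} (hU : NondegOn B U) : NondegOn B (B.orthogonal U) := by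
  intro v hv h
  apply hB.2
  intro w
  obtain ⟨a, ha, b, hb, rfl⟩ := Submodule.mem_sup.1
    ((hB.isCompl hU).sup_eq_top ▸ Submodule.mem_top : w ∈ U ⊔ B.orthogonal U)
  rw [map_add, hB.mem_orthogonal.1 hv a ha, h b hb, add_zero]

theorem SymmNondeg.restrict (hB : SymmNondeg B) {U : Submodule F V} (hU : NondegOn B U) :
    SymmNondeg (B.restrict U) :=
  ⟨fun v w => hB.1 v.1 w.1, fun v hv => Subtype.ext (hU v.1 v.2 fun w hw => hv ⟨w, hw⟩)⟩

theorem IsIsom.injective (hB : SymmNondeg B) {g : Module.End F V} (hg : IsIsom B g) :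
    Function.Injective g := by
  rw [← LinearMap.ker_eq_bot, LinearMap.ker_eq_bot']
  intro v hv
  apply hB.2
  intro w
  rw [← hg, hv, map_zero, LinearMap.zero_apply]

theorem SelfAdj.aeval {y : Module.End F V} (hy : SelfAdj B y) (p : F[X]) :
    SelfAdj B (aeval y p) := by
  induction p using Polynomial.induction_on' with
  | add p q hp hq => intro v w; simp [hp v w, hq v w]
  | monomial n a =>
    have : ∀ n : ℕ, SelfAdj B (y ^ n) := by
      intro n
      induction n with
      | zero => intro v w; simp
      | succ n ih =>
        intro v w
        rw [pow_succ, Module.End.mul_apply, ih, hy, ← Module.End.mul_apply, ← pow_succ', pow_succ]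
    intro v w
    simp [Polynomial.aeval_monomial, Algebra.algebraMap_eq_smul_one, this n v w]

theorem commute_aeval {y g : Module.End F V} (h : Commute y g) (p : F[X]) :
    Commute (aeval y p) g := by
  induction p using Polynomial.induction_on' with
  | add p q hp hq => rw [map_add]; exact hp.add_left hq
  | monomial n a =>
    rw [Polynomial.aeval_monomial]
    have h1 : Commute (algebraMap F (Module.End F V) a) g := Algebra.commutes a g
    exact h1.mul_left (h.pow_left n)

theorem SelfAdj.exists_ne_zero (hB : SymmNondeg B) (h2 : (2 : F) ≠ 0) {s : Module.End F V}
    (hs : SelfAdj B s) (h : s ≠ 0) : ∃ v, B v (s v) ≠ 0 := by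
  by_contra! hc
  apply h
  ext w
  rw [LinearMap.zero_apply]
  apply hB.2
  intro v
  have h1 := hc (v + w)
  have h3 : B v (s w) = B w (s v) := by rw [hB.1 w, hs]
  simp only [map_add, LinearMap.add_apply, hc v, hc w, ← h3] at h1
  rw [hB.1]
  have : (2 : F) * B v (s w) = 0 := by linear_combination h1
  exact (mul_eq_zero.1 this).resolve_left h2

theorem exists_irreducible_pow_aeval_eq_zero [FiniteDimensional F V] [Nontrivial V]
    (hB : SymmNondeg B) {g y : Module.End F V} (hg : Indec B g) (hy : SelfAdj B y)
    (hyg : Commute y g) : ∃ (π : F[X]) (k : ℕ), Irreducible π ∧ aeval y (π ^ (k + 1)) = 0 ∧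
      aeval y (π ^ k) ≠ 0 := by
  have hint : IsIntegral F y := IsIntegral.of_finite F y
  have h0 : minpoly F y ≠ 0 := minpoly.ne_zero hint
  have hu : ¬ IsUnit (minpoly F y) := minpoly.not_isUnit F y
  obtain ⟨π, hπ, hd⟩ := WfDvdMonoid.exists_irreducible_factor hu h0
  have hfin : FiniteMultiplicity π (minpoly F y) := FiniteMultiplicity.of_not_isUnit hπ.not_isUnit h0
  obtain ⟨ρ, hρ, hn⟩ := hfin.exists_eq_pow_mul_and_not_dvd
  set k := multiplicity π (minpoly F y)
  have hcop : IsCoprime (π ^ k) ρ := ((hπ.coprime_iff_not_dvd).2 hn).pow_left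
  have hsup := Polynomial.sup_ker_aeval_eq_ker_aeval_mul_of_coprime y hcop
  rw [← hρ, minpoly.aeval, LinearMap.ker_zero] at hsup
  have horth : ∀ u ∈ LinearMap.ker (aeval y (π ^ k)), ∀ w ∈ LinearMap.ker (aeval y ρ),
      B u w = 0 := by
    intro u hu' w hw
    obtain ⟨a, b, hab⟩ := hcop
    have h1 : u = aeval y (b * ρ) u := by
      have h2 := congrArg (fun p => aeval y p u) hab
      simp only [map_add, map_mul, LinearMap.add_apply, Module.End.mul_apply, map_one,
        Module.End.one_apply] at h2
      rw [LinearMap.mem_ker.1 hu', map_zero, zero_add] at h2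
      rw [map_mul, Module.End.mul_apply, h2]
    rw [h1, hy.aeval, map_mul, Module.End.mul_apply, LinearMap.mem_ker.1 hw, map_zero, map_zero]
  have hUT : LinearMap.ker (aeval y (π ^ k)) = ⊤ := by
    refine (hg (LinearMap.ker (aeval y (π ^ k))) ?_ ?_).resolve_left fun h => ?_
    · intro u hu'
      rw [LinearMap.mem_ker] at hu' ⊢
      have hc := commute_aeval hyg (π ^ k)
      rw [← Module.End.mul_apply, hc.eq, Module.End.mul_apply, hu', map_zero]
    · intro u hu' h
      apply hB.2
      intro w
      obtain ⟨a, ha, b, hb, rfl⟩ := Submodule.mem_sup.1 (hsup ▸ Submodule.mem_top : w ∈ _ ⊔ _)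
      rw [map_add, h a ha, horth u hu' b hb, add_zero]
    · rw [h, bot_sup_eq] at hsup
      exact hn (hd.trans (minpoly.dvd F y (LinearMap.ker_eq_top.1 hsup)))
  have hex : ∃ n, aeval y (π ^ n) = 0 := ⟨k, LinearMap.ker_eq_top.1 hUT⟩
  have hfind := Nat.find_spec hex
  have h00 : Nat.find hex ≠ 0 := by
    intro h
    rw [h, pow_zero, map_one] at hfind
    exact one_ne_zero hfind
  obtain ⟨n, hn'⟩ := Nat.exists_eq_succ_of_ne_zero h00
  rw [hn'] at hfind
  refine ⟨π, n, hπ, hfind, ?_⟩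
  · exact Nat.find_min hex (by omega)

theorem exists_involution_of_surjective (hB : SymmNondeg B) {P : Type*} [AddCommGroup P]
    [Module F P] (Φ : P →ₗ[F] V) (hΦ : Function.Surjective Φ) (τ : P →ₗ[F] P)
    (hτ : ∀ p, τ (τ p) = p) (h : ∀ p p', B (Φ (τ p)) (Φ (τ p')) = B (Φ p) (Φ p')) :
    ∃ t : Module.End F V, (∀ v, t (t v) = v) ∧ IsIsom B t ∧ ∀ p, t (Φ p) = Φ (τ p) := by
  obtain ⟨s, hs⟩ := Φ.exists_rightInverse_of_surjective (LinearMap.range_eq_top.2 hΦ)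
  have hs' : ∀ v, Φ (s v) = v := fun v => LinearMap.congr_fun hs v
  have key : ∀ p p', Φ p = Φ p' → Φ (τ p) = Φ (τ p') := by
    intro p p' hp
    rw [← sub_eq_zero, ← map_sub, ← map_sub]
    apply hB.2
    intro w
    obtain ⟨z, rfl⟩ := hΦ w
    rw [← hτ z, h, map_sub, hp, sub_self, map_zero, LinearMap.zero_apply]
  refine ⟨Φ ∘ₗ τ ∘ₗ s, ?_, ?_, ?_⟩
  · intro v
    simp only [LinearMap.comp_apply]
    rw [key (s (Φ (τ (s v)))) (τ (s v)) (hs' _), hτ, hs']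
  · intro v w
    simp only [LinearMap.comp_apply]
    rw [h, hs', hs']
  · intro p
    simp only [LinearMap.comp_apply]
    exact key _ _ (hs' _)

theorem SkewAdj.apply_self (hB : SymmNondeg B) (h2 : (2 : F) ≠ 0) {δ : Module.End F V}
    (hδ : SkewAdj B δ) (v : V) : B (δ v) v = 0 := by
  have h := hδ v v
  rw [hB.1 v] at h
  have : (2 : F) * B (δ v) v = 0 := by linear_combination h
  exact (mul_eq_zero.1 this).resolve_left h2

end QuadraticSpace

section SkewEndomorphism

open Polynomial

variable {F : Type} [Field F] {V : Type} [AddCommGroup V] [Module F V]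
  {B : LinearMap.BilinForm F V}

theorem aeval_apply_apply (y : Module.End F V) (p q : F[X]) (v : V) :
    aeval y p (aeval y q v) = aeval y (p * q) v := by
  rw [map_mul, Module.End.mul_apply]

/-- The map `(a, b) ↦ a(y) v + δ (b(y) v)`. -/
def cycMap (y δ : Module.End F V) (v : V) : F[X] × F[X] →ₗ[F] V where
  toFun p := aeval y p.1 v + δ (aeval y p.2 v)
  map_add' p p' := by simp; abel
  map_smul' c p := by simp

theorem cycMap_apply (y δ : Module.End F V) (v : V) (p : F[X] × F[X]) :
    cycMap y δ v p = aeval y p.1 v + δ (aeval y p.2 v) := rfl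

theorem apply_skew_aeval (hB : SymmNondeg B) (h2 : (2 : F) ≠ 0) {y δ : Module.End F V}
    (hy : SelfAdj B y) (hδ : SkewAdj B δ) (hc : Commute y δ) (v : V) (a b : F[X]) :
    B (δ (aeval y a v)) (aeval y b v) = 0 := by
  have hcc := fun p => commute_aeval hc p
  have hsk : SkewAdj B (δ * aeval y (b * a)) := by
    intro x z
    rw [Module.End.mul_apply, hδ, hy.aeval, ← Module.End.mul_apply, (hcc _).eq]
  rw [hB.1, hy.aeval, ← Module.End.mul_apply (aeval y b) δ, (hcc b).eq, Module.End.mul_apply,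
    aeval_apply_apply, hB.1, ← Module.End.mul_apply]
  exact hsk.apply_self hB h2 v

theorem nondegOn_range_cycMap (hB : SymmNondeg B) (h2 : (2 : F) ≠ 0) {y δ : Module.End F V}
    (hy : SelfAdj B y) (hδ : SkewAdj B δ) (hc : Commute y δ) {d : F[X]}
    (hd : δ * δ = aeval y d) (hinj : Function.Injective δ) {π : F[X]} (hπ : Irreducible π)
    {k : ℕ} (hk : aeval y (π ^ (k + 1)) = 0) {v : V} (hv : B v (aeval y (π ^ k) v) ≠ 0) :
    NondegOn B (LinearMap.range (cycMap y δ v)) := by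
  have key : ∀ a : F[X], (∀ c : F[X], B (aeval y a v) (aeval y c v) = 0) → aeval y a v = 0 := by
    intro a ha
    by_cases ha0 : a = 0
    · rw [ha0, map_zero, LinearMap.zero_apply]
    have hfin : FiniteMultiplicity π a := FiniteMultiplicity.of_not_isUnit hπ.not_isUnit ha0
    obtain ⟨a', ha', hn⟩ := hfin.exists_eq_pow_mul_and_not_dvd
    set j := multiplicity π a
    by_cases hj : k + 1 ≤ j
    · rw [ha', ← Nat.sub_add_cancel hj, pow_add, mul_right_comm, map_mul, hk, mul_zero,
        LinearMap.zero_apply]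
    · exfalso
      obtain ⟨u, w, huw⟩ := (hπ.coprime_iff_not_dvd).2 hn
      apply hv
      have h1 := ha (π ^ (k - j) * w)
      rw [hy.aeval, aeval_apply_apply] at h1
      have h3 : a * (π ^ (k - j) * w) = π ^ k - u * π ^ (k + 1) := by
        have hkj : k = j + (k - j) := by omega
        have : π ^ k = π ^ j * π ^ (k - j) := by rw [← pow_add, ← hkj]
        calc a * (π ^ (k - j) * w) = π ^ j * π ^ (k - j) * (w * a') := by
              conv_lhs => rw [ha']
              ring
          _ = π ^ k * (1 - u * π) := by rw [← this, ← huw]; ring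
          _ = _ := by ring
      rw [h3, map_sub, map_mul, hk, mul_zero, sub_zero] at h1
      exact h1
  rintro _ ⟨⟨a, b⟩, rfl⟩ h
  rw [cycMap_apply]
  have hb : δ (aeval y b v) = 0 := by
    apply hinj
    rw [map_zero, ← Module.End.mul_apply, hd, aeval_apply_apply]
    apply key
    intro c
    have h1 := h _ ⟨(0, c), rfl⟩
    simp only [cycMap_apply, map_zero, LinearMap.zero_apply, zero_add, map_add,
      LinearMap.add_apply] at h1
    rw [hB.1 (aeval y a v), apply_skew_aeval hB h2 hy hδ hc, zero_add, hB.1, hδ, hB.1,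
      neg_eq_zero, ← Module.End.mul_apply, hd] at h1
    rwa [← aeval_apply_apply]
  have ha : aeval y a v = 0 := by
    apply key
    intro c
    have h1 := h _ ⟨(c, 0), rfl⟩
    simpa only [cycMap_apply, map_zero, LinearMap.zero_apply, add_zero, hb] using h1
  rw [ha, hb, add_zero]

theorem SkewAdj.pow {N : Module.End F V} (hN : SkewAdj B N) (n : ℕ) (v w : V) :
    B ((N ^ n) v) w = (-1) ^ n * B v ((N ^ n) w) := by
  induction n generalizing v w with
  | zero => simp
  | succ n ih =>
    rw [pow_succ, Module.End.mul_apply, ih, hN, ← Module.End.mul_apply, ← pow_succ', ← pow_succ]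
    ring

theorem SkewAdj.aeval_left {N : Module.End F V} (hN : SkewAdj B N) (p : F[X]) (v w : V) :
    B (aeval N p v) w = B v (aeval N (p.comp (-X)) w) := by
  induction p using Polynomial.induction_on' with
  | add p q hp hq => simp [hp, hq]
  | monomial n a =>
    have : ((-N) ^ n) w = (-1 : F) ^ n • ((N ^ n) w) := by
      rw [neg_pow]
      rcases Nat.even_or_odd n with h | h <;> simp [h.neg_one_pow]
    rw [← C_mul_X_pow_eq_monomial]
    simp [Algebra.algebraMap_eq_smul_one, hN.pow n v w, this]

theorem SkewAdj.aeval_apply_self_comp (hB : SymmNondeg B) {N : Module.End F V}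
    (hN : SkewAdj B N) (f h : F[X]) (v : V) :
    B (aeval N (f.comp (-X)) v) (aeval N (h.comp (-X)) v) = B (aeval N f v) (aeval N h v) := by
  have hcc : ∀ f : F[X], (f.comp (-X)).comp (-X) = f := by
    intro f; rw [Polynomial.comp_assoc]; simp
  rw [hN.aeval_left, hcc, aeval_apply_apply, hB.1, hN.aeval_left, mul_comp, hcc,
    ← aeval_apply_apply, ← hN.aeval_left]

/-- The map `(f, h) ↦ f(N) v + h(N) w`. -/
def pairMap (N : Module.End F V) (v w : V) : F[X] × F[X] →ₗ[F] V where
  toFun p := aeval N p.1 v + aeval N p.2 w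
  map_add' p p' := by simp; abel
  map_smul' c p := by simp

theorem pairMap_apply (N : Module.End F V) (v w : V) (p : F[X] × F[X]) :
    pairMap N v w p = aeval N p.1 v + aeval N p.2 w := rfl

theorem apply_pairMap (N : Module.End F V) (v w : V) (p : F[X] × F[X]) :
    N (pairMap N v w p) = pairMap N v w (X * p.1, X * p.2) := by
  simp [pairMap_apply]

/-- The substitution `(f, h) ↦ (f(-X), -h(-X))`. -/
def pairFlip : F[X] × F[X] →ₗ[F] F[X] × F[X] where
  toFun p := (p.1.comp (-X), -p.2.comp (-X))
  map_add' p p' := by simp; abel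
  map_smul' c p := by simp

theorem pairFlip_apply (p : F[X] × F[X]) : pairFlip p = (p.1.comp (-X), -p.2.comp (-X)) := rfl

theorem nondegOn_range_pairMap {N : Module.End F V} (hN : SkewAdj B N)
    {r : ℕ} (hr : N ^ (r + 1) = 0) {v w : V}
    (H : ∀ α β : F, B ((N ^ r) (α • v + β • w)) v = 0 → B ((N ^ r) (α • v + β • w)) w = 0 →
      α • v + β • w = 0) : NondegOn B (LinearMap.range (pairMap N v w)) := by
  intro u hu h
  have hv : v ∈ LinearMap.range (pairMap N v w) := ⟨(1, 0), by simp [pairMap_apply]⟩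
  have hw : w ∈ LinearMap.range (pairMap N v w) := ⟨(0, 1), by simp [pairMap_apply]⟩
  have hst : ∀ j, ∀ x ∈ LinearMap.range (pairMap N v w),
      (N ^ j) x ∈ LinearMap.range (pairMap N v w) := by
    intro j
    induction j with
    | zero => intro x hx; simpa using hx
    | succ j ih =>
      intro x hx
      rw [pow_succ', Module.End.mul_apply]
      obtain ⟨p, hp⟩ := ih x hx
      exact ⟨(X * p.1, X * p.2), by rw [← hp, apply_pairMap]⟩
  have key : ∀ j, j ≤ r + 1 → ∃ p, u = (N ^ j) (pairMap N v w p) := by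
    intro j
    induction j with
    | zero => intro _; obtain ⟨p, hp⟩ := hu; exact ⟨p, by simp [hp]⟩
    | succ j ih =>
      intro hj
      obtain ⟨⟨f, g⟩, hp⟩ := ih (by omega)
      have hsplit : pairMap N v w (f, g) = (f.coeff 0 • v + g.coeff 0 • w) +
          N (pairMap N v w (f.divX, g.divX)) := by
        have hsp : ∀ (f : F[X]) (v : V), aeval N f v = aeval N (X * f.divX) v + f.coeff 0 • v := by
          intro f v
          have := congrArg (fun p => aeval N p v) f.X_mul_divX_add
          simp only [map_add, LinearMap.add_apply, aeval_C, Module.algebraMap_end_apply] at this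
          exact this.symm
        rw [apply_pairMap, pairMap_apply, pairMap_apply]
        simp only [hsp f v, hsp g w]
        abel
      have h1 : (N ^ (r - j)) u = (N ^ r) (f.coeff 0 • v + g.coeff 0 • w) := by
        rw [hp, ← Module.End.mul_apply, ← pow_add, Nat.sub_add_cancel (by omega), hsplit,
          map_add, ← Module.End.mul_apply (N ^ r) N, ← pow_succ, hr]
        simp
      have hz : ∀ x ∈ LinearMap.range (pairMap N v w),
          B ((N ^ r) (f.coeff 0 • v + g.coeff 0 • w)) x = 0 := by
        intro x hx
        rw [← h1, hN.pow, h _ (hst _ x hx), mul_zero]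
      have h0 := H _ _ (hz v hv) (hz w hw)
      refine ⟨(f.divX, g.divX), ?_⟩
      rw [hp, hsplit, h0, zero_add, pow_succ, Module.End.mul_apply]
  obtain ⟨p, hp⟩ := key (r + 1) le_rfl
  rw [hp, hr, LinearMap.zero_apply]

end SkewEndomorphism

section StronglyReal

open Polynomial

variable {F : Type} [Field F] {V : Type} [AddCommGroup V] [Module F V]
  {B : LinearMap.BilinForm F V}

theorem Indec.surjective {g : Module.End F V} (hg : Indec B g) {P : Type*} [AddCommGroup P]
    [Module F P] (Φ : P →ₗ[F] V) (hst : ∀ p, ∃ p', g (Φ p) = Φ p')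
    (hn : NondegOn B (LinearMap.range Φ)) (p : P) (hp : Φ p ≠ 0) : Function.Surjective Φ := by
  rw [← LinearMap.range_eq_top]
  refine (hg _ ?_ hn).resolve_left fun h => hp ?_
  · rintro _ ⟨p, rfl⟩
    obtain ⟨p', h⟩ := hst p
    exact ⟨p', h.symm⟩
  · exact LinearMap.congr_fun (LinearMap.range_eq_bot.1 h) p

theorem SkewAdj.commute_sq (N : Module.End F V) : Commute (N * N) N := by
  rw [commute_iff_eq, mul_assoc]

theorem SkewAdj.selfAdj_sq {N : Module.End F V} (hN : SkewAdj B N) : SelfAdj B (N * N) := by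
  intro v w
  simp [hN _ _]

theorem exists_involution_of_skew_injective [FiniteDimensional F V] [Nontrivial V]
    (hB : SymmNondeg B) (h2 : (2 : F) ≠ 0) {N : Module.End F V} (hN : SkewAdj B N)
    (hI : Indec B N) (hinj : Function.Injective N) :
    ∃ t : Module.End F V, (∀ v, t (t v) = v) ∧ IsIsom B t ∧ ∀ v, t (N v) = -N (t v) := by
  have hc := SkewAdj.commute_sq N
  have hy := hN.selfAdj_sq
  obtain ⟨π, k, hπ, hk, hk'⟩ := exists_irreducible_pow_aeval_eq_zero hB hI hy hc
  obtain ⟨v, hv⟩ := (hy.aeval (π ^ k)).exists_ne_zero hB h2 hk'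
  have hst : ∀ p : F[X] × F[X], N (cycMap (N * N) N v p) = cycMap (N * N) N v (X * p.2, p.1) := by
    intro p
    simp [cycMap_apply, add_comm]
  have hsurj := hI.surjective (cycMap (N * N) N v) (fun p => ⟨_, hst p⟩)
    (nondegOn_range_cycMap hB h2 hy hN hc (d := X) (by simp) hinj hπ hk hv) (1, 0) (by
      intro h
      apply hv
      have : v = 0 := by simpa [cycMap_apply] using h
      rw [this, map_zero, LinearMap.zero_apply])
  let τ : F[X] × F[X] →ₗ[F] F[X] × F[X] := LinearMap.prodMap LinearMap.id (-LinearMap.id)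
  have hτ : ∀ p, τ p = (p.1, -p.2) := fun p => rfl
  obtain ⟨t, ht1, ht2, ht3⟩ := exists_involution_of_surjective hB _ hsurj τ
    (fun p => by simp [hτ]) (fun p p' => by
      simp only [hτ, cycMap_apply, map_add, map_neg, LinearMap.neg_apply, LinearMap.add_apply,
        apply_skew_aeval hB h2 hy hN hc, hB.1 (aeval (N * N) p.1 v) (N _)]
      simp)
  refine ⟨t, ht1, ht2, fun x => ?_⟩
  obtain ⟨p, rfl⟩ := hsurj x
  rw [hst, ht3, ht3, hst, ← map_neg, hτ, hτ]
  simp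

theorem exists_functional (hB : SymmNondeg B) [FiniteDimensional F V] (f : Module.Dual F V) :
    ∃ w, ∀ v, B v w = f v := by
  have hinj : Function.Injective (B : V →ₗ[F] Module.Dual F V) := by
    rw [← LinearMap.ker_eq_bot, LinearMap.ker_eq_bot']
    intro v hv
    exact hB.2 v fun w => by rw [hv]; rfl
  obtain ⟨w, hw⟩ := (LinearMap.injective_iff_surjective_of_finrank_eq_finrank
    (Subspace.dual_finrank_eq (K := F) (V := V)).symm).1 hinj f
  exact ⟨w, fun v => by rw [hB.1, hw]⟩

theorem exists_involution_of_skew_nilpotent (hB : SymmNondeg B) {N : Module.End F V} (hN : SkewAdj B N)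
    (hI : Indec B N) {r : ℕ} (hr : N ^ (r + 1) = 0) {v w : V} (hv : v ≠ 0)
    (hvw : ∀ i, Even i → B v ((N ^ i) w) = 0)
    (H : ∀ α β : F, B ((N ^ r) (α • v + β • w)) v = 0 → B ((N ^ r) (α • v + β • w)) w = 0 →
      α • v + β • w = 0) :
    ∃ t : Module.End F V, (∀ v, t (t v) = v) ∧ IsIsom B t ∧ ∀ v, t (N v) = -N (t v) := by
  have hsurj := hI.surjective (pairMap N v w) (fun p => ⟨_, apply_pairMap N v w p⟩)
    (nondegOn_range_pairMap hN hr H) (1, 0) (by simpa [pairMap_apply] using hv)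
  have hcc : ∀ f : F[X], (f.comp (-X)).comp (-X) = f := by
    intro f; rw [Polynomial.comp_assoc]; simp
  have hodd : ∀ e : F[X], B v (aeval N (e.comp (-X)) w) = -B v (aeval N e w) := by
    intro e
    induction e using Polynomial.induction_on' with
    | add p q hp hq => simp [hp, hq]; ring
    | monomial n a =>
      rw [← C_mul_X_pow_eq_monomial]
      rcases Nat.even_or_odd n with h | h
      · simp [Algebra.algebraMap_eq_smul_one, h.neg_pow, hvw n h]
      · simp [Algebra.algebraMap_eq_smul_one, h.neg_pow]
  have hcross : ∀ f h : F[X], B (aeval N (f.comp (-X)) v) (aeval N (h.comp (-X)) w) =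
      -B (aeval N f v) (aeval N h w) := by
    intro f h
    rw [hN.aeval_left, hN.aeval_left, aeval_apply_apply, aeval_apply_apply, ← mul_comp, hodd,
      ← hodd, mul_comp, hcc, ← neg_inj, ← hodd, mul_comp, hcc]
  obtain ⟨t, ht1, ht2, ht3⟩ := exists_involution_of_surjective hB _ hsurj pairFlip
    (fun p => by simp [pairFlip_apply, hcc]) (fun p p' => by
      simp only [pairFlip_apply, pairMap_apply, map_add, map_neg, LinearMap.neg_apply,
        LinearMap.add_apply, hcross, hN.aeval_apply_self_comp hB,
        hB.1 (aeval N (Polynomial.comp _ (-X)) w) (aeval N (Polynomial.comp _ (-X)) v)]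
      rw [hB.1 (aeval N p'.1 v)]
      ring)
  refine ⟨t, ht1, ht2, fun x => ?_⟩
  obtain ⟨p, rfl⟩ := hsurj x
  rw [apply_pairMap, ht3, ht3, apply_pairMap, ← map_neg]
  simp [pairFlip_apply]

theorem exists_involution_of_skew [FiniteDimensional F V] [Nontrivial V]
    (hB : SymmNondeg B) (h2 : (2 : F) ≠ 0) {N : Module.End F V} (hN : SkewAdj B N)
    (hI : Indec B N) :
    ∃ t : Module.End F V, (∀ v, t (t v) = v) ∧ IsIsom B t ∧ ∀ v, t (N v) = -N (t v) := by
  by_cases hinj : Function.Injective N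
  · exact exists_involution_of_skew_injective hB h2 hN hI hinj
  obtain ⟨π, k, hπ, hk, -⟩ := exists_irreducible_pow_aeval_eq_zero hB hI hN.selfAdj_sq
    (SkewAdj.commute_sq N)
  have hnil : ∃ n, N ^ n = 0 := by
    rw [← LinearMap.ker_eq_bot, LinearMap.ker_eq_bot'] at hinj
    push Not at hinj
    obtain ⟨u, hu, hu0⟩ := hinj
    have hX : X ∣ π := by
      rw [X_dvd_iff]
      have h1 : ∀ p : F[X], aeval (N * N) p u = p.coeff 0 • u := by
        intro p
        have := congrArg (fun p => aeval (N * N) p u) p.divX_mul_X_add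
        simpa [hu] using this.symm
      have h3 := h1 (π ^ (k + 1))
      rw [hk, LinearMap.zero_apply, coeff_zero_eq_eval_zero, eval_pow, ← coeff_zero_eq_eval_zero]
        at h3
      exact eq_zero_of_pow_eq_zero ((smul_eq_zero.1 h3.symm).resolve_right hu0)
    obtain ⟨c, hc⟩ := (Irreducible.dvd_symm irreducible_X hπ hX)
    refine ⟨2 * (k + 1), ?_⟩
    have : aeval (N * N) (X ^ (k + 1) : F[X]) = 0 := by
      rw [hc, mul_pow, map_mul, hk, zero_mul]
    rwa [map_pow, aeval_X, ← pow_two, ← pow_mul] at this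
  have hfind := Nat.find_spec hnil
  obtain ⟨r, hr⟩ := Nat.exists_eq_succ_of_ne_zero (n := Nat.find hnil) (by
    intro h
    rw [h, pow_zero] at hfind
    exact one_ne_zero hfind)
  have hr0 : N ^ r ≠ 0 := Nat.find_min hnil (by omega)
  rw [hr] at hfind
  rcases Nat.even_or_odd r with he | ho
  · have hs : SelfAdj B (N ^ r) := fun v w => by rw [hN.pow, he.neg_one_pow, one_mul]
    obtain ⟨v, hv⟩ := hs.exists_ne_zero hB h2 hr0
    refine exists_involution_of_skew_nilpotent hB hN hI hfind (v := v) (w := 0) ?_ ?_ ?_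
    · rintro rfl
      simp at hv
    · simp
    · intro α β h _
      rw [smul_zero, add_zero, map_smul, map_smul, LinearMap.smul_apply, hB.1] at h
      rw [(smul_eq_zero.1 h).resolve_right hv, zero_smul, smul_zero, add_zero]
  · have hs : SkewAdj B (N ^ r) := fun v w => by rw [hN.pow, ho.neg_one_pow, neg_one_mul]
    obtain ⟨v, hv⟩ : ∃ v, (N ^ r) v ≠ 0 := by
      by_contra! hc
      exact hr0 (LinearMap.ext hc)
    let A : Submodule F V := LinearMap.range ((LinearMap.applyₗ v).comp
      (aeval (N * N) : F[X] →ₐ[F] Module.End F V).toLinearMap)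
    have hA : (N ^ r) v ∉ A := by
      rintro ⟨a, ha⟩
      have ha : aeval (N * N) a v = (N ^ r) v := ha
      have key : ∀ j, 2 * j ≤ r + 1 → ∃ a : F[X], (N ^ r) v = (N ^ (2 * j)) (aeval (N * N) a v) := by
        intro j
        induction j with
        | zero => intro _; exact ⟨a, by simp [ha]⟩
        | succ j ih =>
          intro hj
          obtain ⟨a, ha⟩ := ih (by omega)
          have hsp : aeval (N * N) a v = N (N (aeval (N * N) a.divX v)) + a.coeff 0 • v := by
            have := congrArg (fun p => aeval (N * N) p v) a.X_mul_divX_add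
            simp only [map_add, LinearMap.add_apply, aeval_C, Module.algebraMap_end_apply, map_mul,
              aeval_X, Module.End.mul_apply] at this
            exact this.symm
          have h1 := congrArg (N ^ (r - 2 * j)) ha
          rw [← Module.End.mul_apply, ← pow_add, ← Module.End.mul_apply, ← pow_add,
            Nat.sub_add_cancel (by omega), hsp, map_add, ← Module.End.mul_apply (N ^ r) N,
            ← pow_succ, hfind, pow_eq_zero_of_le (by omega) hfind] at h1
          simp only [LinearMap.zero_apply, zero_add, map_smul] at h1
          have h3 : a.coeff 0 = 0 := (smul_eq_zero.1 h1.symm).resolve_right hv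
          refine ⟨a.divX, ?_⟩
          rw [ha, hsp, h3, zero_smul, add_zero, mul_add, pow_add, Module.End.mul_apply]
          rfl
      obtain ⟨c, hc⟩ := ho
      obtain ⟨a, ha⟩ := key (c + 1) (by omega)
      rw [show 2 * (c + 1) = r + 1 by omega, hfind] at ha
      exact hv ha
    obtain ⟨f, hf1, hf2⟩ := Submodule.exists_dual_map_eq_bot_of_notMem hA inferInstance
    obtain ⟨w, hw⟩ := exists_functional hB f
    have hrw : B ((N ^ r) v) w ≠ 0 := by rw [hw]; exact hf1
    have hvv := hs.apply_self hB h2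
    refine exists_involution_of_skew_nilpotent hB hN hI hfind (v := v) (w := w) ?_ ?_ ?_
    · rintro rfl
      simp at hv
    · intro i hi
      have h1 := hN.pow i v w
      rw [hi.neg_one_pow, one_mul, hw] at h1
      rw [← h1]
      have h3 : f ((N ^ i) v) ∈ A.map f := by
        refine Submodule.mem_map_of_mem ⟨X ^ (i / 2), ?_⟩
        obtain ⟨j, rfl⟩ := hi
        rw [show (j + j) / 2 = j by omega]
        simp [pow_add, (Commute.refl N).mul_pow]
      rw [hf2] at h3
      exact (Submodule.mem_bot F).1 h3
    · intro α β h1 h3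
      rw [map_add, map_smul, map_smul, map_add, LinearMap.add_apply, map_smul, map_smul,
        LinearMap.smul_apply, LinearMap.smul_apply, hvv, smul_zero] at h1 h3
      rw [zero_add, hs, smul_neg, neg_eq_zero, hB.1, smul_eq_mul, mul_eq_zero] at h1
      rw [add_zero, smul_eq_mul, mul_eq_zero] at h3
      rw [h1.resolve_right hrw, h3.resolve_right hrw]
      simp

end StronglyReal

section StronglyRealIsometry

open Polynomial

variable {F : Type} [Field F] {V : Type} [AddCommGroup V] [Module F V]
  {B : LinearMap.BilinForm F V}

theorem aeval_apply_of_eq_smul {y : Module.End F V} {u : V} {a : F} (h : y u = a • u) (p : F[X]) :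
    aeval y p u = p.eval a • u := by
  have hp : ∀ n : ℕ, (y ^ n) u = a ^ n • u := by
    intro n
    induction n with
    | zero => simp
    | succ n ih => rw [pow_succ, Module.End.mul_apply, h, map_smul, ih, smul_smul, pow_succ']
  induction p using Polynomial.induction_on' with
  | add p q hp hq => simp [hp, hq, add_smul]
  | monomial n c =>
    simp [← C_mul_X_pow_eq_monomial, hp, smul_smul]
    rw [mul_comm]

theorem exists_involution_of_cayley [FiniteDimensional F V] [Nontrivial V]
    (hB : SymmNondeg B) (h2 : (2 : F) ≠ 0) {g : Module.End F V} (hg : IsIsom B g)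
    (hI : Indec B g) {ε : F} (hε : ε * ε = 1) (hinj : ∀ v, g v = -(ε • v) → v = 0) :
    ∃ t : Module.End F V, (∀ v, t (t v) = v) ∧ IsIsom B t ∧ ∀ v, g (t (g v)) = t v := by
  have hε0 : ε ≠ 0 := by rintro rfl; simp at hε
  let s : Module.End F V := g + ε • 1
  have hs : Function.Injective s := by
    rw [← LinearMap.ker_eq_bot, LinearMap.ker_eq_bot']
    intro v hv
    exact hinj v (eq_neg_of_add_eq_zero_left hv)
  let e : V ≃ₗ[F] V := LinearEquiv.ofInjectiveEndo s hs
  have he : ∀ v, e v = g v + ε • v := fun v => rfl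
  let N : Module.End F V := (g - ε • 1) * e.symm.toLinearMap
  have hN : ∀ v, N (g v + ε • v) = g v - ε • v := by
    intro v
    rw [← he]
    change (g - ε • 1) (e.symm (e v)) = _
    rw [e.symm_apply_apply]
    rfl
  have hsurj : ∀ v, ∃ a, v = g a + ε • a := fun v => ⟨e.symm v, by rw [← he, e.apply_symm_apply]⟩
  have hskew : SkewAdj B N := by
    intro v w
    obtain ⟨a, rfl⟩ := hsurj v
    obtain ⟨b, rfl⟩ := hsurj w
    rw [hN, hN]
    simp only [map_add, map_sub, LinearMap.add_apply, LinearMap.sub_apply, map_smul,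
      LinearMap.smul_apply, hg a b, smul_eq_mul]
    linear_combination (-2 * B a b) * hε
  have hNg : ∀ v, g v - N (g v) = ε • (v + N v) := by
    intro v
    have := hN v
    rw [map_add, map_smul, sub_eq_iff_eq_add] at *
    rw [smul_add]
    have h3 : N (g v) = g v - ε • v - ε • N v := by rw [← this]; abel
    rw [h3]
    abel
  have hinj1 : ∀ v, N v = v → v = 0 := by
    intro v hv
    obtain ⟨a, rfl⟩ := hsurj v
    rw [hN, sub_eq_add_neg, add_right_inj, neg_eq_iff_add_eq_zero, ← two_smul F, smul_smul,
      smul_eq_zero] at hv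
    rw [hv.resolve_left (mul_ne_zero h2 hε0)]
    simp
  have hcomm : ∀ v, N (g v) = g (N v) := by
    intro v
    obtain ⟨a, rfl⟩ := hsurj v
    rw [hN, map_add g, map_smul g, hN, map_sub, map_smul]
  have hIN : Indec B N := by
    intro U hU hn
    refine hI U (fun u hu => ?_) hn
    let k : U →ₗ[F] U := LinearMap.id - N.restrict hU
    have hk : ∀ u, ((k u : U) : V) = u - N u := fun u => rfl
    have hki : Function.Injective k := by
      rw [← LinearMap.ker_eq_bot, LinearMap.ker_eq_bot']
      intro v hv
      have h3 := congrArg Subtype.val hv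
      rw [hk] at h3
      exact Subtype.ext (hinj1 v (sub_eq_zero.1 h3).symm)
    obtain ⟨u', hu'⟩ := LinearMap.injective_iff_surjective.1 hki
      ⟨ε • (u + N u), U.smul_mem _ (U.add_mem hu (hU u hu))⟩
    have h3 := congrArg Subtype.val hu'
    rw [hk] at h3
    have h4 : g u = u' := by
      rw [← sub_eq_zero]
      apply hinj1
      rw [map_sub, ← sub_eq_zero]
      have := hNg u
      simp only at h3
      rw [← h3] at this
      rw [← neg_eq_zero, ← sub_eq_zero.2 this]
      abel
    rw [h4]
    exact u'.2
  obtain ⟨t, ht1, ht2, ht3⟩ := exists_involution_of_skew hB h2 hskew hIN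
  refine ⟨t, ht1, ht2, fun v => ?_⟩
  rw [← sub_eq_zero]
  apply hinj1
  have h5 : g (t (g v)) - N (g (t (g v))) = ε • (t (g v) - t (N (g v))) := by
    rw [hNg, ht3, sub_neg_eq_add]
  rw [← map_sub, hNg v, map_smul, map_add, ht3, smul_smul, hε, one_smul] at h5
  rw [map_sub, ← sub_eq_zero]
  have h6 := sub_eq_zero.2 h5
  rw [← neg_eq_zero, ← h6]
  abel

theorem exists_involution_of_indec [FiniteDimensional F V] [Nontrivial V]
    (hB : SymmNondeg B) (h2 : (2 : F) ≠ 0) {g : Module.End F V} (hg : IsIsom B g)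
    (hI : Indec B g) :
    ∃ t : Module.End F V, (∀ v, t (t v) = v) ∧ IsIsom B t ∧ ∀ v, g (t (g v)) = t v := by
  let e : V ≃ₗ[F] V := LinearEquiv.ofInjectiveEndo g (hg.injective hB)
  have he : ∀ v, e v = g v := fun v => rfl
  have he' : ∀ v, g (e.symm v) = v := fun v => by rw [← he, e.apply_symm_apply]
  have he'' : ∀ v, e.symm (g v) = v := fun v => by rw [← he, e.symm_apply_apply]
  let y : Module.End F V := g + e.symm.toLinearMap
  have hyv : ∀ v, y v = g v + e.symm v := fun v => rfl
  have hy : SelfAdj B y := by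
    intro v w
    rw [hyv, hyv, map_add, map_add, LinearMap.add_apply, ← hg (e.symm v), he',
      ← hg v (e.symm w), he', add_comm]
  have hyg : Commute y g := by
    refine LinearMap.ext fun v => ?_
    simp only [Module.End.mul_apply, hyv, map_add, he', he'']
  obtain ⟨π, k, hπ, hk, -⟩ := exists_irreducible_pow_aeval_eq_zero hB hI hy hyg
  have hroot : ∀ (a : F) (u : V), u ≠ 0 → y u = a • u → π.eval a = 0 := by
    intro a u hu h
    have h1 := aeval_apply_of_eq_smul h (π ^ (k + 1))
    rw [hk, LinearMap.zero_apply, eval_pow] at h1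
    exact eq_zero_of_pow_eq_zero ((smul_eq_zero.1 h1.symm).resolve_right hu)
  by_cases h1 : ∀ v, g v = -((1 : F) • v) → v = 0
  · exact exists_involution_of_cayley hB h2 hg hI (one_mul 1) h1
  by_cases h3 : ∀ v, g v = -((-1 : F) • v) → v = 0
  · exact exists_involution_of_cayley hB h2 hg hI (by ring) h3
  exfalso
  push Not at h1 h3
  obtain ⟨u, hu, hu0⟩ := h1
  obtain ⟨w, hw, hw0⟩ := h3
  rw [one_smul] at hu
  rw [neg_one_smul, neg_neg] at hw
  have h4 : π.eval (-2) = 0 := hroot _ u hu0 (by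
    have h := he'' u
    rw [hu, map_neg, neg_eq_iff_eq_neg] at h
    rw [hyv, hu, h, neg_smul, two_smul, neg_add])
  have h5 : π.eval 2 = 0 := hroot _ w hw0 (by
    have h := he'' w
    rw [hw] at h
    rw [hyv, hw, h, two_smul])
  obtain ⟨c, hc⟩ := (irreducible_X_sub_C (2 : F)).dvd_symm hπ (dvd_iff_isRoot.2 h5)
  have h6 := congrArg (eval (-2)) hc
  rw [eval_mul, h4, zero_mul, eval_sub, eval_X, eval_C] at h6
  have : (2 : F) * 2 = 0 := by linear_combination -h6
  exact h2 (mul_self_eq_zero.1 this)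

theorem IsIsom.mem_orthogonal [FiniteDimensional F V] (hB : SymmNondeg B) {g : Module.End F V}
    (hg : IsIsom B g) {U : Submodule F V} (hU : ∀ u ∈ U, g u ∈ U) {v : V}
    (hv : v ∈ B.orthogonal U) : g v ∈ B.orthogonal U := by
  rw [hB.mem_orthogonal] at hv ⊢
  intro u hu
  have hinj : Function.Injective (g.restrict hU) := fun a b h =>
    Subtype.ext (hg.injective hB (congrArg Subtype.val h))
  obtain ⟨u', hu'⟩ := LinearMap.injective_iff_surjective.1 hinj ⟨u, hu⟩
  have h1 : g u' = u := congrArg Subtype.val hu'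
  rw [← h1, hg, hv u' u'.2]

theorem SymmNondeg.exists_glue [FiniteDimensional F V] (hB : SymmNondeg B) {U : Submodule F V}
    (hU : NondegOn B U) {t₁ : Module.End F U} {t₂ : Module.End F (B.orthogonal U)}
    (h₁ : IsIsom (B.restrict U) t₁) (h₂ : IsIsom (B.restrict (B.orthogonal U)) t₂) :
    ∃ t : Module.End F V, IsIsom B t ∧ (∀ u : U, t u = t₁ u) ∧
      ∀ u : B.orthogonal U, t u = t₂ u := by
  have hc := hB.isCompl hU
  refine ⟨LinearMap.ofIsCompl hc (U.subtype ∘ₗ t₁) ((B.orthogonal U).subtype ∘ₗ t₂), ?_, ?_, ?_⟩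
  · intro v w
    obtain ⟨a, ha, b, hb, rfl⟩ := Submodule.mem_sup.1
      (hc.sup_eq_top ▸ Submodule.mem_top : v ∈ U ⊔ B.orthogonal U)
    obtain ⟨c, hc', d, hd, rfl⟩ := Submodule.mem_sup.1
      (hc.sup_eq_top ▸ Submodule.mem_top : w ∈ U ⊔ B.orthogonal U)
    lift a to U using ha
    lift b to B.orthogonal U using hb
    lift c to U using hc'
    lift d to B.orthogonal U using hd
    have horth : ∀ (a : U) (b : B.orthogonal U), B a b = 0 ∧ B b a = 0 := fun a b =>
      ⟨by rw [hB.1]; exact hB.mem_orthogonal.1 b.2 a a.2, hB.mem_orthogonal.1 b.2 a a.2⟩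
    simp only [map_add, LinearMap.add_apply, LinearMap.ofIsCompl_apply_left,
      LinearMap.ofIsCompl_apply_right, LinearMap.comp_apply, Submodule.subtype_apply,
      (horth _ _).1, (horth _ _).2]
    have e1 : B (t₁ a : V) (t₁ c : V) = B a c := h₁ a c
    have e2 : B (t₂ b : V) (t₂ d : V) = B b d := h₂ b d
    rw [e1, e2]
  · intro u
    rw [LinearMap.ofIsCompl_apply_left]; rfl
  · intro u
    rw [LinearMap.ofIsCompl_apply_right]; rfl

theorem exists_involution_inverting (h2 : (2 : F) ≠ 0) (n : ℕ) :
    ∀ {V : Type} [AddCommGroup V] [Module F V] [FiniteDimensional F V]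
      {B : LinearMap.BilinForm F V} (_ : SymmNondeg B) (_ : Module.finrank F V = n)
      {g : Module.End F V} (_ : IsIsom B g),
      ∃ t : Module.End F V, (∀ v, t (t v) = v) ∧ IsIsom B t ∧ ∀ v, g (t (g v)) = t v := by
  induction n using Nat.strong_induction_on with
  | _ n ih =>
  intro V _ _ _ B hB hn g hg
  by_cases hI : Indec B g
  · rcases subsingleton_or_nontrivial V with h | h
    · exact ⟨1, fun v => rfl, fun v w => rfl, fun v => Subsingleton.elim _ _⟩
    · exact exists_involution_of_indec hB h2 hg hI
  · simp only [Indec, not_forall, not_or] at hI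
    obtain ⟨U, hU, hnd, hb, ht⟩ := hI
    have hc := hB.isCompl hnd
    have hsum := Submodule.finrank_add_eq_of_isCompl hc
    have hlt : Module.finrank F U < n := by
      rw [← hn]; exact Submodule.finrank_lt ht
    have hpos : Module.finrank F U ≠ 0 := fun h => hb (Submodule.finrank_eq_zero.1 h)
    have hU' : ∀ u ∈ B.orthogonal U, g u ∈ B.orthogonal U :=
      fun u hu => hg.mem_orthogonal hB hU hu
    obtain ⟨t₁, a1, a2, a3⟩ := ih _ hlt (hB.restrict hnd) rfl (g := g.restrict hU)
      (fun v w => hg v w)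
    obtain ⟨t₂, b1, b2, b3⟩ := ih (Module.finrank F (B.orthogonal U)) (by omega)
      (hB.restrict (hB.nondegOn_orthogonal hnd)) rfl (g := g.restrict hU') (fun v w => hg v w)
    obtain ⟨t, t1, t2, t3⟩ := hB.exists_glue hnd a2 b2
    have hext : ∀ p q : Module.End F V, (∀ u : U, p u = q u) →
        (∀ u : B.orthogonal U, p u = q u) → ∀ v, p v = q v := by
      intro p q h1 h3 v
      obtain ⟨a, ha, b, hb, rfl⟩ := Submodule.mem_sup.1
        (hc.sup_eq_top ▸ Submodule.mem_top : v ∈ U ⊔ B.orthogonal U)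
      rw [map_add, map_add, h1 ⟨a, ha⟩, h3 ⟨b, hb⟩]
    refine ⟨t, hext (t * t) 1 ?_ ?_, t1, hext (g * (t * g)) t ?_ ?_⟩
    · intro u
      simp [t2, a1]
    · intro u
      simp [t3, b1]
    · intro u
      have h1 : g u = (g.restrict hU u : U) := rfl
      have h3 := congrArg Subtype.val (a3 u)
      rw [Module.End.mul_apply, Module.End.mul_apply, h1, t2, t2]
      exact h3
    · intro u
      have h1 : g u = (g.restrict hU' u : B.orthogonal U) := rfl
      have h3 := congrArg Subtype.val (b3 u)
      rw [Module.End.mul_apply, Module.End.mul_apply, h1, t3, t3]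
      exact h3

end StronglyRealIsometry

section Extension

variable {G : Type} [Group G]

/-- The union of `N` and its coset `s N`, where `s` normalizes `N` and `s ^ 2` lies in `N`. -/
def extendBy (N : Subgroup G) (s : G) (hs : ∀ n ∈ N, s * n * s⁻¹ ∈ N) (hss : s * s ∈ N) :
    Subgroup G where
  carrier := {k | k ∈ N ∨ s⁻¹ * k ∈ N}
  one_mem' := Or.inl N.one_mem
  mul_mem' := by
    have hs' : ∀ n ∈ N, s⁻¹ * n * s ∈ N := fun n hn => by
      have h := N.mul_mem (N.mul_mem (N.inv_mem hss) (hs n hn)) hss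
      rwa [show (s * s)⁻¹ * (s * n * s⁻¹) * (s * s) = s⁻¹ * n * s by group] at h
    rintro a b (ha | ha) (hb | hb)
    · exact Or.inl (N.mul_mem ha hb)
    · right
      have h := N.mul_mem (hs' a ha) hb
      rwa [show s⁻¹ * a * s * (s⁻¹ * b) = s⁻¹ * (a * b) by group] at h
    · right
      have h := N.mul_mem ha hb
      rwa [mul_assoc] at h
    · left
      have h := N.mul_mem hss (N.mul_mem (hs' _ ha) hb)
      rwa [show s * s * (s⁻¹ * (s⁻¹ * a) * s * (s⁻¹ * b)) = a * b by group] at h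
  inv_mem' := by
    rintro a (ha | ha)
    · exact Or.inl (N.inv_mem ha)
    · right
      have h := N.mul_mem (N.inv_mem hss) (hs _ (N.inv_mem ha))
      rwa [show (s * s)⁻¹ * (s * (s⁻¹ * a)⁻¹ * s⁻¹) = s⁻¹ * a⁻¹ by group] at h

theorem le_extendBy {N : Subgroup G} {s : G} {hs : ∀ n ∈ N, s * n * s⁻¹ ∈ N} {hss : s * s ∈ N} :
    N ≤ extendBy N s hs hss := fun _ => Or.inl

theorem self_mem_extendBy {N : Subgroup G} {s : G} {hs : ∀ n ∈ N, s * n * s⁻¹ ∈ N}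
    {hss : s * s ∈ N} : s ∈ extendBy N s hs hss :=
  Or.inr (by rw [inv_mul_cancel]; exact N.one_mem)

theorem exists_nonnegFS_dihedral [Finite G] (N : Subgroup G)
    (hN : ∀ a ∈ N, ∀ b ∈ N, a * b = b * a) (t : G) (htt : t * t = 1)
    (htN : ∀ β ∈ N, t * β * t = β⁻¹) :
    ∃ K : Subgroup G, N ≤ K ∧ t ∈ K ∧ NonnegFS K := by
  have ht : t⁻¹ = t := inv_eq_of_mul_eq_one_right htt
  let K := extendBy N t (fun n hn => by rw [ht, htN n hn]; exact N.inv_mem hn)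
    (by rw [htt]; exact N.one_mem)
  refine ⟨K, le_extendBy, self_mem_extendBy, ?_⟩
  refine NonnegFS.of_dihedral (N.subgroupOf K) ?_ ⟨t, self_mem_extendBy⟩ ?_ ?_
  · rintro a ha b hb
    exact Subtype.ext (hN a.1 ha b.1 hb)
  · rintro β hβ
    exact Subtype.ext (htN β.1 hβ)
  · rintro ⟨k, hk⟩
    exact hk

theorem exists_nonnegFS_semidihedral [Finite G] (N : Subgroup G)
    (hN : ∀ a ∈ N, ∀ b ∈ N, a * b = b * a) (t : G) (htt : t * t = 1)
    (htN : ∀ β ∈ N, t * β * t = β⁻¹) (htn : t ∉ N) (b : G) (hb : ∀ β ∈ N, b⁻¹ * β * b ∈ N)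
    (hbb : b * b ∈ N) (htb : t * b * t * b ∈ N) :
    ∃ K : Subgroup G, N ≤ K ∧ t ∈ K ∧ b ∈ K ∧ NonnegFS K := by
  have ht : t⁻¹ = t := inv_eq_of_mul_eq_one_right htt
  have hb' : ∀ β ∈ N, b * β * b⁻¹ ∈ N := fun n hn => by
    have h := N.mul_mem (N.mul_mem hbb (hb n hn)) (N.inv_mem hbb)
    rwa [show b * b * (b⁻¹ * n * b) * (b * b)⁻¹ = b * n * b⁻¹ by group] at h
  let M := extendBy N t (fun n hn => by rw [ht, htN n hn]; exact N.inv_mem hn)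
    (by rw [htt]; exact N.one_mem)
  have hbt : t⁻¹ * (b * t * b⁻¹) ∈ N := by
    have h := N.mul_mem htb (N.inv_mem hbb)
    rw [show t * b * t * b * (b * b)⁻¹ = t * (b * t * b⁻¹) by group] at h
    rwa [ht]
  have hbM : ∀ n ∈ M, b * n * b⁻¹ ∈ M := by
    rintro n (hn | hn)
    · exact Or.inl (hb' n hn)
    · right
      have h := N.mul_mem hbt (hb' _ hn)
      rwa [show t⁻¹ * (b * t * b⁻¹) * (b * (t⁻¹ * n) * b⁻¹) = t⁻¹ * (b * n * b⁻¹) by group] at h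
  let K := extendBy M b hbM (Or.inl hbb)
  have hNK : N ≤ K := fun n hn => Or.inl (Or.inl hn)
  have htK : t ∈ K := le_extendBy self_mem_extendBy
  have hbK : b ∈ K := self_mem_extendBy
  refine ⟨K, hNK, htK, hbK, ?_⟩
  refine NonnegFS.of_semidihedral (N.subgroupOf K) ?_ ⟨t, htK⟩ ?_ ?_ ?_ ⟨b, hbK⟩ ?_ ?_ ?_ ?_
  · rintro a ha b hb
    exact Subtype.ext (hN a.1 ha b.1 hb)
  · exact Subtype.ext htt
  · rintro β hβ
    exact Subtype.ext (htN β.1 hβ)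
  · exact htn
  · rintro β hβ
    exact hb β.1 hβ
  · exact hbb
  · exact htb
  · rintro ⟨k, (hk | hk)⟩
    · exact Or.inl hk
    · right
      rcases hk with hk | hk
      · exact Or.inl hk
      · right
        have h1 : b⁻¹ * t⁻¹ * b * t ∈ N := by
          rw [show b⁻¹ * t⁻¹ * b * t = b⁻¹ * (t⁻¹ * (b * t * b⁻¹)) * b by group]
          exact hb _ hbt
        have h := N.mul_mem h1 hk
        change (t * b)⁻¹ * k ∈ N
        rwa [show b⁻¹ * t⁻¹ * b * t * (t⁻¹ * (b⁻¹ * k)) = (t * b)⁻¹ * k by group] at h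

theorem mem_zpowers_mul_of_coprime {x a : G} (h : Commute x a)
    (hc : (orderOf x).Coprime (orderOf a)) :
    x ∈ Subgroup.zpowers (x * a) ∧ a ∈ Subgroup.zpowers (x * a) := by
  obtain ⟨k, h1, h2⟩ := Nat.chineseRemainder hc 1 0
  obtain ⟨l, h3, h4⟩ := Nat.chineseRemainder hc 0 1
  refine ⟨⟨k, ?_⟩, ⟨l, ?_⟩⟩
  · simp only [zpow_natCast]
    rw [h.mul_pow, pow_eq_pow_iff_modEq.2 h1, pow_eq_pow_iff_modEq.2 h2]
    simp
  · simp only [zpow_natCast]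
    rw [h.mul_pow, pow_eq_pow_iff_modEq.2 h3, pow_eq_pow_iff_modEq.2 h4]
    simp

end Extension

section OrthogonalGroup

variable {F : Type} [Field F] {V : Type} [AddCommGroup V] [Module F V]

/-- The isometry group of the bilinear form `B`. -/
def orthGroup (B : LinearMap.BilinForm F V) : Subgroup (V ≃ₗ[F] V) where
  carrier := {g | ∀ v w, B (g v) (g w) = B v w}
  one_mem' := fun _ _ => rfl
  mul_mem' := fun {a b} ha hb v w => by rw [LinearEquiv.mul_apply, LinearEquiv.mul_apply, ha, hb]
  inv_mem' := fun {a} ha v w => by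
    rw [← ha]
    exact congrArg₂ (fun x y => B x y) (a.apply_symm_apply v) (a.apply_symm_apply w)

variable {B : LinearMap.BilinForm F V}

/-- The linear endomorphism underlying an isometry. -/
def orthEnd (g : orthGroup B) : Module.End F V := (g : V ≃ₗ[F] V).toLinearMap

theorem orthEnd_mul (g h : orthGroup B) : orthEnd (g * h) = orthEnd g * orthEnd h := rfl

theorem orthEnd_mul_apply (g h : orthGroup B) (v : V) :
    orthEnd (g * h) v = orthEnd g (orthEnd h v) := rfl

theorem orthEnd_one_apply (v : V) : orthEnd (1 : orthGroup B) v = v := rfl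

theorem orthEnd_inv_apply_self (g : orthGroup B) (v : V) : orthEnd g⁻¹ (orthEnd g v) = v := by
  rw [← orthEnd_mul_apply, inv_mul_cancel]; rfl

theorem orthEnd_apply_inv_self (g : orthGroup B) (v : V) : orthEnd g (orthEnd g⁻¹ v) = v := by
  rw [← orthEnd_mul_apply, mul_inv_cancel]; rfl

theorem orthEnd_isIsom (g : orthGroup B) : IsIsom B (orthEnd g) := g.2

theorem orthGroup_ext {g h : orthGroup B} (H : ∀ v, orthEnd g v = orthEnd h v) : g = h :=
  Subtype.ext (LinearEquiv.ext H)

instance [Finite F] [FiniteDimensional F V] : Finite (orthGroup B) := by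
  have : Finite V := Module.finite_of_finite F
  exact Finite.of_injective (fun g : orthGroup B => (orthEnd g : V → V))
    fun _ _ h => orthGroup_ext (congrFun h)

theorem SymmNondeg.le_orthogonal_orthogonal (hB : SymmNondeg B) {U : Submodule F V} :
    U ≤ B.orthogonal (B.orthogonal U) := by
  intro u hu
  rw [hB.mem_orthogonal]
  intro w hw
  rw [hB.1]
  exact hB.mem_orthogonal.1 hw u hu

/-- The subspace of vectors fixed by `a`. -/
def fixedSpace (a : orthGroup B) : Submodule F V := LinearMap.ker (orthEnd a - 1)

theorem mem_fixedSpace {a : orthGroup B} {v : V} : v ∈ fixedSpace a ↔ orthEnd a v = v := by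
  rw [fixedSpace, LinearMap.mem_ker, LinearMap.sub_apply, sub_eq_zero]; rfl

theorem fixedSpace_of_involution (hB : SymmNondeg B) (h2 : (2 : F) ≠ 0) {a : orthGroup B}
    (ha : a * a = 1) : NondegOn B (fixedSpace a) ∧
      ∀ v, v ∈ B.orthogonal (fixedSpace a) ↔ orthEnd a v = -v := by
  have haa : ∀ v, orthEnd a (orthEnd a v) = v := fun v => by
    rw [← orthEnd_mul_apply, ha]; rfl
  have horth : ∀ v w, orthEnd a v = v → orthEnd a w = -w → B v w = 0 := by
    intro v w hv hw
    have h := a.2 v w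
    change B (orthEnd a v) (orthEnd a w) = _ at h
    rw [hv, hw, map_neg] at h
    have : (2 : F) * B v w = 0 := by linear_combination -h
    exact (mul_eq_zero.1 this).resolve_left h2
  have hsplit : ∀ v, (2 : F) • v = (v + orthEnd a v) + (v - orthEnd a v) := fun v => by
    rw [two_smul]; abel
  have hplus : ∀ v, v + orthEnd a v ∈ fixedSpace a := fun v => by
    rw [mem_fixedSpace, map_add, haa, add_comm]
  have hminus : ∀ v, orthEnd a (v - orthEnd a v) = -(v - orthEnd a v) := fun v => by
    rw [map_sub, haa, neg_sub]
  have hnd : NondegOn B (fixedSpace a) := by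
    intro v hv h
    apply hB.2
    intro w
    have h3 : (2 : F) * B v w = 0 := by
      rw [← smul_eq_mul, ← map_smul, hsplit, map_add, h _ (hplus w),
        horth v _ (mem_fixedSpace.1 hv) (hminus w), add_zero]
    exact (mul_eq_zero.1 h3).resolve_left h2
  refine ⟨hnd, fun v => ⟨fun hv => ?_, fun hv => ?_⟩⟩
  · rw [hB.mem_orthogonal] at hv
    have h1 : v + orthEnd a v = 0 := by
      apply hnd _ (hplus v)
      intro w hw
      rw [map_add, LinearMap.add_apply, hv w hw, ← mem_fixedSpace.1 hw, zero_add]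
      exact (a.2 v w).trans (hv w hw)
    exact eq_neg_of_add_eq_zero_right h1
  · rw [hB.mem_orthogonal]
    intro u hu
    rw [hB.1]
    exact horth u v (mem_fixedSpace.1 hu) hv

variable [FiniteDimensional F V]

/-- The element of the orthogonal group given by an isometric endomorphism. -/
def IsIsom.toOrth (hB : SymmNondeg B) {g : Module.End F V} (hg : IsIsom B g) : orthGroup B :=
  ⟨LinearEquiv.ofInjectiveEndo g (hg.injective hB), hg⟩

theorem IsIsom.orthEnd_toOrth (hB : SymmNondeg B) {g : Module.End F V} (hg : IsIsom B g) (v : V) :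
    orthEnd (hg.toOrth hB) v = g v := rfl

/-- The central isometry `-1`. -/
def negOne (hB : SymmNondeg B) : orthGroup B :=
  IsIsom.toOrth hB (g := -1) (fun v w => by simp)

theorem orthEnd_negOne (hB : SymmNondeg B) (v : V) : orthEnd (negOne hB) v = -v := rfl

theorem negOne_comm (hB : SymmNondeg B) (g : orthGroup B) : g * negOne hB = negOne hB * g :=
  orthGroup_ext fun v => by simp [orthEnd_mul_apply, orthEnd_negOne]

theorem negOne_mul_self (hB : SymmNondeg B) : negOne hB * negOne hB = 1 :=
  orthGroup_ext fun v => by simp [orthEnd_mul_apply, orthEnd_negOne, orthEnd_one_apply]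

theorem negOne_ne_one [Nontrivial V] (h2 : (2 : F) ≠ 0) (hB : SymmNondeg B) : negOne hB ≠ 1 := by
  intro h
  obtain ⟨v, hv⟩ := exists_ne (0 : V)
  have h1 := congrArg (fun g => orthEnd g v) h
  simp only [orthEnd_negOne, orthEnd_one_apply] at h1
  have h3 : (2 : F) • v = 0 := by rw [two_smul]; nth_rw 1 [← h1]; simp
  exact hv ((smul_eq_zero.1 h3).resolve_left h2)

theorem exists_orth_involution (hB : SymmNondeg B) (h2 : (2 : F) ≠ 0) (g : orthGroup B) :
    ∃ t : orthGroup B, t * t = 1 ∧ t * g * t = g⁻¹ := by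
  obtain ⟨t, h1, h3, h4⟩ := exists_involution_inverting h2 _ hB rfl (orthEnd_isIsom g)
  have htt : h3.toOrth hB * h3.toOrth hB = 1 := orthGroup_ext h1
  refine ⟨h3.toOrth hB, htt, ?_⟩
  rw [eq_inv_iff_mul_eq_one, mul_assoc (h3.toOrth hB * g), mul_assoc]
  have : g * (h3.toOrth hB * g) = h3.toOrth hB := orthGroup_ext h4
  rw [this, htt]

variable {U : Submodule F V}

theorem orthGroup_ext_of_nondegOn (hB : SymmNondeg B) (hU : NondegOn B U) {g h : orthGroup B}
    (h1 : ∀ u ∈ U, orthEnd g u = orthEnd h u)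
    (h2 : ∀ u ∈ B.orthogonal U, orthEnd g u = orthEnd h u) : g = h := by
  apply orthGroup_ext
  intro v
  obtain ⟨a, ha, b, hb, rfl⟩ := Submodule.mem_sup.1
    ((hB.isCompl hU).sup_eq_top ▸ Submodule.mem_top : v ∈ U ⊔ B.orthogonal U)
  rw [map_add, map_add, h1 a ha, h2 b hb]

theorem exists_orthExtend (hB : SymmNondeg B) (hU : NondegOn B U) (a : orthGroup (B.restrict U)) :
    ∃ t : orthGroup B, (∀ u : U, orthEnd t u = orthEnd a u) ∧
      ∀ u ∈ B.orthogonal U, orthEnd t u = u := by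
  obtain ⟨t, h1, h2, h3⟩ := hB.exists_glue hU (orthEnd_isIsom a) (t₂ := 1) fun v w => rfl
  exact ⟨h1.toOrth hB, h2, fun u hu => h3 ⟨u, hu⟩⟩

/-- Extension of isometries of a nondegenerate subspace by the identity on its complement. -/
def orthExtend (hB : SymmNondeg B) (hU : NondegOn B U) :
    orthGroup (B.restrict U) →* orthGroup B where
  toFun a := (exists_orthExtend hB hU a).choose
  map_one' := by
    obtain ⟨h1, h2⟩ := (exists_orthExtend hB hU 1).choose_spec
    exact orthGroup_ext_of_nondegOn hB hU (fun u hu => h1 ⟨u, hu⟩) h2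
  map_mul' a b := by
    obtain ⟨h1, h2⟩ := (exists_orthExtend hB hU (a * b)).choose_spec
    obtain ⟨h3, h4⟩ := (exists_orthExtend hB hU a).choose_spec
    obtain ⟨h5, h6⟩ := (exists_orthExtend hB hU b).choose_spec
    refine orthGroup_ext_of_nondegOn hB hU (fun u hu => ?_) fun u hu => ?_
    · exact (h1 ⟨u, hu⟩).trans ((h3 _).symm.trans (congrArg _ (h5 ⟨u, hu⟩).symm))
    · rw [h2 u hu, orthEnd_mul_apply, h6 u hu, h4 u hu]

theorem orthExtend_apply (hB : SymmNondeg B) (hU : NondegOn B U) (a : orthGroup (B.restrict U))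
    (u : U) : orthEnd (orthExtend hB hU a) u = orthEnd a u :=
  (exists_orthExtend hB hU a).choose_spec.1 u

theorem orthExtend_apply_orthogonal (hB : SymmNondeg B) (hU : NondegOn B U)
    (a : orthGroup (B.restrict U)) {u : V} (hu : u ∈ B.orthogonal U) :
    orthEnd (orthExtend hB hU a) u = u :=
  (exists_orthExtend hB hU a).choose_spec.2 u hu

/-- Restriction of an isometry to an invariant nondegenerate subspace. -/
def orthRestrict (hB : SymmNondeg B) (hU : NondegOn B U) (g : orthGroup B)
    (hg : ∀ u ∈ U, orthEnd g u ∈ U) : orthGroup (B.restrict U) :=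
  IsIsom.toOrth (hB.restrict hU) (g := (orthEnd g).restrict hg) fun v w => g.2 v w

theorem orthRestrict_apply (hB : SymmNondeg B) (hU : NondegOn B U) (g : orthGroup B)
    (hg : ∀ u ∈ U, orthEnd g u ∈ U) (u : U) :
    (orthEnd (orthRestrict hB hU g hg) u : V) = orthEnd g u := rfl

end OrthogonalGroup

section SignedCentralizer

variable {F : Type} [Field F] {V : Type} [AddCommGroup V] [Module F V] [FiniteDimensional F V]
  {B : LinearMap.BilinForm F V} {U : Submodule F V}

/-- The elements of `G` commuting with `a` up to the central involution `z`. -/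
def signedCentralizer {G : Type} [Group G] (z : G) (hz : ∀ g, g * z = z * g) (hzz : z * z = 1)
    (a : G) : Subgroup G where
  carrier := {k | k * a = a * k ∨ k * a = z * (a * k)}
  one_mem' := Or.inl (by simp)
  mul_mem' := by
    have key : ∀ x y w : G, x * (z * (y * w)) = z * (x * y * w) := fun x y w => by
      rw [← mul_assoc, hz, mul_assoc, mul_assoc]
    rintro x y (hx | hx) (hy | hy)
    · left
      rw [mul_assoc, hy, ← mul_assoc, hx, mul_assoc]
    · right
      rw [mul_assoc, hy, key, hx]; simp only [mul_assoc]
    · right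
      rw [mul_assoc, hy, ← mul_assoc, hx]; simp only [mul_assoc]
    · left
      rw [mul_assoc, hy, key, hx, ← mul_assoc z, ← mul_assoc z, hzz]; simp only [mul_assoc, one_mul]
  inv_mem' := by
    rintro x (hx | hx)
    · left
      rw [inv_mul_eq_iff_eq_mul, ← mul_assoc, hx, mul_inv_cancel_right]
    · right
      rw [inv_mul_eq_iff_eq_mul, ← mul_assoc, hz, mul_assoc, ← mul_assoc x, hx, ← mul_assoc z,
        ← mul_assoc z, hzz, one_mul, mul_inv_cancel_right]

theorem mul_comm_of_disjoint_support (hB : SymmNondeg B) (hU : NondegOn B U) {x y : orthGroup B}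
    (hx1 : ∀ u ∈ U, orthEnd x u ∈ U) (hx2 : ∀ u ∈ B.orthogonal U, orthEnd x u = u)
    (hy1 : ∀ u ∈ B.orthogonal U, orthEnd y u ∈ B.orthogonal U) (hy2 : ∀ u ∈ U, orthEnd y u = u) :
    x * y = y * x := by
  refine orthGroup_ext_of_nondegOn hB hU (fun u hu => ?_) fun u hu => ?_
  · rw [orthEnd_mul_apply, orthEnd_mul_apply, hy2 u hu, hy2 _ (hx1 u hu)]
  · rw [orthEnd_mul_apply, orthEnd_mul_apply, hx2 u hu, hx2 _ (hy1 u hu)]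

theorem orthExtend_mem (hB : SymmNondeg B) (hU : NondegOn B U) (a : orthGroup (B.restrict U))
    {u : V} (hu : u ∈ U) : orthEnd (orthExtend hB hU a) u ∈ U := by
  rw [orthExtend_apply hB hU a ⟨u, hu⟩]
  exact (orthEnd a ⟨u, hu⟩).2

theorem exists_orth_swap (hB : SymmNondeg B) (hU : NondegOn B U) {s₀ : orthGroup B}
    (h1 : ∀ u ∈ U, orthEnd s₀ u ∈ B.orthogonal U)
    (h2 : ∀ u ∈ B.orthogonal U, orthEnd s₀⁻¹ u ∈ U) :
    ∃ s : orthGroup B, s * s = 1 ∧ (∀ u ∈ U, orthEnd s u ∈ B.orthogonal U) ∧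
      ∀ u ∈ B.orthogonal U, orthEnd s u ∈ U := by
  have hc := hB.isCompl hU
  have horth : ∀ a ∈ U, ∀ b ∈ B.orthogonal U, B a b = 0 ∧ B b a = 0 := fun a ha b hb =>
    ⟨by rw [hB.1]; exact hB.mem_orthogonal.1 hb a ha, hB.mem_orthogonal.1 hb a ha⟩
  let s : Module.End F V := LinearMap.ofIsCompl hc (orthEnd s₀ ∘ₗ U.subtype)
    (orthEnd s₀⁻¹ ∘ₗ (B.orthogonal U).subtype)
  have hs1 : ∀ u ∈ U, s u = orthEnd s₀ u := fun u hu => LinearMap.ofIsCompl_apply_left hc ⟨u, hu⟩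
  have hs2 : ∀ u ∈ B.orthogonal U, s u = orthEnd s₀⁻¹ u := fun u hu =>
    LinearMap.ofIsCompl_apply_right hc ⟨u, hu⟩
  have his : IsIsom B s := by
    intro v w
    obtain ⟨a, ha, b, hb, rfl⟩ := Submodule.mem_sup.1
      (hc.sup_eq_top ▸ Submodule.mem_top : v ∈ U ⊔ B.orthogonal U)
    obtain ⟨c, hc', d, hd, rfl⟩ := Submodule.mem_sup.1
      (hc.sup_eq_top ▸ Submodule.mem_top : w ∈ U ⊔ B.orthogonal U)
    have e1 : B (orthEnd s₀ a) (orthEnd s₀ c) = B a c := s₀.2 a c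
    have e2 : B (orthEnd s₀⁻¹ b) (orthEnd s₀⁻¹ d) = B b d := (s₀⁻¹).2 b d
    simp only [map_add, LinearMap.add_apply, hs1 a ha, hs1 c hc', hs2 b hb, hs2 d hd, e1, e2,
      (horth a ha d hd).1, (horth c hc' b hb).2, (horth _ (h2 b hb) _ (h1 c hc')).1,
      (horth _ (h2 d hd) _ (h1 a ha)).2]
  refine ⟨his.toOrth hB, orthGroup_ext_of_nondegOn hB hU (fun u hu => ?_) fun u hu => ?_, ?_, ?_⟩
  · rw [orthEnd_mul_apply, his.orthEnd_toOrth hB, his.orthEnd_toOrth hB, hs1 u hu,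
      hs2 _ (h1 u hu), orthEnd_inv_apply_self]; rfl
  · rw [orthEnd_mul_apply, his.orthEnd_toOrth hB, his.orthEnd_toOrth hB, hs2 u hu,
      hs1 _ (h2 u hu), orthEnd_apply_inv_self]; rfl
  · intro u hu
    rw [his.orthEnd_toOrth hB, hs1 u hu]; exact h1 u hu
  · intro u hu
    rw [his.orthEnd_toOrth hB, hs2 u hu]; exact h2 u hu

theorem NonnegFS.signedCentralizer [Finite F] (hB : SymmNondeg B) (h2 : (2 : F) ≠ 0)
    {a : orthGroup B} (ha : a * a = 1) (ha1 : a ≠ 1) (haz : a ≠ negOne hB)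
    (ih : ∀ U : Submodule F V, NondegOn B U → U ≠ ⊤ → NonnegFS (orthGroup (B.restrict U))) :
    NonnegFS (signedCentralizer (negOne hB) (negOne_comm hB) (negOne_mul_self hB) a) := by
  set K := _root_.signedCentralizer (negOne hB) (negOne_comm hB) (negOne_mul_self hB) a with hK
  obtain ⟨hU, hmem⟩ := fixedSpace_of_involution hB h2 ha
  set U := fixedSpace a with hUdef
  have hUT : U ≠ ⊤ := fun h => ha1 (orthGroup_ext fun v => mem_fixedSpace.1
    (show v ∈ fixedSpace a by rw [← hUdef, h]; exact Submodule.mem_top))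
  have hWT : B.orthogonal U ≠ ⊤ := fun h => haz (orthGroup_ext fun v => (hmem v).1
    (by rw [h]; exact Submodule.mem_top))
  have hcomm1 : ∀ k, k * a = a * k → ∀ u ∈ U, orthEnd k u ∈ U := by
    intro k hk u hu
    rw [hUdef, mem_fixedSpace] at hu ⊢
    rw [← orthEnd_mul_apply, ← hk, orthEnd_mul_apply, hu]
  have hcomm2 : ∀ k, k * a = a * k → ∀ u ∈ B.orthogonal U, orthEnd k u ∈ B.orthogonal U := by
    intro k hk u hu
    rw [hmem] at hu ⊢
    rw [← orthEnd_mul_apply, ← hk, orthEnd_mul_apply, hu, map_neg]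
  have hcomm3 : ∀ k : orthGroup B, (∀ u ∈ U, orthEnd k u ∈ U) →
      (∀ u ∈ B.orthogonal U, orthEnd k u ∈ B.orthogonal U) → k * a = a * k := by
    intro k h1 h3
    refine orthGroup_ext_of_nondegOn hB hU (fun u hu => ?_) fun u hu => ?_
    · rw [orthEnd_mul_apply, orthEnd_mul_apply, mem_fixedSpace.1 (h1 u hu), mem_fixedSpace.1 hu]
    · rw [orthEnd_mul_apply, orthEnd_mul_apply, (hmem _).1 (h3 u hu), (hmem u).1 hu, map_neg]
  by_cases hall : ∀ k ∈ K, k * a = a * k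
  · have hW := hB.nondegOn_orthogonal hU
    have hcc : ∀ x y, Commute (orthExtend hB hU x) (orthExtend hB hW y) := fun x y =>
      mul_comm_of_disjoint_support hB hU (fun u hu => orthExtend_mem hB hU x hu)
        (fun u hu => orthExtend_apply_orthogonal hB hU x hu)
        (fun u hu => orthExtend_mem hB hW y hu)
        fun u hu => orthExtend_apply_orthogonal hB hW y (hB.le_orthogonal_orthogonal hu)
    let f := (orthExtend hB hU).noncommCoprod (orthExtend hB hW) hcc
    have hf : ∀ p, f p = orthExtend hB hU p.1 * orthExtend hB hW p.2 := fun p => rfl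
    have hfK : ∀ p, f p ∈ K := by
      intro p
      left
      rw [hf]
      apply hcomm3
      · intro u hu
        rw [orthEnd_mul_apply, orthExtend_apply_orthogonal hB hW _ (hB.le_orthogonal_orthogonal hu)]
        exact orthExtend_mem hB hU _ hu
      · intro u hu
        rw [orthEnd_mul_apply,
          orthExtend_apply_orthogonal hB hU _ (orthExtend_mem hB hW p.2 hu)]
        exact orthExtend_mem hB hW p.2 hu
    refine NonnegFS.of_surjective (NonnegFS.prod (ih U hU hUT) (ih _ hW hWT))
      (f.codRestrict K hfK) ?_
    rintro ⟨k, hk⟩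
    have hk' := hall k hk
    refine ⟨(orthRestrict hB hU k (hcomm1 k hk'), orthRestrict hB hW k (hcomm2 k hk')),
      Subtype.ext ?_⟩
    refine orthGroup_ext_of_nondegOn hB hU (fun u hu => ?_) fun u hu => ?_
    · change orthEnd (f _) u = orthEnd k u
      rw [hf, orthEnd_mul_apply,
        orthExtend_apply_orthogonal hB hW _ (hB.le_orthogonal_orthogonal hu)]
      exact orthExtend_apply hB hU _ ⟨u, hu⟩
    · change orthEnd (f _) u = orthEnd k u
      rw [hf, orthEnd_mul_apply,
        orthExtend_apply_orthogonal hB hU _ (orthExtend_mem hB hW _ hu)]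
      exact orthExtend_apply hB hW _ ⟨u, hu⟩
  · push Not at hall
    obtain ⟨s₀, hs₀, hs₀'⟩ := hall
    have hs1 : ∀ s : orthGroup B, s * a = negOne hB * (a * s) →
        (∀ u ∈ U, orthEnd s u ∈ B.orthogonal U) ∧ ∀ u ∈ B.orthogonal U, orthEnd s u ∈ U := by
      intro s hs
      have h3 : ∀ u, orthEnd a (orthEnd s u) = -orthEnd s (orthEnd a u) := by
        intro u
        have := congrArg (fun g => orthEnd g u) hs
        simp only [orthEnd_mul_apply, orthEnd_negOne] at this
        rw [this, neg_neg]
      refine ⟨fun u hu => ?_, fun u hu => ?_⟩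
      · rw [hmem, h3, mem_fixedSpace.1 hu]
      · rw [hUdef, mem_fixedSpace, h3, (hmem u).1 hu, map_neg, neg_neg]
    have hs₀i : s₀⁻¹ * a = negOne hB * (a * s₀⁻¹) := by
      rcases K.inv_mem hs₀ with h | h
      · exfalso
        apply hs₀'
        have h3 := congrArg (fun x => s₀ * x * s₀) h
        simp only [← mul_assoc, mul_inv_cancel, one_mul] at h3
        rw [inv_mul_cancel_right] at h3
        exact h3.symm
      · exact h
    obtain ⟨s, hss, hsU, hsW⟩ := exists_orth_swap hB hU (hs1 s₀ (hs₀.resolve_left hs₀')).1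
      (hs1 _ hs₀i).2
    have hsi : s⁻¹ = s := inv_eq_of_mul_eq_one_right hss
    have hsK' : s * a = negOne hB * (a * s) := by
      refine orthGroup_ext_of_nondegOn hB hU (fun u hu => ?_) fun u hu => ?_
      · simp only [orthEnd_mul_apply, orthEnd_negOne]
        rw [(hmem _).1 (hsU u hu), mem_fixedSpace.1 hu, neg_neg]
      · simp only [orthEnd_mul_apply, orthEnd_negOne]
        rw [mem_fixedSpace.1 (hsW u hu), (hmem u).1 hu, map_neg]
    have hsK : s ∈ K := Or.inr hsK'
    have hss' : ∀ v, orthEnd s (orthEnd s v) = v := fun v => by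
      rw [← orthEnd_mul_apply, hss]; rfl
    have hconjU : ∀ x, ∀ u ∈ U, orthEnd (s * orthExtend hB hU x * s⁻¹) u = u := by
      intro x u hu
      rw [hsi, orthEnd_mul_apply, orthEnd_mul_apply,
        orthExtend_apply_orthogonal hB hU x (hsU u hu), hss']
    have hconjW : ∀ x, ∀ u ∈ B.orthogonal U,
        orthEnd (s * orthExtend hB hU x * s⁻¹) u ∈ B.orthogonal U := by
      intro x u hu
      rw [hsi, orthEnd_mul_apply, orthEnd_mul_apply]
      exact hsU _ (orthExtend_mem hB hU x (hsW u hu))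
    have hcc : ∀ x y, Commute (orthExtend hB hU x)
        (((MulAut.conj s).toMonoidHom.comp (orthExtend hB hU)) y) := fun x y =>
      mul_comm_of_disjoint_support hB hU (fun u hu => orthExtend_mem hB hU x hu)
        (fun u hu => orthExtend_apply_orthogonal hB hU x hu) (hconjW y) (hconjU y)
    let f := (orthExtend hB hU).noncommCoprod _ hcc
    have hf : ∀ p, f p = orthExtend hB hU p.1 * (s * orthExtend hB hU p.2 * s⁻¹) := fun p => rfl
    have hfK : ∀ p, f p ∈ K := by
      intro p
      left
      rw [hf]
      apply hcomm3
      · intro u hu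
        rw [orthEnd_mul_apply, hconjU _ u hu]
        exact orthExtend_mem hB hU _ hu
      · intro u hu
        rw [orthEnd_mul_apply, orthExtend_apply_orthogonal hB hU _ (hconjW _ u hu)]
        exact hconjW _ u hu
    have hrange : ∀ k (hk : k ∈ K), k * a = a * k →
        (⟨k, hk⟩ : K) ∈ (f.codRestrict K hfK).range := by
      intro k hk hka
      have h3 : ∀ u ∈ U, orthEnd (s * k * s) u ∈ U := fun u hu => hsW _ (hcomm2 k hka _ (hsU u hu))
      refine ⟨(orthRestrict hB hU k (hcomm1 k hka), orthRestrict hB hU (s * k * s) h3),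
        Subtype.ext ?_⟩
      refine orthGroup_ext_of_nondegOn hB hU (fun u hu => ?_) fun u hu => ?_
      · change orthEnd (f _) u = orthEnd k u
        rw [hf, orthEnd_mul_apply, hconjU _ u hu]
        exact orthExtend_apply hB hU _ ⟨u, hu⟩
      · change orthEnd (f _) u = orthEnd k u
        rw [hf, orthEnd_mul_apply, orthExtend_apply_orthogonal hB hU _ (hconjW _ u hu), hsi,
          orthEnd_mul_apply, orthEnd_mul_apply, orthExtend_apply hB hU _ ⟨_, hsW u hu⟩,
          orthRestrict_apply, orthEnd_mul_apply, orthEnd_mul_apply, hss', hss']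
    refine NonnegFS.of_swap (ih U hU hUT) (f.codRestrict K hfK) ⟨s, hsK⟩ ?_ ?_
    · intro x y
      refine Subtype.ext ?_
      change s * f (x, y) * s = f (y, x)
      have e : orthExtend hB hU y * (s * orthExtend hB hU x * s⁻¹) =
        s * orthExtend hB hU x * s⁻¹ * orthExtend hB hU y := (hcc y x).eq
      rw [hf, hf]
      change s * (orthExtend hB hU x * (s * orthExtend hB hU y * s⁻¹)) * s =
        orthExtend hB hU y * (s * orthExtend hB hU x * s⁻¹)
      rw [e]
      simp only [hsi, mul_assoc, hss, mul_one]
    · rintro ⟨k, hk⟩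
      by_cases hka : k * a = a * k
      · exact Or.inl (hrange k hk hka)
      · right
        refine hrange (s⁻¹ * k) (K.mul_mem (K.inv_mem hsK) hk) ?_
        have hk' := Or.resolve_left hk hka
        rw [hsi, mul_assoc, hk', ← mul_assoc, negOne_comm, mul_assoc, ← mul_assoc s, hsK',
          ← mul_assoc, ← mul_assoc, negOne_mul_self, one_mul, mul_assoc]

end SignedCentralizer

section CyclicCentralizer

open Polynomial

variable {F : Type} [Field F] {V : Type} [AddCommGroup V] [Module F V]
  {B : LinearMap.BilinForm F V}

/-- The self-adjoint endomorphism `g + g⁻¹`. -/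
def orthTrace (g : orthGroup B) : Module.End F V := orthEnd g + orthEnd g⁻¹

theorem orthTrace_selfAdj (g : orthGroup B) : SelfAdj B (orthTrace g) := by
  intro v w
  have h : ∀ (k : orthGroup B) v w, B (orthEnd k v) w = B v (orthEnd k⁻¹ w) := fun k v w => by
    rw [← orthEnd_isIsom k v, orthEnd_apply_inv_self]
  simp only [orthTrace, LinearMap.add_apply, map_add, h g, h g⁻¹, inv_inv]
  abel

theorem commute_orthTrace {g h : orthGroup B} (H : h * g = g * h) :
    Commute (orthTrace g) (orthEnd h) := by
  have h1 : orthEnd g * orthEnd h = orthEnd h * orthEnd g := by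
    rw [← orthEnd_mul, ← orthEnd_mul, H]
  have h2 : orthEnd g⁻¹ * orthEnd h = orthEnd h * orthEnd g⁻¹ := by
    rw [← orthEnd_mul, ← orthEnd_mul]
    congr 1
    rw [inv_mul_eq_iff_eq_mul, ← mul_assoc, ← H,
      mul_inv_cancel_right]
  rw [commute_iff_eq, orthTrace, add_mul, mul_add, h1, h2]

theorem exists_aeval_orthTrace (g : orthGroup B) (n : ℕ) :
    ∃ c : F[X], orthEnd (g ^ n) + orthEnd (g ^ n)⁻¹ = aeval (orthTrace g) c := by
  induction n using Nat.twoStepInduction with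
  | zero => exact ⟨2, by rw [pow_zero, inv_one, map_ofNat]; exact one_add_one_eq_two⟩
  | one => exact ⟨X, by rw [pow_one, aeval_X]; rfl⟩
  | more n h1 h2 =>
    obtain ⟨c1, h1⟩ := h1
    obtain ⟨c2, h2⟩ := h2
    refine ⟨X * c2 - c1, ?_⟩
    rw [map_sub, map_mul, aeval_X, ← h1, ← h2, orthTrace, add_mul, mul_add, mul_add]
    simp only [← orthEnd_mul]
    rw [show g * g ^ (n + 1) = g ^ (n + 2) by group, show g * (g ^ (n + 1))⁻¹ = (g ^ n)⁻¹ by group,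
      show g⁻¹ * g ^ (n + 1) = g ^ n by group, show g⁻¹ * (g ^ (n + 1))⁻¹ = (g ^ (n + 2))⁻¹ by group]
    abel

variable [FiniteDimensional F V]

theorem orthEnd_eq_of_commute [Finite F] [Nontrivial V] (hB : SymmNondeg B) (h2 : (2 : F) ≠ 0)
    {g i : orthGroup B} (hI : Indec B (orthEnd g)) (hi : i * i = negOne hB)
    (hig : i ∈ Subgroup.zpowers g) {h : orthGroup B} (hh : h * g = g * h) :
    ∃ p q : F[X],
      orthEnd h = aeval (orthTrace g) p + orthEnd i * aeval (orthTrace g) q := by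
  obtain ⟨n, rfl⟩ := mem_powers_iff_mem_zpowers.2 hig
  simp only at hi
  set i := g ^ n with hidef
  set y := orthTrace g with hy
  set I := orthEnd i with hIdef
  have hII : I * I = -1 := by
    rw [hIdef, ← orthEnd_mul, hi]; rfl
  have hgi : g * i = i * g := by rw [hidef, ← pow_succ, ← pow_succ']
  have hyI : Commute y I := commute_orthTrace hgi.symm
  have hIy := fun p : F[X] => (commute_aeval hyI p).eq
  have hIs : SkewAdj B I := by
    intro v w
    rw [← orthEnd_isIsom i (I v) w, ← Module.End.mul_apply I I, hII]
    simp [hIdef]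
  have hinj : Function.Injective I := (orthEnd_isIsom i).injective hB
  obtain ⟨π, k, hπ, hk, hk'⟩ := exists_irreducible_pow_aeval_eq_zero hB hI (orthTrace_selfAdj g)
    (commute_orthTrace rfl)
  obtain ⟨v, hv⟩ := ((orthTrace_selfAdj g).aeval (π ^ k)).exists_ne_zero hB h2 hk'
  obtain ⟨c, hc⟩ := exists_aeval_orthTrace g (n + 1)
  have hg2 : (2 : F) • orthEnd g = y - I * aeval y c := by
    have h3 : orthEnd (g ^ (n + 1))⁻¹ = -(I * orthEnd g⁻¹) := by
      have h5 : i⁻¹ = negOne hB * i := by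
        rw [inv_eq_iff_mul_eq_one, ← mul_assoc, negOne_comm, mul_assoc, hi, negOne_mul_self]
      have h4 : (g ^ (n + 1))⁻¹ = negOne hB * (i * g⁻¹) := by
        rw [pow_succ', _root_.mul_inv_rev, ← hidef, h5, mul_assoc]
      rw [h4]
      rfl
    rw [← hc, h3, pow_succ, orthEnd_mul, mul_add, ← mul_assoc, mul_neg, ← mul_assoc, hII, hy,
      orthTrace, two_smul]
    simp
  have hg : orthEnd g = (2 : F)⁻¹ • (y - I * aeval y c) := by
    rw [← hg2, smul_smul, inv_mul_cancel₀ h2, one_smul]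
  have hst : ∀ p : F[X] × F[X], orthEnd g (cycMap y I v p) =
      cycMap y I v (C (2 : F)⁻¹ * (X * p.1 + c * p.2), C (2 : F)⁻¹ * (X * p.2 - c * p.1)) := by
    intro p
    have e1 : ∀ w, I (I w) = -w := fun w => by
      rw [← Module.End.mul_apply, hII]; rfl
    have e2 : ∀ (p : F[X]) w, aeval y p (I w) = I (aeval y p w) := fun p w => by
      rw [← Module.End.mul_apply, hIy]; rfl
    have e3 : ∀ w, y (I w) = I (y w) := fun w => by
      rw [← Module.End.mul_apply, hyI.eq]; rfl
    rw [hg]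
    simp only [cycMap_apply, LinearMap.smul_apply, LinearMap.sub_apply, Module.End.mul_apply,
      map_add, map_mul, map_sub, aeval_X, aeval_C, LinearMap.add_apply, e1, e2, e3,
      Module.algebraMap_end_apply, map_smul, smul_sub, smul_neg]
    abel
  have hsurj := hI.surjective (cycMap y I v) (fun p => ⟨_, hst p⟩)
    (nondegOn_range_cycMap hB h2 (orthTrace_selfAdj g) hIs hyI (d := C (-1))
      (by rw [hII]; simp) hinj hπ hk hv) (1, 0) (by
      intro h
      apply hv
      have : v = 0 := by simpa [cycMap_apply] using h
      rw [this, map_zero, LinearMap.zero_apply])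
  obtain ⟨⟨p, q⟩, hpq⟩ := hsurj (orthEnd h v)
  refine ⟨p, q, LinearMap.ext fun w => ?_⟩
  obtain ⟨⟨r, s⟩, rfl⟩ := hsurj w
  have hhi : h * i = i * h := ((show Commute h g from hh).pow_right n).eq
  have e0 : ∀ (r : F[X]) w, orthEnd h (aeval y r w) = aeval y r (orthEnd h w) := fun r w => by
    rw [← Module.End.mul_apply, ← (commute_aeval (commute_orthTrace hh) r).eq]; rfl
  have e1 : ∀ w, orthEnd h (I w) = I (orthEnd h w) := fun w => by
    rw [hIdef, ← orthEnd_mul_apply, hhi]; rfl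
  have e2 : ∀ (p : F[X]) w, aeval y p (I w) = I (aeval y p w) := fun p w => by
    rw [← Module.End.mul_apply, hIy]; rfl
  simp only [cycMap_apply, map_add, e0, e1, ← hpq, LinearMap.add_apply, Module.End.mul_apply, e2,
    aeval_apply_apply, mul_comm r, mul_comm s]

theorem mul_comm_of_commute [Finite F] [Nontrivial V] (hB : SymmNondeg B) (h2 : (2 : F) ≠ 0)
    {g i : orthGroup B} (hI : Indec B (orthEnd g)) (hi : i * i = negOne hB)
    (hig : i ∈ Subgroup.zpowers g) {h k : orthGroup B} (hh : h * g = g * h) (hk : k * g = g * k) :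
    h * k = k * h := by
  obtain ⟨p, q, hpq⟩ := orthEnd_eq_of_commute hB h2 hI hi hig hh
  have hik : k * i = i * k := by
    obtain ⟨n, rfl⟩ := hig
    exact ((show Commute k g from hk).zpow_right n).eq
  have h3 : Commute (orthEnd h) (orthEnd k) := by
    rw [hpq]
    refine (commute_aeval (commute_orthTrace hk) p).add_left
      (Commute.mul_left ?_ (commute_aeval (commute_orthTrace hk) q))
    rw [commute_iff_eq, ← orthEnd_mul, ← orthEnd_mul, hik]
  exact orthGroup_ext fun v => LinearMap.congr_fun h3.eq v

theorem conj_eq_inv_of_commute [Finite F] [Nontrivial V] (hB : SymmNondeg B) (h2 : (2 : F) ≠ 0)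
    {g i : orthGroup B} (hI : Indec B (orthEnd g)) (hi : i * i = negOne hB)
    (hig : i ∈ Subgroup.zpowers g) {h t : orthGroup B} (hh : h * g = g * h) (htt : t * t = 1)
    (ht : t * g * t = g⁻¹) : t * h * t = h⁻¹ := by
  obtain ⟨p, q, hpq⟩ := orthEnd_eq_of_commute hB h2 hI hi hig hh
  have htinv : t⁻¹ = t := inv_eq_of_mul_eq_one_right htt
  have hti : t * i * t = i⁻¹ := by
    obtain ⟨n, rfl⟩ := hig
    have := conj_zpow (a := t) (b := g) (i := n)
    rw [htinv, ht, _root_.inv_zpow] at this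
    exact this.symm
  have hii : i⁻¹ = negOne hB * i := by
    rw [inv_eq_iff_mul_eq_one, ← mul_assoc, negOne_comm, mul_assoc, hi, negOne_mul_self]
  set y := orthTrace g with hy
  set I := orthEnd i with hIdef
  set T := orthEnd t with hT
  have hTT : T * T = 1 := by rw [hT, ← orthEnd_mul, htt]; rfl
  have hTI : T * I = -(I * T) := by
    have : t * i = negOne hB * (i * t) := by
      rw [← mul_assoc, ← hii, ← hti, mul_assoc, htt, mul_one]
    rw [hT, hIdef, ← orthEnd_mul, this]; rfl
  have hTy : Commute y T := by
    have h3 : T * orthEnd g = orthEnd g⁻¹ * T := by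
      rw [hT, ← orthEnd_mul, ← orthEnd_mul, ← ht, mul_assoc _ t t, htt, mul_one]
    have h4 : T * orthEnd g⁻¹ = orthEnd g * T := by
      rw [hT, ← orthEnd_mul, ← orthEnd_mul, ← ht, ← mul_assoc, ← mul_assoc, htt, one_mul]
    rw [commute_iff_eq, hy, orthTrace, add_mul, mul_add, h3, h4, add_comm]
  have hig' : i * g = g * i := by
    obtain ⟨n, rfl⟩ := hig
    exact ((Commute.refl g).zpow_left n).eq
  have hyI : Commute y I := commute_orthTrace hig'
  have hIs : ∀ v w, B (I v) w = -B v (I w) := by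
    intro v w
    have hII : I * I = -1 := by rw [hIdef, ← orthEnd_mul, hi]; rfl
    rw [← orthEnd_isIsom i (I v) w, ← Module.End.mul_apply I I, hII]
    simp [hIdef]
  have hadj : ∀ v w, B (orthEnd h v) w = B v ((aeval y p - I * aeval y q) w) := by
    intro v w
    have e1 := (orthTrace_selfAdj g).aeval p v w
    have e2 := (orthTrace_selfAdj g).aeval q v (I w)
    have e3 := hIs (aeval y q v) w
    have e4 := LinearMap.congr_fun (commute_aeval hyI q).eq w
    simp only [Module.End.mul_apply] at e4
    rw [hpq, LinearMap.add_apply, LinearMap.sub_apply, map_add, LinearMap.add_apply, map_sub,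
      Module.End.mul_apply, Module.End.mul_apply, e1, e3, e2, e4, sub_eq_add_neg]
  have hconj : T * orthEnd h * T = aeval y p - I * aeval y q := by
    rw [hpq, mul_add, add_mul, ← (commute_aeval hTy p).eq, mul_assoc _ T T, hTT, mul_one,
      ← mul_assoc, hTI, neg_mul, neg_mul, mul_assoc I, ← (commute_aeval hTy q).eq, mul_assoc I,
      mul_assoc _ T T, hTT, mul_one, sub_eq_add_neg]
  rw [eq_inv_iff_mul_eq_one]
  apply orthGroup_ext
  intro w
  have h5 : ∀ v, B v (orthEnd (t * h * t * h) w) = B v w := by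
    intro v
    rw [orthEnd_mul_apply, orthEnd_mul, orthEnd_mul, hconj, ← hadj]
    exact orthEnd_isIsom h v w
  rw [← sub_eq_zero]
  apply hB.2
  intro v
  rw [hB.1, map_sub, h5, orthEnd_one_apply, sub_self]

end CyclicCentralizer

section SylowLemmas

variable {G : Type} [Group G] [Finite G]

/-- If the central involution `z` is, in each Sylow `2`-subgroup, the only nontrivial involution
commuting with the subgroup up to `z`, and a Sylow `2`-subgroup has a cyclic subgroup `⟨a⟩` of
index two containing `z`, then `⟨a⟩` commutes with no further involution. -/
theorem eq_one_or_eq_of_commute_of_sylow {z : G}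
    (hP : ∀ S : Sylow 2 G, ∀ j ∈ S, j * j = 1 → (∀ s ∈ S, s * j = j * s) → j = 1 ∨ j = z)
    (S : Sylow 2 G) {a b j : G} (haS : a ∈ S) (hza : z ∈ Subgroup.zpowers a) (hz1 : z ≠ 1)
    (hzz : z * z = 1)
    (hS : ∀ s ∈ S, s ∈ Subgroup.zpowers a ∨ b⁻¹ * s ∈ Subgroup.zpowers a) (hj : j * j = 1)
    (hja : j * a = a * j) : j = 1 ∨ j = z := by
  have hjA : ∀ n ∈ Subgroup.zpowers a, j * n = n * j := by
    rintro _ ⟨k, rfl⟩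
    exact ((show Commute j a from hja).zpow_right k).eq
  have hpow : ∀ n ∈ Subgroup.zpowers a, ∃ k, n ^ 2 ^ k = 1 := by
    intro n hn
    obtain ⟨k, hk⟩ := S.isPGroup' ⟨n, (Subgroup.zpowers_le.2 haS) hn⟩
    exact ⟨k, congrArg Subtype.val hk⟩
  by_cases hjm : j ∈ Subgroup.zpowers a
  · have : Fact (Nat.Prime 2) := ⟨Nat.prime_two⟩
    obtain ⟨k, hk⟩ := IsPGroup.iff_orderOf.mp S.isPGroup' ⟨a, haS⟩
    rw [Subgroup.orderOf_mk] at hk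
    exact eq_one_or_eq_of_mul_self hk hza hz1 hzz hjm hj
  · let T := extendBy (Subgroup.zpowers a) j
      (fun n hn => by rw [hjA n hn, mul_inv_cancel_right]; exact hn)
      (by rw [hj]; exact Subgroup.one_mem _)
    have hjT : ∀ s ∈ T, s * j = j * s := by
      rintro s (hs | hs)
      · exact (hjA s hs).symm
      · have := hjA _ hs
        rw [mul_assoc, eq_inv_mul_iff_mul_eq, mul_inv_cancel_left] at this
        exact this.symm
    have hTp : IsPGroup 2 T := by
      rintro ⟨s, hs⟩
      have key : ∃ k, s ^ 2 ^ k = 1 := by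
        have hs' : s ∈ Subgroup.zpowers a ∨ j⁻¹ * s ∈ Subgroup.zpowers a := hs
        rcases hs' with h | h
        · exact hpow s h
        · have hss : s * s ∈ Subgroup.zpowers a := by
            have h1 := Subgroup.mul_mem _ h h
            have hji : j⁻¹ = j := inv_eq_of_mul_eq_one_right hj
            rwa [hji, mul_assoc, ← mul_assoc s, hjT s hs, ← mul_assoc, ← mul_assoc, hj,
              one_mul] at h1
          obtain ⟨k, hk⟩ := hpow _ hss
          exact ⟨k + 1, by rw [pow_succ', pow_mul, pow_two, hk]⟩
      obtain ⟨k, hk⟩ := key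
      exact ⟨k, Subtype.ext hk⟩
    obtain ⟨S', hTS⟩ := hTp.exists_le_sylow
    have hcard : Nat.card S ≤ 2 * Nat.card (Subgroup.zpowers a) := by
      have hsurj := Nat.card_le_card_of_injective
        (fun s : S => if h : (s : G) ∈ Subgroup.zpowers a then
          (Sum.inl ⟨s, h⟩ : Subgroup.zpowers a ⊕ Subgroup.zpowers a)
          else Sum.inr ⟨b⁻¹ * s, (hS s s.2).resolve_left h⟩) (by
          intro s s' h
          simp only at h
          split_ifs at h with h1 h2 h2
          · exact Subtype.ext (Subtype.mk.inj (Sum.inl.inj h))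
          · exact Subtype.ext (mul_left_cancel (Subtype.mk.inj (Sum.inr.inj h))))
      rwa [Nat.card_sum, ← two_mul] at hsurj
    have hcard2 : 2 * Nat.card (Subgroup.zpowers a) ≤ Nat.card T := by
      have hlt : Subgroup.zpowers a < T :=
        lt_of_le_of_ne le_extendBy fun h => hjm (h ▸ self_mem_extendBy)
      obtain ⟨c, hc⟩ := Subgroup.card_dvd_of_le hlt.le
      have hT0 : 0 < Nat.card T := Nat.card_pos
      have hne : Nat.card (Subgroup.zpowers a) ≠ Nat.card T := fun h =>
        hlt.ne (Subgroup.eq_of_le_of_card_ge hlt.le h.ge)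
      rcases c with _ | _ | c
      · omega
      · omega
      · rw [hc]; nlinarith
    have hSS : Nat.card S' = Nat.card S := by
      rw [S.card_eq_multiplicity, S'.card_eq_multiplicity]
    have hTS' : T = S' := Subgroup.eq_of_le_of_card_ge hTS (by omega)
    have hmem : ∀ s, s ∈ S' ↔ s ∈ T := fun s => by
      change s ∈ (S' : Subgroup G) ↔ _
      rw [hTS']
    exact hP S' j ((hmem j).2 self_mem_extendBy) hj fun s hs => hjT s ((hmem s).1 hs)

omit [Finite G] in
theorem mem_sylow_of_central {z : G} (hz : ∀ g, g * z = z * g) (hzz : z * z = 1) (S : Sylow 2 G) :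
    z ∈ S := by
  have hn : (Subgroup.zpowers z).Normal := by
    refine ⟨fun n hn g => ?_⟩
    obtain ⟨k, rfl⟩ := hn
    have : g * z ^ k = z ^ k * g := ((show Commute g z from hz g).zpow_right k).eq
    simp only
    rw [this, mul_inv_cancel_right]
    exact ⟨k, rfl⟩
  have hp : IsPGroup 2 (Subgroup.zpowers z) := by
    rintro ⟨_, k, rfl⟩
    refine ⟨1, Subtype.ext ?_⟩
    change (z ^ k) ^ (2 ^ 1) = 1
    rw [← zpow_natCast, ← _root_.zpow_mul, mul_comm, _root_.zpow_mul, zpow_natCast, pow_one,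
      pow_two, hzz, _root_.one_zpow]
  exact hp.le_sylow_of_normal S (Subgroup.mem_zpowers z)

end SylowLemmas

section OrthogonalSylow

variable {F : Type} [Field F] {V : Type} [AddCommGroup V] [Module F V] [FiniteDimensional F V]
  {B : LinearMap.BilinForm F V}

theorem exists_inverting_commute (hB : SymmNondeg B) (h2 : (2 : F) ≠ 0) {a x : orthGroup B}
    (ha : a * a = 1) (hax : x * a = a * x) :
    ∃ k : orthGroup B, k * a = a * k ∧ k * x * k⁻¹ = x⁻¹ := by
  obtain ⟨hU, hmem⟩ := fixedSpace_of_involution hB h2 ha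
  set U := fixedSpace a with hUdef
  have hx1 : ∀ u ∈ U, orthEnd x u ∈ U := by
    intro u hu
    rw [hUdef, mem_fixedSpace] at hu ⊢
    rw [← orthEnd_mul_apply, ← hax, orthEnd_mul_apply, hu]
  have hx2 : ∀ u ∈ B.orthogonal U, orthEnd x u ∈ B.orthogonal U := by
    intro u hu
    rw [hmem] at hu ⊢
    rw [← orthEnd_mul_apply, ← hax, orthEnd_mul_apply, hu, map_neg]
  have hW := hB.nondegOn_orthogonal hU
  obtain ⟨t₁, h11, h12⟩ := exists_orth_involution (hB.restrict hU) h2 (orthRestrict hB hU x hx1)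
  obtain ⟨t₂, h21, h22⟩ := exists_orth_involution (hB.restrict hW) h2 (orthRestrict hB hW x hx2)
  obtain ⟨t, ht, e1, e2⟩ := hB.exists_glue hU (orthEnd_isIsom t₁) (orthEnd_isIsom t₂)
  let k := ht.toOrth hB
  have f1 : ∀ u (hu : u ∈ U), orthEnd k u = orthEnd t₁ ⟨u, hu⟩ := fun u hu => e1 ⟨u, hu⟩
  have f2 : ∀ u (hu : u ∈ B.orthogonal U), orthEnd k u = orthEnd t₂ ⟨u, hu⟩ :=
    fun u hu => e2 ⟨u, hu⟩
  have key : ∀ {H : Type} [Group H] (s y : H), s * s = 1 → s * y * s = y⁻¹ → y * (s * y) = s := by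
    intro H _ s y hs hsy
    rw [← mul_left_cancel_iff (a := y⁻¹), inv_mul_cancel_left, ← hsy, mul_assoc, hs, mul_one]
  have g1 := key _ _ h11 h12
  have g2 := key _ _ h21 h22
  refine ⟨k, orthGroup_ext_of_nondegOn hB hU (fun u hu => ?_) fun u hu => ?_, ?_⟩
  · rw [orthEnd_mul_apply, orthEnd_mul_apply, mem_fixedSpace.1 hu, f1 u hu]
    exact (mem_fixedSpace.1 (show (orthEnd t₁ ⟨u, hu⟩ : V) ∈ U from Subtype.prop _)).symm
  · rw [orthEnd_mul_apply, orthEnd_mul_apply, (hmem u).1 hu, map_neg, f2 u hu]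
    exact ((hmem _).1 (show (orthEnd t₂ ⟨u, hu⟩ : V) ∈ B.orthogonal U from Subtype.prop _)).symm
  · have : x * (k * x) = k := by
      refine orthGroup_ext_of_nondegOn hB hU (fun u hu => ?_) fun u hu => ?_
      · rw [orthEnd_mul_apply, orthEnd_mul_apply, f1 _ (hx1 u hu), f1 u hu]
        have := congrArg (fun s : orthGroup (B.restrict U) => (orthEnd s ⟨u, hu⟩ : V)) g1
        exact this
      · rw [orthEnd_mul_apply, orthEnd_mul_apply, f2 _ (hx2 u hu), f2 u hu]
        have := congrArg (fun s : orthGroup (B.restrict (B.orthogonal U)) =>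
          (orthEnd s ⟨u, hu⟩ : V)) g2
        exact this
    rw [mul_inv_eq_iff_eq_mul, eq_inv_mul_iff_mul_eq, this]

theorem exists_commuting_involution (hB : SymmNondeg B) (h2 : (2 : F) ≠ 0) {g : orthGroup B}
    (hg : ¬ Indec B (orthEnd g)) :
    ∃ j : orthGroup B, j * j = 1 ∧ j ≠ 1 ∧ j ≠ negOne hB ∧ j * g = g * j := by
  unfold Indec at hg
  push Not at hg
  obtain ⟨U, hgU, hU, hbot, htop⟩ := hg
  have hc := hB.isCompl hU
  let j := orthExtend hB hU (negOne (hB.restrict hU))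
  have hj1 : ∀ u ∈ U, orthEnd j u = -u := fun u hu => by
    rw [orthExtend_apply hB hU _ ⟨u, hu⟩, orthEnd_negOne]; rfl
  have hj2 : ∀ u ∈ B.orthogonal U, orthEnd j u = u := fun u hu =>
    orthExtend_apply_orthogonal hB hU _ hu
  have hneg : ∀ v : V, -v = v → v = 0 := fun v hv => by
    have h3 : (2 : F) • v = 0 := by rw [two_smul]; nth_rw 1 [← hv]; simp
    exact (smul_eq_zero.1 h3).resolve_left h2
  refine ⟨j, ?_, fun h => hbot ?_, fun h => htop ?_, ?_⟩
  · rw [← map_mul, negOne_mul_self, map_one]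
  · rw [eq_bot_iff]
    intro u hu
    apply hneg
    rw [← hj1 u hu, h]; rfl
  · rw [← hc.sup_eq_top, eq_comm, sup_eq_left]
    intro u hu
    have : u = 0 := hneg u (by rw [← orthEnd_negOne hB, ← h]; exact hj2 u hu)
    rw [this]; exact U.zero_mem
  · refine orthGroup_ext_of_nondegOn hB hU (fun u hu => ?_) fun u hu => ?_
    · rw [orthEnd_mul_apply, orthEnd_mul_apply, hj1 u hu, hj1 _ (hgU u hu), map_neg]
    · rw [orthEnd_mul_apply, orthEnd_mul_apply, hj2 u hu,
        hj2 _ ((orthEnd_isIsom g).mem_orthogonal hB hgU hu)]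

end OrthogonalSylow

section OrthogonalNonneg

variable {F : Type} [Field F]

/-- The local subgroup in the case of a Sylow `2`-subgroup `S` of the centralizer of `x` with a
cyclic subgroup `⟨a⟩` of index two. -/
theorem exists_local_of_index_two [Finite F] (h2 : (2 : F) ≠ 0) {V : Type} [AddCommGroup V]
    [Module F V] [FiniteDimensional F V] [Nontrivial V] {B : LinearMap.BilinForm F V}
    (hB : SymmNondeg B) {x g i b : orthGroup B} (hI : Indec B (orthEnd g))
    (hi : i * i = negOne hB) (hig : i ∈ Subgroup.zpowers g) (hxg : x ∈ Subgroup.zpowers g)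
    (hbg : b * g * b⁻¹ ∈ Subgroup.zpowers g) (hbb : b * b ∈ Subgroup.zpowers g) :
    ∃ K : Subgroup (orthGroup B), NonnegFS K ∧ (∀ n ∈ Subgroup.zpowers g, n ∈ K) ∧ b ∈ K ∧
      ∃ k ∈ K, k * x * k⁻¹ = x⁻¹ := by
  obtain ⟨t, htt, htg⟩ := exists_orth_involution hB h2 g
  have ht : t⁻¹ = t := inv_eq_of_mul_eq_one_right htt
  have hmem : ∀ n, n ∈ Subgroup.centralizer {g} ↔ n * g = g * n := fun n => by
    rw [Subgroup.mem_centralizer_singleton_iff]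
  have hzN : ∀ n ∈ Subgroup.zpowers g, n ∈ Subgroup.centralizer {g} := by
    rintro _ ⟨k, rfl⟩
    rw [hmem]
    exact ((Commute.refl g).zpow_left k).eq
  have hinv : ∀ n ∈ Subgroup.centralizer {g}, t * n * t = n⁻¹ := fun n hn =>
    conj_eq_inv_of_commute hB h2 hI hi hig ((hmem n).1 hn) htt htg
  obtain ⟨e, he⟩ := hbg
  simp only at he
  have hbbg : b * b * g = g * (b * b) := (hmem _).1 (hzN _ hbb)
  have hcomm : ∀ n ∈ Subgroup.centralizer {g}, ∀ m ∈ Subgroup.centralizer {g}, n * m = m * n :=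
    fun n hn m hm => mul_comm_of_commute hB h2 hI hi hig ((hmem n).1 hn) ((hmem m).1 hm)
  have ht' : t ∉ Subgroup.centralizer {g} := by
    intro htN
    rw [hmem] at htN
    have hgg : g * g = 1 := by
      have h := htg
      rw [htN, mul_assoc, htt, mul_one, eq_inv_iff_mul_eq_one] at h
      exact h
    obtain ⟨k, rfl⟩ := hig
    simp only at hi
    rw [← (Commute.refl g).mul_zpow, hgg, _root_.one_zpow] at hi
    exact negOne_ne_one h2 hB hi.symm
  have hbC : ∀ β ∈ Subgroup.centralizer {g}, b⁻¹ * β * b ∈ Subgroup.centralizer {g} := by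
    intro β hβ
    rw [hmem] at hβ ⊢
    have hc : Commute β (g ^ e) := (show Commute β g from hβ).zpow_right e
    rw [he] at hc
    have := hc.eq
    calc b⁻¹ * β * b * g = b⁻¹ * (β * (b * g * b⁻¹)) * b := by group
      _ = b⁻¹ * (b * g * b⁻¹ * β) * b := by rw [this]
      _ = g * (b⁻¹ * β * b) := by group
  have htb : t * b * t * b ∈ Subgroup.centralizer {g} := by
    rw [hmem]
    let f := MulAut.conj b
    let τ := MulAut.conj t
    have hf : f g = g ^ e := he.symm
    have hff : f (f g) = g := by
      change b * (b * g * b⁻¹) * b⁻¹ = g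
      calc b * (b * g * b⁻¹) * b⁻¹ = b * b * g * (b * b)⁻¹ := by group
        _ = g := by rw [hbbg, mul_inv_cancel_right]
    have hτ : τ g = g⁻¹ := by
      change t * g * t⁻¹ = g⁻¹
      rw [ht, htg]
    have key : τ (f (τ (f g))) = g := by
      rw [hf, map_zpow, hτ, _root_.inv_zpow, ← hf, map_inv, hff, map_inv, hτ, inv_inv]
    have key' : t * b * t * b * g * (t * b * t * b)⁻¹ = g := by
      rw [← key]
      change _ = t * (b * (t * (b * _ * b⁻¹) * t⁻¹) * b⁻¹) * t⁻¹
      rw [key]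
      group
    exact mul_inv_eq_iff_eq_mul.1 key'
  obtain ⟨K, h1, h3, h4, h5⟩ := exists_nonnegFS_semidihedral (Subgroup.centralizer {g}) hcomm t htt
    hinv ht' b hbC (hzN _ hbb) htb
  refine ⟨K, h5, fun n hn => h1 (hzN n hn), h4, t, h3, ?_⟩
  rw [ht]
  exact hinv x (hzN x hxg)

theorem nonnegFS_orthGroup [Finite F] (h2 : (2 : F) ≠ 0) (n : ℕ) :
    ∀ {V : Type} [AddCommGroup V] [Module F V] [FiniteDimensional F V]
      {B : LinearMap.BilinForm F V} (_ : SymmNondeg B) (_ : Module.finrank F V = n),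
      NonnegFS (orthGroup B) := by
  induction n using Nat.strong_induction_on with
  | _ n ih =>
  intro V _ _ _ B hB hn
  rcases subsingleton_or_nontrivial V with hV | hV
  · have : Subsingleton (orthGroup B) := ⟨fun g h => orthGroup_ext fun v => Subsingleton.elim _ _⟩
    exact (NonnegFS.of_comm (⊤ : Subgroup (orthGroup B))
      fun _ _ _ _ => Subsingleton.elim _ _).of_mulEquiv Subgroup.topEquiv
  have ihU : ∀ U : Submodule F V, NondegOn B U → U ≠ ⊤ → NonnegFS (orthGroup (B.restrict U)) :=
    fun U hU hT => ih _ (hn ▸ Submodule.finrank_lt hT) (hB.restrict hU) rfl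
  refine NonnegFS.of_local fun x hx => ?_
  have : Fact (Nat.Prime 2) := ⟨Nat.prime_two⟩
  set C := Subgroup.centralizer {x} with hC
  have hCmem : ∀ c : orthGroup B, c ∈ C ↔ c * x = x * c := fun c => by
    rw [hC, Subgroup.mem_centralizer_singleton_iff]
  let z : C := ⟨negOne hB, (hCmem _).2 (negOne_comm hB x).symm⟩
  have hzc : ∀ c : C, c * z = z * c := fun c => Subtype.ext (negOne_comm hB c)
  have hzz : z * z = 1 := Subtype.ext (negOne_mul_self hB)
  have hz1 : z ≠ 1 := fun h => negOne_ne_one h2 hB (congrArg Subtype.val h)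
  by_cases h : ∃ (S : Sylow 2 C), ∃ a ∈ S, a * a = 1 ∧ a ≠ 1 ∧ a ≠ z ∧
      ∀ s ∈ S, s * a = a * s ∨ s * a = z * (a * s)
  · obtain ⟨S, a, haS, haa, ha1, haz, hS⟩ := h
    have haa' : (a : orthGroup B) * a = 1 := congrArg Subtype.val haa
    have hxa : x * (a : orthGroup B) = a * x := ((hCmem a).1 a.2).symm
    obtain ⟨k, hk1, hk2⟩ := exists_inverting_commute hB h2 haa' hxa
    refine ⟨_, NonnegFS.signedCentralizer hB h2 haa' (fun h => ha1 (Subtype.ext h))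
      (fun h => haz (Subtype.ext h)) ihU, Or.inl hxa, not_dvd_relIndex_of_sylow S fun s hs => ?_,
      k, Or.inl hk1, hk2⟩
    exact (hS s hs).imp (congrArg Subtype.val) (congrArg Subtype.val)
  push Not at h
  have hP : ∀ S : Sylow 2 C, ∀ j ∈ S, j * j = 1 → (∀ s ∈ S, s * j = j * s ∨ s * j = z * (j * s)) →
      j = 1 ∨ j = z := by
    intro S j hj hjj hs
    by_contra! hne
    obtain ⟨s, hs1, hs2, hs3⟩ := h S j hj hjj hne.1 hne.2
    exact (hs s hs1).elim hs2 hs3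
  obtain ⟨S⟩ := (inferInstance : Nonempty (Sylow 2 C))
  have hzS := mem_sylow_of_central hzc hzz S
  obtain ⟨a, hnorm, hcases⟩ := cyclic_or_index_two S.isPGroup' (z := ⟨z, hzS⟩)
    (fun h => hz1 (congrArg Subtype.val h)) (Subtype.ext hzz)
    (fun s => Subtype.ext (by
      change (s : C) * z * (s : C)⁻¹ = z
      rw [hzc, mul_inv_cancel_right])) (by
      intro j hjj hj
      refine (hP S j j.2 (congrArg Subtype.val hjj) fun s hs => ?_).imp
        (fun h => Subtype.ext h) (fun h => Subtype.ext h)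
      refine (hj ⟨s, hs⟩).imp (fun h => ?_) fun h => ?_
      · have : s * (j : C) * s⁻¹ = j := congrArg Subtype.val h
        rwa [mul_inv_eq_iff_eq_mul] at this
      · have : s * (j : C) * s⁻¹ = j * z := congrArg Subtype.val h
        rwa [mul_inv_eq_iff_eq_mul, hzc, mul_assoc] at this)
  have hval : ∀ s : S, s ∈ Subgroup.zpowers a →
      ((s : C) : orthGroup B) ∈ Subgroup.zpowers ((a : C) : orthGroup B) := by
    rintro _ ⟨k, rfl⟩
    exact ⟨k, rfl⟩
  set a' : orthGroup B := ((a : C) : orthGroup B) with ha'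
  have hax : Commute x a' := ((hCmem a').1 (a : C).2).symm
  have hord : (orderOf x).Coprime (orderOf a') := by
    obtain ⟨k, hk⟩ := IsPGroup.iff_orderOf.mp S.isPGroup' a
    have : orderOf a' = 2 ^ k := by
      rw [← hk, ha', Subgroup.orderOf_coe, Subgroup.orderOf_coe]
    rw [this]
    exact (Nat.coprime_two_right.2 hx).pow_right k
  obtain ⟨hxg, hag⟩ := mem_zpowers_mul_of_coprime hax hord
  set g := x * a' with hg
  have hle : ∀ s : S, s ∈ Subgroup.zpowers a → ((s : C) : orthGroup B) ∈ Subgroup.zpowers g :=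
    fun s hs => (Subgroup.zpowers_le.2 hag) (hval s hs)
  rcases hcases with hcyc | ⟨⟨i, hia, hii⟩, b, hba, hbb, hbS⟩
  · obtain ⟨t, htt, htg⟩ := exists_orth_involution hB h2 g
    have ht : t⁻¹ = t := inv_eq_of_mul_eq_one_right htt
    have htn : ∀ β ∈ Subgroup.zpowers g, t * β * t = β⁻¹ := by
      rintro _ ⟨k, rfl⟩
      have := conj_zpow (a := t) (b := g) (i := k)
      rw [ht, htg, _root_.inv_zpow] at this
      exact this.symm
    obtain ⟨K, h1, h3, h4⟩ := exists_nonnegFS_dihedral (Subgroup.zpowers g) (by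
      rintro _ ⟨k, rfl⟩ _ ⟨l, rfl⟩
      exact (Commute.zpow_zpow_self g k l).eq) t htt htn
    refine ⟨K, h4, h1 hxg, not_dvd_relIndex_of_sylow S fun s hs => h1 (hle ⟨s, hs⟩ (hcyc _)),
      t, h3, ?_⟩
    rw [ht]
    exact htn x hxg
  · have hiz : ((i : C) : orthGroup B) * ((i : C) : orthGroup B) = negOne hB :=
      congrArg (fun s : S => ((s : C) : orthGroup B)) hii
    have hI : Indec B (orthEnd g) := by
      by_contra hI
      obtain ⟨j, hjj, hj1, hjz, hjg⟩ := exists_commuting_involution hB h2 hI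
      have hjn : ∀ n ∈ Subgroup.zpowers g, j * n = n * j := by
        rintro _ ⟨k, rfl⟩
        exact ((show Commute j g from hjg).zpow_right k).eq
      have hza : (z : C) ∈ Subgroup.zpowers (a : C) := by
        have h3 : (⟨z, hzS⟩ : S) ∈ Subgroup.zpowers a := hii ▸ Subgroup.mul_mem _ hia hia
        obtain ⟨k, hk⟩ := h3
        exact ⟨k, congrArg Subtype.val hk⟩
      have hvalC : ∀ s : S, s ∈ Subgroup.zpowers a → (s : C) ∈ Subgroup.zpowers (a : C) := by
        rintro _ ⟨k, rfl⟩
        exact ⟨k, rfl⟩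
      rcases eq_one_or_eq_of_commute_of_sylow (z := z)
        (fun S j hj hjj hs => hP S j hj hjj fun s hs' => Or.inl (hs s hs')) S a.2 hza hz1 hzz
        (b := (b : C)) (fun s hs => (hbS ⟨s, hs⟩).imp (hvalC _) (hvalC _))
        (j := ⟨j, (hCmem j).2 (hjn x hxg)⟩) (Subtype.ext hjj) (Subtype.ext (hjn a' hag)) with h3 | h3
      · exact hj1 (congrArg Subtype.val h3)
      · exact hjz (congrArg Subtype.val h3)
    have hbx : ((b : C) : orthGroup B) * x = x * ((b : C) : orthGroup B) := (hCmem _).1 (b : C).2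
    obtain ⟨K, h1, h3, h4, h5⟩ := exists_local_of_index_two h2 hB hI hiz (hle i hia) hxg
      (b := ((b : C) : orthGroup B)) (by
        rw [hg, ← mul_assoc, hbx, mul_assoc, mul_assoc]
        refine Subgroup.mul_mem _ hxg ?_
        rw [← mul_assoc]
        exact hle _ (hnorm.conj_mem a (Subgroup.mem_zpowers a) b)) (hle _ hbb)
    refine ⟨K, h1, h3 x hxg, not_dvd_relIndex_of_sylow S fun s hs => ?_, h5⟩
    rcases hbS ⟨s, hs⟩ with h6 | h6
    · exact h3 _ (hle _ h6)
    · have h7 := K.mul_mem h4 (h3 _ (hle _ h6))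
      change ((b : C) : orthGroup B) * (((b : C) : orthGroup B)⁻¹ * s) ∈ K at h7
      rwa [mul_inv_cancel_left] at h7

end OrthogonalNonneg

section DegreeSum

variable {G : Type} [Group G]

/-- A linear functional on functions which vanishes on irreducible characters vanishes on all
characters. -/
theorem functional_character_eq_zero [Finite G] (L : (G → ℂ) →ₗ[ℂ] ℂ)
    (hL : ∀ (U : Type) [AddCommGroup U] [Module ℂ U] [FiniteDimensional ℂ U]
      (σ : Representation ℂ G U), σ.IsIrreducible → L σ.character = 0) (n : ℕ) :
    ∀ (W : Type) [AddCommGroup W] [Module ℂ W] [FiniteDimensional ℂ W]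
      (ρ : Representation ℂ G W), Module.finrank ℂ W = n → L ρ.character = 0 := by
  induction n using Nat.strong_induction_on with
  | _ n ih =>
    intro W _ _ _ ρ hn
    rcases subsingleton_or_nontrivial W with hW | hW
    · have : ρ.character = 0 := funext fun g => by
        rw [Representation.character, Subsingleton.elim (ρ g) 0, map_zero, Pi.zero_apply]
      rw [this, map_zero]
    by_cases hirr : ρ.IsIrreducible
    · exact hL W ρ hirr
    have hnt : Nontrivial (Subrepresentation ρ) :=
      ⟨⊥, ⊤, fun h => bot_ne_top (congrArg Subrepresentation.toSubmodule h)⟩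
    obtain ⟨p, hp1, hp2⟩ : ∃ p : Subrepresentation ρ, p ≠ ⊥ ∧ p ≠ ⊤ := by
      by_contra hcon
      push Not at hcon
      exact hirr ⟨fun a => or_iff_not_imp_left.mpr (hcon a)⟩
    have hss : ρ.IsSemisimpleRepresentation := inferInstance
    obtain ⟨r, hr⟩ := exists_isCompl p
    have hlt : ∀ s : Subrepresentation ρ, s ≠ ⊤ → Module.finrank ℂ s.toSubmodule < n := by
      intro s hs
      rw [← hn]
      exact Submodule.finrank_lt fun h => hs (Subrepresentation.toSubmodule_injective h)
    have hr2 : r ≠ ⊤ := fun h => hp1 (by simpa [h] using hr.inf_eq_bot)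
    have hadd : ρ.character = p.toRepresentation.character + r.toRepresentation.character :=
      funext fun g => character_eq_add_of_isCompl ρ hr g
    rw [hadd, map_add, ih _ (hlt p hp2) p.toSubmodule p.toRepresentation rfl,
      ih _ (hlt r hr2) r.toSubmodule r.toRepresentation rfl, add_zero]

theorem sum_character_mul_inv_irreducible [Fintype G] {U : Type} [AddCommGroup U] [Module ℂ U]
    [FiniteDimensional ℂ U] (σ : Representation ℂ G U) (hσ : σ.IsIrreducible) :
    ∑ g, σ.character g * σ.character g⁻¹ = Nat.card G := by
  have h0 : (Nat.card G : ℂ) ≠ 0 := Nat.cast_ne_zero.2 Nat.card_pos.ne'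
  have := invertibleOfNonzero h0
  have h := Representation.char_orthonormal σ σ
  rw [if_pos ⟨Representation.Equiv.refl σ⟩, inv_mul_eq_one₀ h0] at h
  exact h.symm

theorem sum_character_sq_of_real [Fintype G] (hG : NonnegFS G)
    (hinv : ∀ g : G, ∃ t, t * g * t⁻¹ = g⁻¹) {U : Type} [AddCommGroup U] [Module ℂ U]
    [FiniteDimensional ℂ U] (σ : Representation ℂ G U) (hσ : σ.IsIrreducible) :
    ∑ g, σ.character (g * g) = Nat.card G := by
  have h0 : (Nat.card G : ℂ) ≠ 0 := Nat.cast_ne_zero.2 Nat.card_pos.ne'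
  have hreal : ∀ g, σ.character g⁻¹ = σ.character g := fun g => by
    obtain ⟨t, ht⟩ := hinv g
    rw [← ht, Representation.char_conj]
  rcases frobeniusSchur_irreducible σ hσ with ⟨-, h⟩ | ⟨c, hc, hsum, -⟩
  · exfalso
    have := invertibleOfNonzero h0
    have h1 := Representation.card_inv_mul_sum_char_eq_finrank (σ.linHom σ.dual)
    have h2 : ∑ g, (σ.linHom σ.dual).character g = Nat.card G := by
      rw [← sum_character_mul_inv_irreducible σ hσ]
      refine Finset.sum_congr rfl fun g _ => ?_
      rw [Representation.char_linHom, Representation.char_dual, hreal]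
    rw [h2, inv_mul_cancel₀ h0] at h1
    have h3 : Module.finrank ℂ (σ.linHom σ.dual).invariants = 1 := by exact_mod_cast h1.symm
    have h4 : (σ.linHom σ.dual).invariants = ⊥ := by
      rw [eq_bot_iff]
      intro X hX
      exact h X ((mem_linHom_dual_invariants σ X).1 hX)
    rw [h4, finrank_bot] at h3
    exact zero_ne_one h3
  · rcases hc with rfl | rfl
    · rw [hsum, one_mul, Nat.card_eq_fintype_card]
    · have h := hG inferInstance U σ
      rw [hsum] at h
      have h1 : (0 : ℝ) < Fintype.card G := Nat.cast_pos.2 Fintype.card_pos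
      simp at h

theorem leftRegular_character [Fintype G] (g : G) :
    (Representation.leftRegular ℂ G).character g = if g = 1 then (Nat.card G : ℂ) else 0 := by
  rw [Representation.character, LinearMap.trace_eq_matrix_trace ℂ (MonoidAlgebra.basis G ℂ),
    Matrix.trace]
  have : ∀ x : G, LinearMap.toMatrix (MonoidAlgebra.basis G ℂ) (MonoidAlgebra.basis G ℂ)
      (Representation.leftRegular ℂ G g) x x = if g = 1 then (1 : ℂ) else 0 := fun x => by
    rw [LinearMap.toMatrix_apply]
    simp [MonoidAlgebra.basis, Finsupp.single_apply]
  simp only [Matrix.diag, this]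
  split_ifs <;> simp

/-- If all irreducible characters are real and no irreducible representation is quaternionic,
then the sum of the degrees is the number of solutions of `g² = 1`. -/
theorem sum_degree_eq_card_involution [Fintype G] (hG : NonnegFS G)
    (hinv : ∀ g : G, ∃ t, t * g * t⁻¹ = g⁻¹) {κ : Type} [Fintype κ] (S : κ → FDRep ℂ G)
    (hsimple : ∀ i, Simple (S i)) (hdistinct : ∀ i j : κ, Nonempty (S i ≅ S j) → i = j)
    (hcomplete : ∀ ρ : FDRep ℂ G, Simple ρ → ∃ i, Nonempty (ρ ≅ S i)) :
    ∑ j, Module.finrank ℂ (S j) = Nat.card {g : G // g * g = 1} := by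
  have h0 : (Nat.card G : ℂ) ≠ 0 := Nat.cast_ne_zero.2 Nat.card_pos.ne'
  have := invertibleOfNonzero h0
  let L : (G → ℂ) →ₗ[ℂ] ℂ :=
    { toFun := fun χ => ∑ g, χ (g * g) - ∑ j, ∑ g, χ g * (S j).character g⁻¹
      map_add' := fun χ ψ => by
        simp only [Pi.add_apply, Finset.sum_add_distrib, add_mul]
        ring
      map_smul' := fun c χ => by
        simp only [Pi.smul_apply, smul_eq_mul, RingHom.id_apply, mul_sub, Finset.mul_sum,
          mul_assoc] }
  have hL := functional_character_eq_zero L (fun U _ _ _ σ hσ => ?_) _ (MonoidAlgebra ℂ G)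
    (Representation.leftRegular ℂ G) rfl
  · have h1 : ∑ g : G, (Representation.leftRegular ℂ G).character (g * g) -
      ∑ j, ∑ g, (Representation.leftRegular ℂ G).character g * (S j).character g⁻¹ = 0 := hL
    simp only [leftRegular_character, ite_mul, zero_mul, Finset.sum_ite_eq', Finset.mem_univ,
      if_true, inv_one, FDRep.char_one, ← Finset.mul_sum] at h1
    rw [← Finset.sum_filter, Finset.sum_const, nsmul_eq_mul, mul_comm, ← mul_sub] at h1
    have h2 := sub_eq_zero.1 ((mul_eq_zero.1 h1).resolve_left h0)
    rw [Nat.card_eq_fintype_card, Fintype.card_subtype]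
    exact_mod_cast h2.symm
  · have hs : Simple (FDRep.of σ) :=
      (FDRep.simple_iff_char_is_norm_one _).2 (sum_character_mul_inv_irreducible σ hσ)
    obtain ⟨i, ⟨e⟩⟩ := hcomplete _ hs
    change ∑ g, σ.character (g * g) - ∑ j, ∑ g, (FDRep.of σ).character g * (S j).character g⁻¹ = 0
    have horth : ∀ j, ∑ g, (FDRep.of σ).character g * (S j).character g⁻¹ =
        if j = i then (Nat.card G : ℂ) else 0 := fun j => by
      have h := FDRep.char_orthonormal (FDRep.of σ) (S j)
      rw [inv_mul_eq_iff_eq_mul₀ h0] at h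
      rw [h]
      by_cases hj : j = i
      · subst hj
        rw [if_pos ⟨e⟩, if_pos rfl, mul_one]
      · rw [if_neg, if_neg hj, mul_zero]
        rintro ⟨e'⟩
        exact hj (hdistinct j i ⟨e'.symm ≪≫ e⟩)
    rw [sum_character_sq_of_real hG hinv σ hσ]
    simp [horth]

end DegreeSum

section Isotropic

variable {F : Type} [Field F] {V : Type} [AddCommGroup V] [Module F V] [FiniteDimensional F V]
  {B : LinearMap.BilinForm F V}

omit [FiniteDimensional F V] in
theorem SymmNondeg.exists_anisotropic (hB : SymmNondeg B) (h2 : (2 : F) ≠ 0) [Nontrivial V] :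
    ∃ v, B v v ≠ 0 := by
  by_contra! h
  obtain ⟨v, hv⟩ := exists_ne (0 : V)
  refine hv (hB.2 v fun w => ?_)
  have h1 := h (v + w)
  simp only [map_add, LinearMap.add_apply, h, hB.1 w v, zero_add, add_zero, ← two_mul] at h1
  exact (mul_eq_zero.1 h1).resolve_left h2

omit [FiniteDimensional F V] in
theorem nondegOn_span_singleton {v : V} (hv : B v v ≠ 0) : NondegOn B (Submodule.span F {v}) := by
  intro x hx h
  obtain ⟨c, rfl⟩ := Submodule.mem_span_singleton.1 hx
  have h1 := h v (Submodule.mem_span_singleton_self v)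
  rw [map_smul, LinearMap.smul_apply, smul_eq_mul] at h1
  rw [(mul_eq_zero.1 h1).resolve_right hv, zero_smul]

theorem SymmNondeg.finrank_orthogonal_add (hB : SymmNondeg B) {U : Submodule F V}
    (hU : NondegOn B U) :
    Module.finrank F (B.orthogonal U) + Module.finrank F U = Module.finrank F V := by
  rw [add_comm]
  exact Submodule.finrank_add_eq_of_isCompl (hB.isCompl hU)

theorem SymmNondeg.exists_orthogonal_anisotropic (hB : SymmNondeg B) (h2 : (2 : F) ≠ 0) (n : ℕ)
    (hn : n + 1 ≤ Module.finrank F V) : ∃ (v : V) (U : Submodule F V), B v v ≠ 0 ∧ NondegOn B U ∧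
      n ≤ Module.finrank F U ∧ ∀ u ∈ U, B v u = 0 := by
  have : Nontrivial V := Module.nontrivial_of_finrank_pos (R := F) (by omega)
  obtain ⟨v, hv⟩ := hB.exists_anisotropic h2
  have hU := nondegOn_span_singleton hv
  refine ⟨v, _, hv, hB.nondegOn_orthogonal hU, ?_, fun u hu => ?_⟩
  · have h1 := hB.finrank_orthogonal_add hU
    rw [finrank_span_singleton (fun h => hv (by rw [h, map_zero]))] at h1
    omega
  · rw [hB.1]
    exact hB.mem_orthogonal.1 hu v (Submodule.mem_span_singleton_self v)

open Polynomial in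
theorem exists_sq_add_sq_add_eq_zero [Finite F] (h2 : (2 : F) ≠ 0) {a b : F} (ha : a ≠ 0)
    (hb : b ≠ 0) (c : F) : ∃ x y : F, a * x ^ 2 + b * y ^ 2 + c = 0 := by
  have := Fintype.ofFinite F
  have hodd : Fintype.card F % 2 = 1 :=
    FiniteField.odd_card_of_char_ne_two fun h => by
      have := ringChar.spec F 2
      rw [h] at this
      exact h2 (by exact_mod_cast this.2 dvd_rfl)
  obtain ⟨x, y, h⟩ := FiniteField.exists_root_sum_quadratic (f := C a * X ^ 2 + C 0 * X + C 0)
    (g := C b * X ^ 2 + C 0 * X + C c) (degree_quadratic ha) (degree_quadratic hb) hodd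
  refine ⟨x, y, ?_⟩
  simp at h
  rw [← h]
  ring

theorem SymmNondeg.exists_isotropic [Finite F] (hB : SymmNondeg B) (h2 : (2 : F) ≠ 0)
    (hn : 3 ≤ Module.finrank F V) : ∃ v, v ≠ 0 ∧ B v v = 0 := by
  obtain ⟨e, U, he, hU, hU2, heU⟩ := hB.exists_orthogonal_anisotropic h2 2 hn
  obtain ⟨f, U', hf, hU', hU2', hfU⟩ := (hB.restrict hU).exists_orthogonal_anisotropic h2 1 hU2
  obtain ⟨g, -, hg, -⟩ := ((hB.restrict hU).restrict hU').exists_orthogonal_anisotropic h2 0 hU2'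
  obtain ⟨x, y, hxy⟩ := exists_sq_add_sq_add_eq_zero h2 he hf (B (g : U) (g : U))
  have hef : B e f = 0 := heU f f.2
  have heg : B e (g : U) = 0 := heU _ (g : U).2
  have hfg : B f (g : U) = 0 := hfU _ g.2
  have hfe : B f e = 0 := by rw [hB.1, hef]
  have hge : B (g : U) e = 0 := by rw [hB.1, heg]
  have hgf : B (g : U) f = 0 := by rw [hB.1, hfg]
  refine ⟨x • e + y • (f : V) + (g : U), fun h => hg ?_, ?_⟩
  · change B (g : U) (g : U) = 0
    have h1 := congrArg (fun v => B v (g : U)) h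
    simpa [heg, hfg] using h1
  · simp only [map_add, map_smul, LinearMap.add_apply, LinearMap.smul_apply, smul_eq_mul, hef, heg,
      hfg, hfe, hge, hgf]
    refine Eq.trans ?_ hxy
    change _ = B e e * x ^ 2 + B f f * y ^ 2 + _
    ring

/-- A pair of isotropic vectors with product `1`. -/
def IsHypPair (B : LinearMap.BilinForm F V) (p : V × V) : Prop :=
  B p.1 p.1 = 0 ∧ B p.2 p.2 = 0 ∧ B p.1 p.2 = 1

omit [FiniteDimensional F V] in
theorem IsHypPair.apply (hB : SymmNondeg B) {v w : V} (h : IsHypPair B (v, w)) (a b : F) :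
    B (a • v + b • w) v = b ∧ B (a • v + b • w) w = a := by
  obtain ⟨h1, h2, h3⟩ := h
  have h4 : B w v = 1 := by rw [hB.1]; exact h3
  simp only at h1 h2 h3
  simp [h1, h2, h3, h4]

omit [FiniteDimensional F V] in
theorem IsHypPair.nondegOn (hB : SymmNondeg B) {v w : V} (h : IsHypPair B (v, w)) :
    NondegOn B (Submodule.span F {v, w}) := by
  intro x hx hx0
  obtain ⟨a, b, rfl⟩ := Submodule.mem_span_pair.1 hx
  have h1 := hx0 v (Submodule.subset_span (by simp))
  have h2 := hx0 w (Submodule.subset_span (by simp))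
  rw [(h.apply hB a b).1] at h1
  rw [(h.apply hB a b).2] at h2
  rw [h1, h2, zero_smul, zero_smul, add_zero]

theorem IsHypPair.finrank_orthogonal (hB : SymmNondeg B) {v w : V} (h : IsHypPair B (v, w)) :
    Module.finrank F (B.orthogonal (Submodule.span F {v, w})) + 2 = Module.finrank F V := by
  have hli : LinearIndependent F ![v, w] := by
    rw [LinearIndependent.pair_iff]
    intro a b hab
    have h1 := h.apply hB a b
    rw [hab, map_zero, LinearMap.zero_apply, LinearMap.zero_apply] at h1
    exact ⟨h1.2.symm, h1.1.symm⟩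
  have h1 := finrank_span_eq_card hli
  rw [show Set.range ![v, w] = {v, w} by simp [Set.pair_comm w v], Fintype.card_fin] at h1
  rw [← hB.finrank_orthogonal_add (h.nondegOn hB), h1]

omit [FiniteDimensional F V] in
/-- The isotropic vectors forming a hyperbolic pair with a given isotropic vector. -/
theorem card_hypPair_partner (hB : SymmNondeg B) (h2 : (2 : F) ≠ 0) {v : V}
    (hv : v ≠ 0) (hvv : B v v = 0) :
    Nat.card {w // B w w = 0 ∧ B v w = 1} * Nat.card F ^ 2 = Nat.card V := by
  obtain ⟨w₀, hw₀⟩ : ∃ w₀, B v w₀ = 1 := by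
    by_contra! h
    refine hv (hB.2 v fun w => ?_)
    by_contra hw
    exact h ((B v w)⁻¹ • w) (by rw [map_smul, smul_eq_mul, inv_mul_cancel₀ hw])
  have key : ∀ x : V, B x x = 0 → B v x = 1 → ∀ s : F, B (x + s • v) (x + s • v) = 2 * s := by
    intro x hx hvx s
    simp only [map_add, map_smul, LinearMap.add_apply, LinearMap.smul_apply, smul_eq_mul, hx, hvx,
      hB.1 x v, hvv]
    ring
  let T : V → V := fun x => x - (B v x - 1) • w₀
  have hT : ∀ x, B v (T x) = 1 := fun x => by
    simp [T, hw₀]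
  let e : V ≃ {w // B w w = 0 ∧ B v w = 1} × F × F :=
    { toFun := fun x => (⟨T x - (B (T x) (T x) / 2) • v, by
        simp only [map_sub, map_smul, LinearMap.sub_apply, LinearMap.smul_apply, smul_eq_mul, hT,
          hB.1 (T x) v, hvv]
        field_simp
        ring, by rw [map_sub, map_smul, hT, hvv, smul_zero, sub_zero]⟩,
        B (T x) (T x) / 2, B v x - 1)
      invFun := fun p => p.1 + p.2.1 • v + p.2.2 • w₀
      left_inv := fun x => by
        simp [T]
      right_inv := fun ⟨⟨w, hw1, hw2⟩, s, t⟩ => by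
        have h1 : B v (w + s • v + t • w₀) - 1 = t := by
          simp [hw2, hvv, hw₀]
        have h3 : T (w + s • v + t • w₀) = w + s • v := by
          simp only [T, h1, add_sub_cancel_right]
        have h4 : B (w + s • v) (w + s • v) / 2 = s := by
          rw [key w hw1 hw2 s, mul_div_cancel_left₀ _ h2]
        refine Prod.ext (Subtype.ext ?_) (Prod.ext ?_ h1)
        · simp only [h3, h4, add_sub_cancel_right]
        · simp only [h3, h4] }
  rw [Nat.card_congr e, Nat.card_prod, Nat.card_prod, sq]

end Isotropic

section IsotropicCount

variable {F : Type} [Field F] {V : Type} [AddCommGroup V] [Module F V] [FiniteDimensional F V]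
  {B : LinearMap.BilinForm F V}

omit [FiniteDimensional F V] in
theorem IsHypPair.mem_orthogonal (hB : SymmNondeg B) {v w x : V} :
    x ∈ B.orthogonal (Submodule.span F {v, w}) ↔ B v x = 0 ∧ B w x = 0 := by
  rw [hB.mem_orthogonal]
  constructor
  · intro h
    rw [hB.1 v x, hB.1 w x]
    exact ⟨h v (Submodule.subset_span (by simp)), h w (Submodule.subset_span (by simp))⟩
  · rintro ⟨h1, h2⟩ u hu
    obtain ⟨a, b, rfl⟩ := Submodule.mem_span_pair.1 hu
    rw [map_add, map_smul, map_smul, hB.1 x v, hB.1 x w, h1, h2, smul_zero, smul_zero, add_zero]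

omit [FiniteDimensional F V] in
/-- Isotropic vectors orthogonal to the second member of a hyperbolic pair. -/
theorem card_isotropic_orthogonal (hB : SymmNondeg B) {v w : V} (h : IsHypPair B (v, w)) :
    Nat.card {x // B x x = 0 ∧ B w x = 0} = Nat.card F *
      Nat.card {u : B.orthogonal (Submodule.span F {v, w}) //
        B.restrict (B.orthogonal (Submodule.span F {v, w})) u u = 0} := by
  obtain ⟨hv, hw, hvw⟩ := h
  simp only at hv hw hvw
  let e : {x // B x x = 0 ∧ B w x = 0} ≃ F × {u : B.orthogonal (Submodule.span F {v, w}) //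
        B.restrict (B.orthogonal (Submodule.span F {v, w})) u u = 0} :=
    { toFun := fun x => (B v x, ⟨⟨x - B v x • w, (IsHypPair.mem_orthogonal hB).2
        ⟨by simp [hvw], by simp [hw, x.2.2]⟩⟩, by
          change B ((x : V) - B v x • w) ((x : V) - B v x • w) = 0
          simp [hB.1 x w, x.2.1, x.2.2, hw]⟩)
      invFun := fun p => ⟨(p.2 : B.orthogonal (Submodule.span F {v, w})) + p.1 • w, by
        have h1 := (IsHypPair.mem_orthogonal hB).1
          (p.2 : B.orthogonal (Submodule.span F {v, w})).2
        have h3 : B (p.2 : B.orthogonal (Submodule.span F {v, w}))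
          (p.2 : B.orthogonal (Submodule.span F {v, w})) = 0 := p.2.2
        have h4 : B (p.2 : B.orthogonal (Submodule.span F {v, w})) w = 0 := by rw [hB.1, h1.2]
        constructor
        · simp [h1, h3, hw, h4]
        · simp [h1, hw]⟩
      left_inv := fun x => by simp
      right_inv := fun ⟨s, u, hu⟩ => by
        have h1 := (IsHypPair.mem_orthogonal hB).1 u.2
        have h3 : B v (u + s • w) = s := by simp [h1, hvw]
        refine Prod.ext h3 (Subtype.ext (Subtype.ext ?_))
        simp only [h3, add_sub_cancel_right] }
  rw [Nat.card_congr e, Nat.card_prod]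

omit [FiniteDimensional F V] in
theorem card_isotropic_not_orthogonal [Finite F] (w : V) :
    Nat.card {x // B x x = 0 ∧ B w x ≠ 0} =
      (Nat.card F - 1) * Nat.card {x // B x x = 0 ∧ B w x = 1} := by
  let e : {x // B x x = 0 ∧ B w x ≠ 0} ≃ Fˣ × {x // B x x = 0 ∧ B w x = 1} :=
    { toFun := fun x => (Units.mk0 _ x.2.2, ⟨(B w x)⁻¹ • x, by simp [x.2.1],
        by simp [x.2.2]⟩)
      invFun := fun p => ⟨(p.1 : F) • p.2, by simp [p.2.2.1], by simp [p.2.2.2]⟩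
      left_inv := fun x => Subtype.ext (by simp [smul_smul, x.2.2])
      right_inv := fun ⟨s, x, h1, h2⟩ => by
        refine Prod.ext (Units.ext ?_) (Subtype.ext ?_)
        · simp [h2]
        · simp [h2] }
  rw [Nat.card_congr e, Nat.card_prod, Nat.card_units]

/-- The number of isotropic vectors of a quadratic space of odd dimension. -/
theorem card_isotropic [Finite F] (h2 : (2 : F) ≠ 0) (r : ℕ) :
    ∀ {V : Type} [AddCommGroup V] [Module F V] [FiniteDimensional F V]
      {B : LinearMap.BilinForm F V} (_ : SymmNondeg B) (_ : Module.finrank F V = 2 * r + 1),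
      Nat.card {x // B x x = 0} = Nat.card F ^ (2 * r) := by
  induction r with
  | zero =>
    intro V _ _ _ B hB hn
    rw [mul_zero, pow_zero, Nat.card_eq_one_iff_unique]
    refine ⟨⟨?_⟩, ⟨⟨0, by simp⟩⟩⟩
    have : ∀ x : V, B x x = 0 → x = 0 := by
      intro x hx
      by_contra hx0
      refine hx0 (hB.2 x fun w => ?_)
      obtain ⟨c, rfl⟩ := (finrank_eq_one_iff_of_nonzero' x hx0).1 hn w
      rw [map_smul, hx, smul_zero]
    exact fun x y => Subtype.ext ((this x x.2).trans (this y y.2).symm)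
  | succ r ih =>
    intro V _ _ _ B hB hn
    have : Finite V := Module.finite_of_finite F
    have hq : 0 < Nat.card F := Nat.card_pos
    have hV : Nat.card V = Nat.card F ^ (2 * r + 3) := by
      rw [Module.natCard_eq_pow_finrank (K := F), hn]
      rfl
    obtain ⟨w, hw0, hww⟩ := hB.exists_isotropic h2 (by omega)
    have hpart := card_hypPair_partner hB h2 hw0 hww
    obtain ⟨v, hvv, hwv⟩ : ∃ v, B v v = 0 ∧ B w v = 1 := by
      by_contra! hcon
      have : IsEmpty {x // B x x = 0 ∧ B w x = 1} := ⟨fun x => hcon x x.2.1 x.2.2⟩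
      rw [Nat.card_of_isEmpty, zero_mul] at hpart
      exact Nat.card_pos.ne hpart
    have hp : IsHypPair B (v, w) := ⟨hvv, hww, (hB.1 v w).trans hwv⟩
    have h1 := card_isotropic_orthogonal hB hp
    have h3 := card_isotropic_not_orthogonal (B := B) w
    have h4 := hp.finrank_orthogonal hB
    rw [ih (hB.restrict (hB.nondegOn_orthogonal (hp.nondegOn hB))) (by omega)] at h1
    have h5 : Nat.card {x // B x x = 0} =
        Nat.card {x // B x x = 0 ∧ B w x = 0} + Nat.card {x // B x x = 0 ∧ B w x ≠ 0} := by
      rw [← Nat.card_sum]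
      refine Nat.card_congr ((Equiv.sumCompl fun x : {x // B x x = 0} => B w x = 0).symm.trans ?_)
      exact Equiv.sumCongr (Equiv.subtypeSubtypeEquivSubtypeInter (fun x => B x x = 0) fun x => B w x = 0)
        (Equiv.subtypeSubtypeEquivSubtypeInter (fun x => B x x = 0) fun x => B w x ≠ 0)
    apply Nat.eq_of_mul_eq_mul_right (pow_pos hq 2)
    rw [h5, h3, h1, add_mul, mul_assoc (Nat.card F - 1), hpart, hV]
    obtain ⟨s, hs⟩ : ∃ s, Nat.card F = s + 1 := ⟨Nat.card F - 1, by omega⟩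
    rw [hs, Nat.add_sub_cancel]
    ring

/-- The number of hyperbolic pairs of a quadratic space of odd dimension. -/
theorem card_hypPair [Finite F] (hB : SymmNondeg B) (h2 : (2 : F) ≠ 0) {r : ℕ}
    (hn : Module.finrank F V = 2 * r + 1) :
    Nat.card {p // IsHypPair B p} * Nat.card F ^ 2 =
      (Nat.card F ^ (2 * r) - 1) * Nat.card F ^ (2 * r + 1) := by
  have : Finite V := Module.finite_of_finite F
  have := Fintype.ofFinite V
  let e : {p // IsHypPair B p} ≃
      Σ v : {v // B v v = 0 ∧ v ≠ 0}, {w // B w w = 0 ∧ B v w = 1} :=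
    { toFun := fun p => ⟨⟨p.1.1, p.2.1, fun h => by
        have := p.2.2.2
        rw [h, map_zero] at this
        exact zero_ne_one this⟩, ⟨p.1.2, p.2.2⟩⟩
      invFun := fun s => ⟨(s.1, s.2), s.1.2.1, s.2.2⟩
      left_inv := fun _ => rfl
      right_inv := fun _ => rfl }
  rw [Nat.card_congr e, Nat.card_sigma, Finset.sum_mul, Finset.sum_congr rfl fun v _ =>
    card_hypPair_partner hB h2 v.2.2 v.2.1, Finset.sum_const, Finset.card_univ, smul_eq_mul,
    Module.natCard_eq_pow_finrank (K := F), hn, ← card_isotropic h2 r hB hn]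
  congr 1
  rw [← Nat.card_eq_fintype_card]
  have h1 : Nat.card {x : {x // B x x = 0} // x ≠ ⟨0, by simp⟩} = Nat.card {x // B x x = 0} - 1 := by
    rw [Nat.card_eq_fintype_card, Nat.card_eq_fintype_card, Fintype.card_subtype_compl,
      Fintype.card_subtype_eq]
  rw [← h1]
  refine Nat.card_congr ?_
  exact
    { toFun := fun x => ⟨⟨x, x.2.1⟩, fun h => x.2.2 (congrArg Subtype.val h)⟩
      invFun := fun x => ⟨x.1, x.1.2, fun h => x.2 (Subtype.ext h)⟩
      left_inv := fun _ => rfl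
      right_inv := fun _ => rfl }

/-- The number of anisotropic vectors of a quadratic space of odd dimension. -/
theorem card_anisotropic [Finite F] (hB : SymmNondeg B) (h2 : (2 : F) ≠ 0) {r : ℕ}
    (hn : Module.finrank F V = 2 * r + 1) :
    Nat.card {v // B v v ≠ 0} = Nat.card F ^ (2 * r) * (Nat.card F - 1) := by
  have : Finite V := Module.finite_of_finite F
  have h1 : Nat.card {v // B v v = 0} + Nat.card {v // B v v ≠ 0} = Nat.card V := by
    rw [← Nat.card_sum]
    exact Nat.card_congr (Equiv.sumCompl fun x : V => B x x = 0)
  rw [card_isotropic h2 r hB hn, Module.natCard_eq_pow_finrank (K := F) (V := V), hn, pow_succ] at h1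
  rw [Nat.mul_sub, mul_one]
  omega

end IsotropicCount

section InvolutionCount

variable {F : Type} [Field F] {V : Type} [AddCommGroup V] [Module F V] {B : LinearMap.BilinForm F V}

/-- The `-1`-eigenspace of an isometry. -/
def negSpace (a : orthGroup B) : Submodule F V := LinearMap.ker (orthEnd a + 1)

theorem mem_negSpace {a : orthGroup B} {v : V} : v ∈ negSpace a ↔ orthEnd a v = -v := by
  rw [negSpace, LinearMap.mem_ker, LinearMap.add_apply, add_eq_zero_iff_eq_neg]; rfl

/-- The involutive isometries whose `-1`-eigenspace has dimension `d`. -/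
def OrthInvolution (B : LinearMap.BilinForm F V) (d : ℕ) : Type :=
  {a : orthGroup B // a * a = 1 ∧ Module.finrank F (negSpace a) = d}

variable [FiniteDimensional F V]

instance [Finite F] (d : ℕ) : Finite (OrthInvolution B d) :=
  inferInstanceAs (Finite {a : orthGroup B // a * a = 1 ∧ Module.finrank F (negSpace a) = d})

theorem finrank_negSpace_add_fixedSpace (hB : SymmNondeg B) (h2 : (2 : F) ≠ 0) {a : orthGroup B}
    (ha : a * a = 1) :
    Module.finrank F (negSpace a) + Module.finrank F (fixedSpace a) = Module.finrank F V := by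
  obtain ⟨h1, h3⟩ := fixedSpace_of_involution hB h2 ha
  rw [← hB.finrank_orthogonal_add h1, show negSpace a = B.orthogonal (fixedSpace a) from
    Submodule.ext fun v => mem_negSpace.trans (h3 v).symm]

theorem finrank_negSpace_orthExtend (hB : SymmNondeg B) (h2 : (2 : F) ≠ 0) {U : Submodule F V}
    (hU : NondegOn B U) (a : orthGroup (B.restrict U)) :
    Module.finrank F (negSpace (orthExtend hB hU a)) = Module.finrank F (negSpace a) := by
  suffices h : negSpace (orthExtend hB hU a) = (negSpace a).map U.subtype by
    rw [h, Submodule.finrank_map_subtype_eq U (negSpace a)]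
  ext x
  rw [mem_negSpace, Submodule.mem_map]
  constructor
  · intro hx
    obtain ⟨u, hu, b, hb, rfl⟩ := Submodule.mem_sup.1
      ((hB.isCompl hU).sup_eq_top ▸ Submodule.mem_top : x ∈ U ⊔ B.orthogonal U)
    rw [map_add, orthExtend_apply_orthogonal hB hU a hb, orthExtend_apply hB hU a ⟨u, hu⟩] at hx
    have hmem : (2 : F) • b ∈ U := by
      have : (2 : F) • b = -(u + (orthEnd a ⟨u, hu⟩ : U)) := by
        rw [two_smul, ← sub_eq_zero]
        rw [← sub_eq_zero] at hx
        rw [← hx]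
        abel
      rw [this]
      exact U.neg_mem (U.add_mem hu (orthEnd a ⟨u, hu⟩).2)
    have hb0 : b = 0 := Submodule.disjoint_def.1 (hB.isCompl hU).disjoint b
      ((U.smul_mem_iff h2).1 hmem) hb
    subst hb0
    refine ⟨⟨u, hu⟩, mem_negSpace.2 (Subtype.ext ?_), by simp⟩
    simpa using hx
  · rintro ⟨u, hu, rfl⟩
    rw [Submodule.subtype_apply, orthExtend_apply, mem_negSpace.1 hu]
    rfl

theorem orthExtend_injective (hB : SymmNondeg B) {U : Submodule F V} (hU : NondegOn B U) :
    Function.Injective (orthExtend hB hU) := by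
  intro a b hab
  refine orthGroup_ext fun u => Subtype.ext ?_
  rw [← orthExtend_apply hB hU, hab, orthExtend_apply]

/-- The involutions fixing a hyperbolic pair. -/
theorem card_involution_fixing_hypPair (hB : SymmNondeg B) (h2 : (2 : F) ≠ 0) (d : ℕ) {v w : V}
    (h : IsHypPair B (v, w)) :
    Nat.card {a : OrthInvolution B d // orthEnd a.1 v = v ∧ orthEnd a.1 w = w} =
      Nat.card (OrthInvolution (B.restrict (B.orthogonal (Submodule.span F {v, w}))) d) := by
  have hU := h.nondegOn hB
  have hW := hB.nondegOn_orthogonal hU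
  set U := Submodule.span F {v, w} with hUdef
  have hfix : ∀ (a : orthGroup (B.restrict (B.orthogonal U))), ∀ u ∈ U,
      orthEnd (orthExtend hB hW a) u = u := fun a u hu =>
    orthExtend_apply_orthogonal hB hW a (hB.le_orthogonal_orthogonal hu)
  have hvU : v ∈ U := Submodule.subset_span (by simp)
  have hwU : w ∈ U := Submodule.subset_span (by simp)
  symm
  refine Nat.card_congr (Equiv.ofBijective (fun a => ⟨⟨orthExtend hB hW a.1, ?_, ?_⟩,
    hfix a.1 v hvU, hfix a.1 w hwU⟩) ⟨?_, ?_⟩)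
  · rw [← map_mul, a.2.1, map_one]
  · rw [finrank_negSpace_orthExtend hB h2, a.2.2]
  · intro a b hab
    exact Subtype.ext (orthExtend_injective hB hW
      (congrArg (fun x => x.1.1) hab))
  · rintro ⟨⟨a, haa, had⟩, hav, haw⟩
    simp only at hav haw
    have hinv : ∀ u ∈ B.orthogonal U, orthEnd a u ∈ B.orthogonal U := fun u hu => by
      rw [hUdef, IsHypPair.mem_orthogonal hB] at hu ⊢
      constructor
      · rw [← hu.1]; nth_rw 1 [← hav]; exact orthEnd_isIsom a v u
      · rw [← hu.2]; nth_rw 1 [← haw]; exact orthEnd_isIsom a w u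
    have hext : orthExtend hB hW (orthRestrict hB hW a hinv) = a := by
      refine orthGroup_ext_of_nondegOn hB hU (fun u hu => ?_) fun u hu => ?_
      · rw [hfix _ u hu]
        obtain ⟨s, t, rfl⟩ := Submodule.mem_span_pair.1 hu
        rw [map_add, map_smul, map_smul, hav, haw]
      · rw [orthExtend_apply hB hW _ ⟨u, hu⟩, orthRestrict_apply]
    refine ⟨⟨orthRestrict hB hW a hinv, orthExtend_injective hB hW ?_, ?_⟩,
      Subtype.ext (Subtype.ext hext)⟩
    · rw [map_mul, hext, haa, map_one]
    · rw [← finrank_negSpace_orthExtend hB h2 hW, hext, had]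

/-- Double counting. -/
theorem card_mul_eq_of_relation_real {α β : Type} [Finite α] [Finite β] (R : α → β → Prop)
    (m n : ℝ) (hm : ∀ a, (Nat.card {b // R a b} : ℝ) = m)
    (hn : ∀ b, (Nat.card {a // R a b} : ℝ) = n) :
    (Nat.card α : ℝ) * m = Nat.card β * n := by
  have := Fintype.ofFinite α
  have := Fintype.ofFinite β
  have h1 : Nat.card (Σ a, {b // R a b}) = Nat.card (Σ b, {a // R a b}) := Nat.card_congr
    { toFun := fun s => ⟨s.2, s.1, s.2.2⟩
      invFun := fun s => ⟨s.2, s.1, s.2.2⟩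
      left_inv := fun _ => rfl
      right_inv := fun _ => rfl }
  rw [Nat.card_sigma, Nat.card_sigma] at h1
  have h3 := congrArg (fun n : ℕ => (n : ℝ)) h1
  simpa only [Nat.cast_sum, hm, hn, Finset.sum_const, Finset.card_univ, nsmul_eq_mul,
    ← Nat.card_eq_fintype_card] using h3

theorem card_mul_eq_of_relation {α β : Type} [Finite α] [Finite β] (R : α → β → Prop) (m n : ℕ)
    (hm : ∀ a, Nat.card {b // R a b} = m) (hn : ∀ b, Nat.card {a // R a b} = n) :
    Nat.card α * m = Nat.card β * n := by
  exact_mod_cast card_mul_eq_of_relation_real R m n (fun a => by rw [hm]) fun b => by rw [hn]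

theorem card_involution_corank_one [Finite F] (hB : SymmNondeg B) (h2 : (2 : F) ≠ 0) {k : ℕ}
    (hn : Module.finrank F V = 2 * k + 1) :
    Nat.card (OrthInvolution B (2 * k)) = Nat.card F ^ (2 * k) := by
  have : Finite V := Module.finite_of_finite F
  have hfix : ∀ a : OrthInvolution B (2 * k), Module.finrank F (fixedSpace a.1) = 1 := fun a => by
    have := finrank_negSpace_add_fixedSpace hB h2 a.2.1
    rw [a.2.2, hn] at this
    omega
  have haniso : ∀ (a : OrthInvolution B (2 * k)) (v : V), orthEnd a.1 v = v → v ≠ 0 →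
      B v v ≠ 0 := by
    intro a v hv hv0 hvv
    refine hv0 ((fixedSpace_of_involution hB h2 a.2.1).1 v (mem_fixedSpace.2 hv) fun w hw => ?_)
    obtain ⟨c, hc⟩ := (finrank_eq_one_iff_of_nonzero' (⟨v, mem_fixedSpace.2 hv⟩ : fixedSpace a.1)
      fun h => hv0 (congrArg Subtype.val h)).1 (hfix a) ⟨w, hw⟩
    have : c • v = w := congrArg Subtype.val hc
    rw [← this, map_smul, hvv, smul_zero]
  have key := card_mul_eq_of_relation
    (fun (a : OrthInvolution B (2 * k)) (v : {v // B v v ≠ 0}) => orthEnd a.1 v = v)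
    (Nat.card F - 1) 1 ?_ ?_
  · rw [card_anisotropic hB h2 hn, mul_one] at key
    exact Nat.eq_of_mul_eq_mul_right (Nat.sub_pos_of_lt Finite.one_lt_card) key
  · intro a
    have : Nat.card {x : fixedSpace a.1 // x ≠ 0} = Nat.card F - 1 := by
      have := Fintype.ofFinite (fixedSpace a.1)
      rw [Nat.card_eq_fintype_card, Fintype.card_subtype_compl, Fintype.card_subtype_eq,
        ← Nat.card_eq_fintype_card, Module.natCard_eq_pow_finrank (K := F), hfix, pow_one]
    rw [← this]
    exact Nat.card_congr
      { toFun := fun v => ⟨⟨v, mem_fixedSpace.2 v.2⟩, fun h => v.1.2 (by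
          rw [show (v : V) = 0 from congrArg Subtype.val h, map_zero])⟩
        invFun := fun x => ⟨⟨x.1, haniso a _ (mem_fixedSpace.1 x.1.2) fun h => x.2 (Subtype.ext h)⟩,
          mem_fixedSpace.1 x.1.2⟩
        left_inv := fun _ => rfl
        right_inv := fun _ => rfl }
  · rintro ⟨v, hv⟩
    have hU := nondegOn_span_singleton hv
    have hW := hB.nondegOn_orthogonal hU
    have hv0 : v ≠ 0 := fun h => hv (by rw [h, map_zero])
    set U := Submodule.span F {v} with hUdef
    have hvU : v ∈ U := Submodule.mem_span_singleton_self v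
    have hU1 : Module.finrank F U = 1 := finrank_span_singleton hv0
    rw [Nat.card_eq_one_iff_unique]
    refine ⟨⟨?_⟩, ⟨⟨⟨orthExtend hB hW (negOne (hB.restrict hW)), ?_, ?_⟩, ?_⟩⟩⟩
    · rintro ⟨a, hav⟩ ⟨b, hbv⟩
      simp only at hav hbv
      have hneg : ∀ c : OrthInvolution B (2 * k), orthEnd c.1 v = v → ∀ u ∈ B.orthogonal U,
          orthEnd c.1 u = -u := by
        intro c hc u hu
        rw [← (fixedSpace_of_involution hB h2 c.2.1).2, ← Submodule.eq_of_le_of_finrank_eq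
          ((Submodule.span_singleton_le_iff_mem v _).2 (mem_fixedSpace.2 hc)) (by
            rw [hfix, ← hU1])]
        exact hu
      refine Subtype.ext (Subtype.ext (orthGroup_ext_of_nondegOn hB hU (fun u hu => ?_)
        fun u hu => ?_))
      · obtain ⟨s, rfl⟩ := Submodule.mem_span_singleton.1 hu
        rw [map_smul, map_smul, hav, hbv]
      · rw [hneg a hav u hu, hneg b hbv u hu]
    · rw [← map_mul, negOne_mul_self, map_one]
    · rw [finrank_negSpace_orthExtend hB h2]
      have h3 : negSpace (negOne (hB.restrict hW)) = ⊤ :=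
        eq_top_iff.2 fun x _ => mem_negSpace.2 (orthEnd_negOne _ x)
      rw [h3, finrank_top]
      have := hB.finrank_orthogonal_add hU
      omega
    · exact orthExtend_apply_orthogonal hB hW _ (hB.le_orthogonal_orthogonal hvU)

omit [FiniteDimensional F V] in
theorem card_hypPair_fixed (a : orthGroup B) :
    Nat.card {p : {p // IsHypPair B p} // orthEnd a p.1.1 = p.1.1 ∧ orthEnd a p.1.2 = p.1.2} =
      Nat.card {p // IsHypPair (B.restrict (fixedSpace a)) p} :=
  Nat.card_congr
    { toFun := fun p => ⟨(⟨p.1.1.1, mem_fixedSpace.2 p.2.1⟩, ⟨p.1.1.2, mem_fixedSpace.2 p.2.2⟩),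
        p.1.2⟩
      invFun := fun p => ⟨⟨(p.1.1, p.1.2), p.2⟩, mem_fixedSpace.1 p.1.1.2, mem_fixedSpace.1 p.1.2.2⟩
      left_inv := fun _ => rfl
      right_inv := fun _ => rfl }

end InvolutionCount

section InvolutionTotal

theorem gbinom_self {q : ℝ} (hq : 1 < q) (k : ℕ) : gbinom k k q = 1 := by
  refine Finset.prod_eq_one fun i hi => ?_
  have h1 : q ^ i ≠ 1 := (one_lt_pow₀ hq (by have := (Finset.mem_Icc.1 hi).1; omega)).ne'
  rw [Nat.sub_self, zero_add, div_self (sub_ne_zero.2 h1)]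

theorem gbinom_succ_mul (q : ℝ) (k l : ℕ) :
    gbinom (k + (l + 1)) k q * (q ^ (l + 1) - 1) =
      (q ^ (k + (l + 1)) - 1) * gbinom (k + l) k q := by
  have h : ∀ l, k + l - k = l := fun l => by omega
  simp only [gbinom, h, Finset.prod_div_distrib, div_mul_eq_mul_div, mul_div_assoc']
  congr 1
  induction k with
  | zero => simp
  | succ k ih =>
    rw [Finset.prod_Icc_succ_top (by omega), Finset.prod_Icc_succ_top (by omega), mul_right_comm,
      ih (fun l => by omega), show l + 1 + (k + 1) = k + 1 + (l + 1) by ring,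
      show l + (k + 1) = k + (l + 1) by ring]
    ring

variable {F : Type} [Field F] [Finite F]

theorem card_orthInvolution (h2 : (2 : F) ≠ 0) (k l : ℕ) :
    ∀ {V : Type} [AddCommGroup V] [Module F V] [FiniteDimensional F V]
      {B : LinearMap.BilinForm F V} (_ : SymmNondeg B)
      (_ : Module.finrank F V = 2 * (k + l) + 1),
      (Nat.card (OrthInvolution B (2 * k)) : ℝ) =
        (Nat.card F : ℝ) ^ (2 * k * (l + 1)) * gbinom (k + l) k ((Nat.card F : ℝ) ^ 2) := by
  have hq1 : (1 : ℝ) < Nat.card F := by exact_mod_cast Finite.one_lt_card (α := F)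
  have hq0 : (Nat.card F : ℝ) ≠ 0 := by positivity
  induction l with
  | zero =>
    intro V _ _ _ B hB hn
    rw [card_involution_corank_one (k := k) hB h2 hn, add_zero, gbinom_self (one_lt_pow₀ hq1 two_ne_zero)]
    simp
  | succ l ih =>
    intro V _ _ _ B hB hn
    have : Finite V := Module.finite_of_finite F
    have hfix : ∀ a : OrthInvolution B (2 * k), Module.finrank F (fixedSpace a.1) = 2 * (l + 1) + 1 :=
      fun a => by
        have := finrank_negSpace_add_fixedSpace hB h2 a.2.1
        rw [a.2.2, hn] at this
        omega
    have hcast : ∀ r : ℕ, ((Nat.card F ^ (2 * r) - 1 : ℕ) : ℝ) = (Nat.card F : ℝ) ^ (2 * r) - 1 :=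
      fun r => by
        rw [Nat.cast_sub (Nat.one_le_pow _ _ Nat.card_pos)]
        simp
    have hpair : ∀ {V : Type} [AddCommGroup V] [Module F V] [FiniteDimensional F V]
        {B : LinearMap.BilinForm F V} (_ : SymmNondeg B) (r : ℕ)
        (_ : Module.finrank F V = 2 * r + 1), (Nat.card {p // IsHypPair B p} : ℝ) =
          ((Nat.card F : ℝ) ^ (2 * r) - 1) * (Nat.card F : ℝ) ^ (2 * r + 1) /
            (Nat.card F : ℝ) ^ 2 := by
      intro V _ _ _ B hB r hn
      rw [eq_div_iff (pow_ne_zero 2 hq0), ← hcast]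
      exact_mod_cast card_hypPair hB h2 hn
    have h3 := card_mul_eq_of_relation_real
      (fun (a : OrthInvolution B (2 * k)) (p : {p // IsHypPair B p}) =>
        orthEnd a.1 p.1.1 = p.1.1 ∧ orthEnd a.1 p.1.2 = p.1.2) _ _
      (fun a => by
        rw [card_hypPair_fixed, hpair (hB.restrict (fixedSpace_of_involution hB h2 a.2.1).1) (l + 1)
          (hfix a)])
      (fun p => by
        rw [card_involution_fixing_hypPair hB h2 (2 * k) p.2,
          ih (hB.restrict (hB.nondegOn_orthogonal (IsHypPair.nondegOn hB p.2)))
            (by have := IsHypPair.finrank_orthogonal hB p.2; omega)])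
    rw [hpair hB (k + (l + 1)) hn] at h3
    set q : ℝ := (Nat.card F : ℝ) with hq
    have hl : q ^ (2 * (l + 1)) - 1 ≠ 0 :=
      sub_ne_zero.2 (one_lt_pow₀ hq1 (by omega)).ne'
    have hg := gbinom_succ_mul (q ^ 2) k l
    rw [← pow_mul, ← pow_mul] at hg
    have h4 : q ^ (2 * (l + 1) + 1) ≠ 0 := pow_ne_zero _ hq0
    rw [mul_div_assoc', mul_comm_div, ← mul_div_assoc, div_left_inj' (pow_ne_zero 2 hq0)] at h3
    apply mul_right_cancel₀ hl
    apply mul_right_cancel₀ h4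
    rw [mul_assoc, h3, mul_assoc (q ^ _) (gbinom _ _ _), hg]
    ring

theorem sum_range_two_mul (f : ℕ → ℕ) (m : ℕ) :
    ∑ d ∈ Finset.range (2 * m), f d = ∑ k ∈ Finset.range m, (f (2 * k) + f (2 * k + 1)) := by
  induction m with
  | zero => rfl
  | succ m ih =>
    rw [show 2 * (m + 1) = 2 * m + 1 + 1 by ring, Finset.sum_range_succ, Finset.sum_range_succ, ih,
      Finset.sum_range_succ, add_assoc]

variable {V : Type} [AddCommGroup V] [Module F V] [FiniteDimensional F V]
  {B : LinearMap.BilinForm F V}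

omit [Finite F] in
theorem card_orthInvolution_compl (hB : SymmNondeg B) (h2 : (2 : F) ≠ 0) {d e : ℕ}
    (hde : d + e = Module.finrank F V) :
    Nat.card (OrthInvolution B d) = Nat.card (OrthInvolution B e) := by
  have hz := negOne_mul_self hB
  have hmul : ∀ a : orthGroup B, negOne hB * (negOne hB * a) = a := fun a => by
    rw [← mul_assoc, hz, one_mul]
  have key : ∀ (a : orthGroup B) (d e : ℕ), d + e = Module.finrank F V →
      a * a = 1 ∧ Module.finrank F (negSpace a) = d →
      negOne hB * a * (negOne hB * a) = 1 ∧ Module.finrank F (negSpace (negOne hB * a)) = e := by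
    rintro a d e hde ⟨h1, h3⟩
    constructor
    · rw [mul_assoc, ← mul_assoc a, negOne_comm, mul_assoc, h1, mul_one, hz]
    · have h4 := finrank_negSpace_add_fixedSpace hB h2 h1
      have h5 : negSpace (negOne hB * a) = fixedSpace a := Submodule.ext fun v => by
        rw [mem_negSpace, mem_fixedSpace, orthEnd_mul_apply, orthEnd_negOne, neg_inj]
      rw [h5]
      omega
  exact Nat.card_congr
    { toFun := fun a => ⟨negOne hB * a.1, key a.1 d e hde a.2⟩
      invFun := fun a => ⟨negOne hB * a.1, key a.1 e d ((add_comm e d).trans hde) a.2⟩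
      left_inv := fun a => Subtype.ext (hmul a.1)
      right_inv := fun a => Subtype.ext (hmul a.1) }

/-- The number of isometries `g` of a quadratic space of odd dimension such that `g² = 1`. -/
theorem card_involution (hB : SymmNondeg B) (h2 : (2 : F) ≠ 0) {m : ℕ}
    (hn : Module.finrank F V = 2 * m + 1) :
    (Nat.card {a : orthGroup B // a * a = 1} : ℝ) = 2 * ∑ k ∈ Finset.range (m + 1),
      (Nat.card F : ℝ) ^ (2 * k * (m - k + 1)) * gbinom m k ((Nat.card F : ℝ) ^ 2) := by
  have h1 : Nat.card {a : orthGroup B // a * a = 1} =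
      ∑ d ∈ Finset.range (2 * (m + 1)), Nat.card (OrthInvolution B d) := by
    have := Fintype.ofFinite (orthGroup B)
    have h3 := Finset.card_eq_sum_card_fiberwise
      (s := Finset.univ.filter fun a : orthGroup B => a * a = 1)
      (t := Finset.range (2 * (m + 1))) (f := fun a => Module.finrank F (negSpace a))
      (fun a _ => by
        have := Submodule.finrank_le (negSpace a)
        simp only [Finset.coe_range, Set.mem_Iio]
        omega)
    rw [Nat.card_eq_fintype_card, Fintype.card_subtype, h3]
    refine Finset.sum_congr rfl fun d _ => ?_
    rw [Finset.filter_filter, ← Fintype.card_subtype, ← Nat.card_eq_fintype_card]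
    rfl
  have h4 : Nat.card {a : orthGroup B // a * a = 1} =
      2 * ∑ k ∈ Finset.range (m + 1), Nat.card (OrthInvolution B (2 * k)) := by
    rw [h1, sum_range_two_mul, Finset.sum_add_distrib, two_mul, add_right_inj,
      ← Finset.sum_range_reflect]
    refine Finset.sum_congr rfl fun k hk => ?_
    have := Finset.mem_range.1 hk
    exact card_orthInvolution_compl hB h2 (by omega)
  rw [h4, Nat.cast_mul, Nat.cast_sum, Nat.cast_two]
  congr 1
  refine Finset.sum_congr rfl fun k hk => ?_
  obtain ⟨l, rfl⟩ := Nat.exists_eq_add_of_le (Nat.lt_succ_iff.1 (Finset.mem_range.1 hk))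
  rw [card_orthInvolution h2 k l hB hn, Nat.add_sub_cancel_left]

end InvolutionTotal

section Transfer

variable {F : Type} [Field F] {N : Type} [Fintype N] [DecidableEq N]

theorem symmNondeg_toBilin' {J : Matrix N N F} (hu : IsUnit J) (hs : Jᵀ = J) :
    SymmNondeg (Matrix.toBilin' J) := by
  refine ⟨fun v w => ?_, fun v hv => ?_⟩
  · rw [Matrix.toBilin'_apply', Matrix.toBilin'_apply', Matrix.dotProduct_mulVec, ← hs,
      Matrix.vecMul_transpose, dotProduct_comm, hs]
  · have h : v ᵥ* J = 0 := by
      refine dotProduct_eq_zero _ fun w => ?_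
      rw [← Matrix.dotProduct_mulVec, ← Matrix.toBilin'_apply', hv]
    exact Matrix.vecMul_injective_of_isUnit hu (h.trans (Matrix.zero_vecMul J).symm)

/-- Invertible matrices as linear automorphisms of the space of column vectors. -/
def glEquiv : GL N F ≃* ((N → F) ≃ₗ[F] (N → F)) :=
  Matrix.GeneralLinearGroup.toLin.trans
    (LinearMap.GeneralLinearGroup.generalLinearEquiv F (N → F))

theorem glEquiv_apply (g : GL N F) (v : N → F) :
    glEquiv g v = (g : Matrix N N F) *ᵥ v := rfl

theorem glEquiv_mem_orthGroup {J : Matrix N N F} {g : GL N F} :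
    glEquiv g ∈ orthGroup (Matrix.toBilin' J) ↔ g ∈ fixGroup J := by
  have h : ∀ v w, Matrix.toBilin' J (glEquiv g v) (glEquiv g w) =
      Matrix.toBilin' ((g : Matrix N N F)ᵀ * J * (g : Matrix N N F)) v w := fun v w => by
    rw [glEquiv_apply, glEquiv_apply, Matrix.toBilin'_apply', Matrix.toBilin'_apply',
      ← Matrix.mulVec_mulVec, ← Matrix.mulVec_mulVec, Matrix.dotProduct_mulVec v,
      Matrix.vecMul_transpose]
  change (∀ v w, _) ↔ (g : Matrix N N F)ᵀ * J * (g : Matrix N N F) = J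
  simp only [h]
  exact ⟨fun h => Matrix.toBilin'.injective (LinearMap.ext₂ h), fun h v w => by rw [h]⟩

/-- The matrices preserving `J` are the isometries of the associated bilinear form. -/
def fixGroupEquiv (J : Matrix N N F) : fixGroup J ≃* orthGroup (Matrix.toBilin' J) :=
  (glEquiv.subgroupMap (fixGroup J)).trans <| MulEquiv.subgroupCongr <| by
    ext g
    obtain ⟨a, rfl⟩ := glEquiv.surjective g
    rw [glEquiv_mem_orthGroup]
    exact Subgroup.mem_map_iff_mem glEquiv.injective

end Transfer

theorem two_ne_zero_of_odd_card {F : Type} [Field F] [Fintype F] (h : Odd (Fintype.card F)) :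
    (2 : F) ≠ 0 := by
  intro h2
  have : CharP F 2 := CharTwo.of_one_ne_zero_of_two_eq_zero one_ne_zero h2
  have hd : 2 ∣ Fintype.card F := (CharP.cast_eq_zero_iff F 2 _).1 (FiniteField.cast_card_eq_zero F)
  exact h.not_two_dvd_nat hd

theorem stmt_11 (m : ℕ) (q : ℕ) (hq : ∃ p r : ℕ, p.Prime ∧ Odd p ∧ 0 < r ∧ q = p ^ r)
    (F : Type) [Field F] [Fintype F] [DecidableEq F] (hF : Fintype.card F = q)
    (J : Matrix (Fin (2 * m + 1)) (Fin (2 * m + 1)) F) (hJunit : IsUnit J) (hJsymm : Jᵀ = J)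
    (κ : Type) [Fintype κ] (S : κ → FDRep ℂ ↥(fixGroup J))
    (hsimple : ∀ i, Simple (S i))
    (hdistinct : ∀ i j : κ, Nonempty (S i ≅ S j) → i = j)
    (hcomplete : ∀ ρ : FDRep ℂ ↥(fixGroup J), Simple ρ → ∃ i, Nonempty (ρ ≅ S i)) :
    ∑ j : κ, (Module.finrank ℂ (S j) : ℝ)
      = 2 * ∑ k ∈ Finset.range (m + 1),
          (q : ℝ) ^ (2 * k * (m - k + 1)) * gbinom m k ((q : ℝ) ^ 2) := by
  have h2 : (2 : F) ≠ 0 := by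
    obtain ⟨p, r, -, hp, -, rfl⟩ := hq
    exact two_ne_zero_of_odd_card (hF ▸ hp.pow)
  have hB := symmNondeg_toBilin' hJunit hJsymm
  let e := fixGroupEquiv J
  have hn : Module.finrank F (Fin (2 * m + 1) → F) = 2 * m + 1 := by simp
  have hG : NonnegFS (fixGroup J) := (nonnegFS_orthGroup h2 _ hB hn).of_mulEquiv e.symm
  have hinv : ∀ g : fixGroup J, ∃ t, t * g * t⁻¹ = g⁻¹ := fun g => by
    obtain ⟨t, h1, h3⟩ := exists_orth_involution hB h2 (e g)
    refine ⟨e.symm t, e.injective ?_⟩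
    rw [map_mul, map_mul, map_inv, map_inv, e.apply_symm_apply, inv_eq_of_mul_eq_one_right h1, h3]
  have hcard : Nat.card {g : fixGroup J // g * g = 1} =
      Nat.card {a : orthGroup (Matrix.toBilin' J) // a * a = 1} :=
    Nat.card_congr <| e.toEquiv.subtypeEquiv fun g => by
      rw [← e.injective.eq_iff, map_mul, map_one]
      rfl
  have h := card_involution hB h2 hn
  rw [Nat.card_eq_fintype_card (α := F), hF] at h
  rw [← h, ← hcard, ← sum_degree_eq_card_involution hG hinv S hsimple hdistinct hcomplete,
    Nat.cast_sum]

end
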